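/- arXiv:2602.19999 — 2 statements merged into one kernel-verified Lean document; each statement's English description precedes it below -/
import Mathlib

section
/- Let n ≥ 3, let q ≥ 0 and let p ∈ ℝ satisfy p ≤ 3√(n+6)/(2(n−2)). Then every positive classical solution u of Δu + |∇u|^q u^p = 0 on all of ℝ^n is constant. -/
open scoped BigOperators

/-- The Euclidean Laplacian of `u : ℝⁿ → ℝ`, defined as the sum of the second
partial derivatives in the coordinate directions. -/
noncomputable def elaplacian {n : ℕ} (u : EuclideanSpace ℝ (Fin n) → ℝ)
    (x : EuclideanSpace ℝ (Fin n)) : ℝ :=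
  ∑ i : Fin n, fderiv ℝ (fun y => fderiv ℝ u y (EuclideanSpace.single i 1)) x
    (EuclideanSpace.single i 1)

open Filter Topology Set

/-- The `i`-th partial derivative. -/
noncomputable def pd {n : ℕ} (i : Fin n) (w : EuclideanSpace ℝ (Fin n) → ℝ)
    (x : EuclideanSpace ℝ (Fin n)) : ℝ :=
  fderiv ℝ w x (EuclideanSpace.single i 1)

section PartialDerivatives

variable {n : ℕ} {w v : EuclideanSpace ℝ (Fin n) → ℝ} {x : EuclideanSpace ℝ (Fin n)} {i : Fin n}

theorem elaplacian_eq_sum_pd (w : EuclideanSpace ℝ (Fin n) → ℝ) (x : EuclideanSpace ℝ (Fin n)) :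
    elaplacian w x = ∑ i, pd i (pd i w) x := rfl

theorem pd_congr (h : w =ᶠ[𝓝 x] v) : pd i w x = pd i v x := by
  simp only [pd, h.fderiv_eq]

theorem pd_eventuallyEq (h : w =ᶠ[𝓝 x] v) : pd i w =ᶠ[𝓝 x] pd i v := by
  filter_upwards [h.eventually_nhds] with y hy using pd_congr hy

theorem elaplacian_congr (h : w =ᶠ[𝓝 x] v) : elaplacian w x = elaplacian v x := by
  simp only [elaplacian_eq_sum_pd]
  exact Finset.sum_congr rfl fun i _ => pd_congr (pd_eventuallyEq h)

theorem ContDiffAt.pd {m k : ℕ∞} (h : ContDiffAt ℝ k w x) (hmk : m + 1 ≤ k) :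
    ContDiffAt ℝ m (pd i w) x := by
  have : ContDiffAt ℝ m (fderiv ℝ w) x := h.fderiv_right (by exact_mod_cast hmk)
  exact this.clm_apply contDiffAt_const

theorem ContDiff.pd {m k : ℕ∞} (h : ContDiff ℝ k w) (hmk : m + 1 ≤ k) :
    ContDiff ℝ m (pd i w) :=
  contDiff_iff_contDiffAt.2 fun _ => h.contDiffAt.pd hmk

theorem pd_add (hw : DifferentiableAt ℝ w x) (hv : DifferentiableAt ℝ v x) :
    pd i (fun y => w y + v y) x = pd i w x + pd i v x := by
  simp [pd, fderiv_fun_add hw hv]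

theorem pd_mul (hw : DifferentiableAt ℝ w x) (hv : DifferentiableAt ℝ v x) :
    pd i (fun y => w y * v y) x = w x * pd i v x + v x * pd i w x := by
  simp [pd, fderiv_fun_mul hw hv]

theorem pd_comp {ψ : ℝ → ℝ} (hψ : DifferentiableAt ℝ ψ (w x)) (hw : DifferentiableAt ℝ w x) :
    pd i (fun y => ψ (w y)) x = deriv ψ (w x) * pd i w x := by
  have := (hψ.hasDerivAt.comp_hasFDerivAt x hw.hasFDerivAt).fderiv
  simp only [Function.comp_def] at this
  simp [pd, this]

theorem ContDiffAt.eventually_differentiableAt {k : ℕ∞} (h : ContDiffAt ℝ k w x) (hk : 1 ≤ k)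
    (hk' : k ≠ ⊤) : ∀ᶠ y in 𝓝 x, DifferentiableAt ℝ w y := by
  filter_upwards [h.eventually (by simpa using hk')] with y hy
  exact hy.differentiableAt (by exact_mod_cast (lt_of_lt_of_le zero_lt_one hk).ne')

theorem elaplacian_add (hw : ContDiffAt ℝ 2 w x) (hv : ContDiffAt ℝ 2 v x) :
    elaplacian (fun y => w y + v y) x = elaplacian w x + elaplacian v x := by
  simp only [elaplacian_eq_sum_pd, ← Finset.sum_add_distrib]
  refine Finset.sum_congr rfl fun i _ => ?_
  have h : pd i (fun y => w y + v y) =ᶠ[𝓝 x] fun y => pd i w y + pd i v y := by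
    filter_upwards [ContDiffAt.eventually_differentiableAt (k := 2) hw (by norm_num) (by simp),
      ContDiffAt.eventually_differentiableAt (k := 2) hv (by norm_num) (by simp)] with y h1 h2
      using pd_add h1 h2
  rw [pd_congr h, pd_add]
  · exact (ContDiffAt.pd (m := 1) (k := 2) hw (by norm_num)).differentiableAt (by norm_num)
  · exact (ContDiffAt.pd (m := 1) (k := 2) hv (by norm_num)).differentiableAt (by norm_num)

theorem elaplacian_comp {ψ : ℝ → ℝ} (hψ : ContDiffAt ℝ 2 ψ (w x)) (hw : ContDiffAt ℝ 2 w x) :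
    elaplacian (fun y => ψ (w y)) x =
      deriv ψ (w x) * elaplacian w x + deriv (deriv ψ) (w x) * ∑ i, pd i w x ^ 2 := by
  simp only [elaplacian_eq_sum_pd, Finset.mul_sum, ← Finset.sum_add_distrib]
  refine Finset.sum_congr rfl fun i _ => ?_
  have hψ' : DifferentiableAt ℝ (deriv ψ) (w x) := by
    have h1 : ContDiffAt ℝ 1 (fderiv ℝ ψ) (w x) := hψ.fderiv_right (by norm_num)
    have h2 : ContDiffAt ℝ 1 (fun y => fderiv ℝ ψ y 1) (w x) := h1.clm_apply contDiffAt_const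
    exact h2.differentiableAt (by norm_num)
  have hw1 : DifferentiableAt ℝ w x := hw.differentiableAt (by norm_num)
  have h : pd i (fun y => ψ (w y)) =ᶠ[𝓝 x] fun y => deriv ψ (w y) * pd i w y := by
    filter_upwards [ContDiffAt.eventually_differentiableAt (k := 2) hw (by norm_num) (by simp),
      hw.continuousAt.eventually (hψ.eventually (by simp))] with y h1 h2
    exact pd_comp (h2.differentiableAt (by norm_num)) h1
  have hd : DifferentiableAt ℝ (fun y => deriv ψ (w y)) x := hψ'.comp x hw1
  rw [pd_congr h, pd_mul hd
    ((ContDiffAt.pd (m := 1) (k := 2) hw (by norm_num)).differentiableAt (by norm_num)),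
    pd_comp hψ' hw1]
  ring

theorem pd_comm (hw : ContDiffAt ℝ 2 w x) (i j : Fin n) :
    pd i (pd j w) x = pd j (pd i w) x := by
  have hs : IsSymmSndFDerivAt ℝ w x := hw.isSymmSndFDerivAt (by simp)
  have hd : DifferentiableAt ℝ (fderiv ℝ w) x :=
    (hw.fderiv_right (m := 1) (by norm_num)).differentiableAt (by norm_num)
  have key : ∀ a b : Fin n, pd a (pd b w) x =
      fderiv ℝ (fderiv ℝ w) x (EuclideanSpace.single a 1) (EuclideanSpace.single b 1) := by
    intro a b
    unfold pd
    rw [fderiv_clm_apply hd (differentiableAt_const _)]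
    simp
  rw [key, key, hs.eq]

theorem pd_eq_deriv_line (hw : DifferentiableAt ℝ w x) :
    HasDerivAt (fun t : ℝ => w (x + t • EuclideanSpace.single i 1)) (pd i w x) 0 := by
  have h1 : HasDerivAt (fun t : ℝ => x + t • (EuclideanSpace.single i 1 : EuclideanSpace ℝ (Fin n)))
      (EuclideanSpace.single i 1) 0 := by
    simpa using ((hasDerivAt_id (0 : ℝ)).smul_const
      (EuclideanSpace.single i 1 : EuclideanSpace ℝ (Fin n))).const_add x
  have h2 : HasFDerivAt w (fderiv ℝ w x)
      (x + (0 : ℝ) • (EuclideanSpace.single i 1 : EuclideanSpace ℝ (Fin n))) := by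
    simpa using hw.hasFDerivAt
  exact h2.comp_hasDerivAt (0 : ℝ) h1

theorem IsLocalMax.pd_eq_zero (h : IsLocalMax w x) : pd i w x = 0 := by
  simp [pd, h.fderiv_eq_zero]

theorem IsLocalMax.pd_pd_nonpos (h : IsLocalMax w x) (hw : ContDiffAt ℝ 2 w x) :
    pd i (pd i w) x ≤ 0 := by
  by_contra! hpos
  set e : EuclideanSpace ℝ (Fin n) := EuclideanSpace.single i 1
  let φ : ℝ → ℝ := fun t => w (x + t • e)
  have hline : Tendsto (fun t : ℝ => x + t • e) (𝓝 0) (𝓝 x) := by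
    have : Continuous fun t : ℝ => x + t • e := by fun_prop
    simpa using this.tendsto 0
  have hdφ : ∀ᶠ t in 𝓝 (0 : ℝ), HasDerivAt φ (pd i w (x + t • e)) t := by
    filter_upwards [hline.eventually
      (ContDiffAt.eventually_differentiableAt (k := 2) hw (by norm_num) (by simp))] with t ht
    have h0 := pd_eq_deriv_line (i := i) ht
    have h1 : HasDerivAt (fun s : ℝ => w (x + t • e + s • e)) (pd i w (x + t • e)) (t - t) := by
      simpa using h0
    have h2 := h1.comp_sub_const t t
    refine h2.congr_of_eventuallyEq (Eventually.of_forall fun s => ?_)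
    simp only [φ]
    congr 1
    module
  have hder : deriv φ =ᶠ[𝓝 0] fun t => pd i w (x + t • e) := hdφ.mono fun t ht => ht.deriv
  have hdd : deriv (deriv φ) 0 = pd i (pd i w) x := by
    rw [hder.deriv_eq]
    exact (pd_eq_deriv_line
      ((ContDiffAt.pd (m := 1) (k := 2) hw (by norm_num)).differentiableAt (by norm_num))).deriv
  have hd0 : deriv φ 0 = 0 := by
    rw [hder.eq_of_nhds]; simpa using h.pd_eq_zero
  have hmin : IsLocalMin φ 0 :=
    isLocalMin_of_deriv_deriv_pos (hdd ▸ hpos) hd0 hdφ.self_of_nhds.continuousAt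
  have hconst : φ =ᶠ[𝓝 0] fun _ => φ 0 := by
    have hmax : ∀ᶠ t in 𝓝 (0 : ℝ), φ t ≤ φ 0 := by
      simpa [φ] using hline.eventually h
    filter_upwards [hmin, hmax] with t h1 h2 using le_antisymm h2 h1
  have : deriv (deriv φ) 0 = 0 := by
    have h1 : deriv φ =ᶠ[𝓝 0] fun _ => 0 := by
      filter_upwards [hconst.eventually_nhds] with t ht
      have ht' : φ =ᶠ[𝓝 t] fun _ => φ 0 := ht
      rw [ht'.deriv_eq]; simp
    rw [h1.deriv_eq]; simp
  linarith

theorem IsLocalMax.elaplacian_nonpos (h : IsLocalMax w x) (hw : ContDiffAt ℝ 2 w x) :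
    elaplacian w x ≤ 0 :=
  Finset.sum_nonpos fun _ _ => h.pd_pd_nonpos hw

end PartialDerivatives

/-- `w k` are `C²` near `x₀` and converge continuously, together with their partial derivatives and
Laplacians at `x₀`, to the function `a`, the vector `b` and the number `c`. This lets one
apply the second derivative test to `a`, with `c` in the role of `Δ a`, even if `a` is not `C²`. -/
structure ApproxJet {n : ℕ} (w : ℕ → EuclideanSpace ℝ (Fin n) → ℝ)
    (x₀ : EuclideanSpace ℝ (Fin n)) (a : EuclideanSpace ℝ (Fin n) → ℝ) (b : Fin n → ℝ)
    (c : ℝ) : Prop where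
  continuousAt : ContinuousAt a x₀
  tendsto : ∀ᶠ x in 𝓝 x₀, Tendsto (fun z : ℕ × EuclideanSpace ℝ (Fin n) => w z.1 z.2)
    (atTop ×ˢ 𝓝 x) (𝓝 (a x))
  contDiffAt : ∀ᶠ z : ℕ × EuclideanSpace ℝ (Fin n) in atTop ×ˢ 𝓝 x₀,
    ContDiffAt ℝ 2 (w z.1) z.2
  tendsto_pd : ∀ i, Tendsto (fun z : ℕ × EuclideanSpace ℝ (Fin n) => pd i (w z.1) z.2)
    (atTop ×ˢ 𝓝 x₀) (𝓝 (b i))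
  tendsto_lap : Tendsto (fun z : ℕ × EuclideanSpace ℝ (Fin n) => elaplacian (w z.1) z.2)
    (atTop ×ˢ 𝓝 x₀) (𝓝 c)

namespace ApproxJet

variable {n : ℕ} {w v : ℕ → EuclideanSpace ℝ (Fin n) → ℝ} {x₀ : EuclideanSpace ℝ (Fin n)}
  {a a' : EuclideanSpace ℝ (Fin n) → ℝ} {b b' : Fin n → ℝ} {c c' : ℝ}

theorem of_contDiff {f : EuclideanSpace ℝ (Fin n) → ℝ} (hf : ContDiff ℝ 2 f) :
    ApproxJet (fun _ => f) x₀ f (fun i => pd i f x₀) (elaplacian f x₀) where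
  continuousAt := hf.continuous.continuousAt
  tendsto := Eventually.of_forall fun x => (hf.continuous.tendsto x).comp tendsto_snd
  contDiffAt := Eventually.of_forall fun _ => hf.contDiffAt
  tendsto_pd i := ((ContDiff.pd (m := 1) (k := 2) hf (by norm_num)).continuous.tendsto x₀).comp
    tendsto_snd
  tendsto_lap := by
    have : Continuous (elaplacian f) := by
      have h : elaplacian f = fun x => ∑ i, pd i (pd i f) x := funext fun _ => rfl
      rw [h]
      exact continuous_finsetSum _ fun i _ => (ContDiff.pd (m := 0) (k := 1)
        (ContDiff.pd (m := 1) (k := 2) hf (by norm_num)) (by norm_num)).continuous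
    exact (this.tendsto x₀).comp tendsto_snd

theorem add (hw : ApproxJet w x₀ a b c) (hv : ApproxJet v x₀ a' b' c') :
    ApproxJet (fun k x => w k x + v k x) x₀ (fun x => a x + a' x) (fun i => b i + b' i)
      (c + c') where
  continuousAt := hw.continuousAt.add hv.continuousAt
  tendsto := by
    filter_upwards [hw.tendsto, hv.tendsto] with x h1 h2 using h1.add h2
  contDiffAt := by
    filter_upwards [hw.contDiffAt, hv.contDiffAt] with z h1 h2 using h1.add h2
  tendsto_pd i := by
    refine ((hw.tendsto_pd i).add (hv.tendsto_pd i)).congr' ?_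
    filter_upwards [hw.contDiffAt, hv.contDiffAt] with z h1 h2
    exact (pd_add (h1.differentiableAt (by norm_num)) (h2.differentiableAt (by norm_num))).symm
  tendsto_lap := by
    refine (hw.tendsto_lap.add hv.tendsto_lap).congr' ?_
    filter_upwards [hw.contDiffAt, hv.contDiffAt] with z h1 h2 using (elaplacian_add h1 h2).symm

theorem comp {ψ : ℝ → ℝ} (hw : ApproxJet w x₀ a b c) (hψ : ContDiffAt ℝ 2 ψ (a x₀)) :
    ApproxJet (fun k x => ψ (w k x)) x₀ (fun x => ψ (a x)) (fun i => deriv ψ (a x₀) * b i)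
      (deriv ψ (a x₀) * c + deriv (deriv ψ) (a x₀) * ∑ i, b i ^ 2) := by
  have hev : ∀ᶠ y in 𝓝 (a x₀), ContDiffAt ℝ 2 ψ y := hψ.eventually (by simp)
  have h0 := hw.tendsto.self_of_nhds
  have hcd := h0.eventually hev
  have h1 : ContDiffAt ℝ 1 (deriv ψ) (a x₀) := by
    have h1 : ContDiffAt ℝ 1 (fderiv ℝ ψ) (a x₀) := hψ.fderiv_right (by norm_num)
    exact h1.clm_apply contDiffAt_const
  have h2 : ContDiffAt ℝ 0 (deriv (deriv ψ)) (a x₀) := by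
    have h2 : ContDiffAt ℝ 0 (fderiv ℝ (deriv ψ)) (a x₀) := h1.fderiv_right (by norm_num)
    exact h2.clm_apply contDiffAt_const
  have t1 := h1.continuousAt.tendsto.comp h0
  have t2 := h2.continuousAt.tendsto.comp h0
  refine ⟨hψ.continuousAt.comp hw.continuousAt, ?_, ?_, fun i => ?_, ?_⟩
  · filter_upwards [hw.tendsto, hw.continuousAt.eventually hev] with x hx hx'
    exact hx'.continuousAt.tendsto.comp hx
  · filter_upwards [hw.contDiffAt, hcd] with z h1 h2 using h2.comp z.2 h1
  · refine (t1.mul (hw.tendsto_pd i)).congr' ?_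
    filter_upwards [hw.contDiffAt, hcd] with z h1 h2
    exact (pd_comp (h2.differentiableAt (by norm_num)) (h1.differentiableAt (by norm_num))).symm
  · refine ((t1.mul hw.tendsto_lap).add
      (t2.mul (tendsto_finsetSum _ fun i _ => (hw.tendsto_pd i).pow 2))).congr' ?_
    filter_upwards [hw.contDiffAt, hcd] with z h1 h2 using (elaplacian_comp h2 h1).symm

theorem const_mul (hw : ApproxJet w x₀ a b c) (r : ℝ) :
    ApproxJet (fun k x => r * w k x) x₀ (fun x => r * a x) (fun i => r * b i) (r * c) := by
  have h := hw.comp (ψ := fun t => r * t) (by fun_prop)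
  have h1 : deriv (fun t : ℝ => r * t) = fun _ => r := by
    funext t; simp
  simpa [h1] using h

theorem log (hw : ApproxJet w x₀ a b c) (h0 : a x₀ ≠ 0) :
    ApproxJet (fun k x => Real.log (w k x)) x₀ (fun x => Real.log (a x)) (fun i => b i / a x₀)
      (c / a x₀ - (∑ i, b i ^ 2) / a x₀ ^ 2) := by
  have h := hw.comp (ψ := Real.log) (Real.contDiffAt_log.2 h0)
  have h1 : deriv Real.log = fun x => x⁻¹ := by funext x; simp
  convert h using 1
  · funext i; simp; ring
  · simp [h1]; ring

theorem sub_const_sq (hw : ApproxJet w x₀ a b c) (r : ℝ) :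
    ApproxJet (fun k x => (w k x - r) ^ 2) x₀ (fun x => (a x - r) ^ 2)
      (fun i => 2 * (a x₀ - r) * b i) (2 * (a x₀ - r) * c + 2 * ∑ i, b i ^ 2) := by
  have h := hw.comp (ψ := fun t => (t - r) ^ 2) (by fun_prop)
  have h1 : deriv (fun t : ℝ => (t - r) ^ 2) = fun t => 2 * (t - r) := by
    funext t; simp
  have h2 : deriv (fun t : ℝ => 2 * (t - r)) = fun _ => 2 := by
    funext t; simp
  simpa only [h1, h2] using h

theorem sum {ι : Type*} (s : Finset ι) {w : ι → ℕ → EuclideanSpace ℝ (Fin n) → ℝ}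
    {a : ι → EuclideanSpace ℝ (Fin n) → ℝ} {b : ι → Fin n → ℝ} {c : ι → ℝ}
    (h : ∀ j ∈ s, ApproxJet (w j) x₀ (a j) (b j) (c j)) :
    ApproxJet (fun k x => ∑ j ∈ s, w j k x) x₀ (fun x => ∑ j ∈ s, a j x)
      (fun i => ∑ j ∈ s, b j i) (∑ j ∈ s, c j) := by
  classical
  induction s using Finset.induction_on with
  | empty =>
    have h0 := of_contDiff (x₀ := x₀) (f := fun _ : EuclideanSpace ℝ (Fin n) => (0 : ℝ))
      contDiff_const
    simpa [pd, elaplacian] using h0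
  | insert j s hj ih =>
    simp only [Finset.sum_insert hj]
    exact (h j (by simp)).add (ih fun i hi => h i (by simp [hi]))

theorem congr_limit (hw : ApproxJet w x₀ a b c) (ha : a' =ᶠ[𝓝 x₀] a) (hb : b' = b) (hc : c' = c) :
    ApproxJet w x₀ a' b' c' := by
  subst hb hc
  refine ⟨hw.continuousAt.congr ha.symm, ?_, hw.contDiffAt, hw.tendsto_pd, hw.tendsto_lap⟩
  filter_upwards [hw.tendsto, ha] with x h1 h2
  rwa [h2]

theorem of_strict_isLocalMax (hw : ApproxJet w x₀ a b c)
    (hmax : ∀ᶠ x in 𝓝 x₀, x ≠ x₀ → a x < a x₀) : (∀ i, b i = 0) ∧ c ≤ 0 := by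
  obtain ⟨P, hP, Q, hQ, hPQ⟩ := eventually_prod_iff.1 hw.contDiffAt
  obtain ⟨K, hK⟩ := eventually_atTop.1 hP
  obtain ⟨ρ, hρ, hball⟩ := Metric.nhds_basis_closedBall.eventually_iff.1
    ((hw.tendsto.and hmax).and hQ)
  have hcd : ∀ k ≥ K, ∀ y ∈ Metric.closedBall x₀ ρ, ContDiffAt ℝ 2 (w k) y :=
    fun k hk y hy => hPQ (hK k hk) (hball hy).2
  have hex : ∀ k, ∃ y ∈ Metric.closedBall x₀ ρ, K ≤ k →
      IsMaxOn (w k) (Metric.closedBall x₀ ρ) y := by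
    intro k
    by_cases hk : K ≤ k
    · obtain ⟨y, hy, hym⟩ := (isCompact_closedBall x₀ ρ).exists_isMaxOn
        ⟨x₀, Metric.mem_closedBall_self hρ.le⟩
        (fun y hy => (hcd k hk y hy).continuousAt.continuousWithinAt)
      exact ⟨y, hy, fun _ => hym⟩
    · exact ⟨x₀, Metric.mem_closedBall_self hρ.le, fun h => absurd h hk⟩
  choose y hyb hym using hex
  obtain ⟨z, hz, φ, hφ, hlim⟩ := (isCompact_closedBall x₀ ρ).tendsto_subseq hyb
  have hpair : Tendsto (fun k => (φ k, y (φ k))) atTop (atTop ×ˢ 𝓝 z) :=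
    hφ.tendsto_atTop.prodMk hlim
  have hpair0 : Tendsto (fun k => (φ k, x₀)) atTop (atTop ×ˢ 𝓝 x₀) :=
    hφ.tendsto_atTop.prodMk tendsto_const_nhds
  have hge : a x₀ ≤ a z := by
    refine le_of_tendsto_of_tendsto (hw.tendsto.self_of_nhds.comp hpair0)
      ((hball hz).1.1.comp hpair) ?_
    filter_upwards [hφ.tendsto_atTop.eventually_ge_atTop K] with k hk
    exact hym (φ k) hk (Metric.mem_closedBall_self hρ.le)
  have hzx : z = x₀ := by
    by_contra hne
    exact absurd ((hball hz).1.2 hne) (not_lt.2 hge)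
  subst hzx
  have hloc : ∀ᶠ k in atTop, IsLocalMax (w (φ k)) (y (φ k)) := by
    filter_upwards [hφ.tendsto_atTop.eventually_ge_atTop K,
      hlim.eventually (Metric.ball_mem_nhds z hρ)] with k hk hk'
    exact (hym (φ k) hk).isLocalMax (mem_of_superset (Metric.isOpen_ball.mem_nhds hk')
      Metric.ball_subset_closedBall)
  refine ⟨fun i => ?_, ?_⟩
  · refine tendsto_nhds_unique ((hw.tendsto_pd i).comp hpair)
      (tendsto_const_nhds.congr' ?_)
    filter_upwards [hloc] with k hk using hk.pd_eq_zero.symm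
  · refine le_of_tendsto (hw.tendsto_lap.comp hpair) ?_
    filter_upwards [hloc, hpair.eventually hw.contDiffAt] with k hk hk'
    exact hk.elaplacian_nonpos hk'

theorem of_isLocalMax (hw : ApproxJet w x₀ a b c) (hmax : IsLocalMax a x₀) :
    (∀ i, b i = 0) ∧ c ≤ 0 := by
  let N : EuclideanSpace ℝ (Fin n) → ℝ := fun y => -‖y - x₀‖ ^ 2
  have hN : ContDiff ℝ 2 N := ((contDiff_id.sub contDiff_const).norm_sq ℝ).neg
  have hN0 : ∀ i, pd i N x₀ = 0 := fun i => by
    refine IsLocalMax.pd_eq_zero (Eventually.of_forall fun y => ?_)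
    simp only [N, sub_self, norm_zero]
    nlinarith [sq_nonneg ‖y - x₀‖]
  have key : ∀ δ > 0, (∀ i, b i = 0) ∧ c + δ * elaplacian N x₀ ≤ 0 := by
    intro δ hδ
    have h := (hw.add ((of_contDiff (x₀ := x₀) hN).const_mul δ)).of_strict_isLocalMax (by
      filter_upwards [hmax] with y hy hne
      have : 0 < ‖y - x₀‖ := norm_pos_iff.2 (sub_ne_zero.2 hne)
      have : 0 < δ * ‖y - x₀‖ ^ 2 := by positivity
      simp only [N, sub_self, norm_zero]
      linarith)
    simpa [hN0] using h
  refine ⟨(key 1 one_pos).1, ?_⟩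
  have hlim : Tendsto (fun δ : ℝ => c + δ * elaplacian N x₀) (𝓝[>] 0) (𝓝 c) := by
    have : Continuous fun δ : ℝ => c + δ * elaplacian N x₀ := by fun_prop
    simpa using (this.tendsto 0).mono_left nhdsWithin_le_nhds
  exact le_of_tendsto hlim (eventually_mem_nhdsWithin.mono fun δ hδ => (key δ hδ).2)

end ApproxJet

section Mollification

open MeasureTheory ContinuousLinearMap
open scoped Convolution

variable {n : ℕ}

/-- A sequence of smooth bumps shrinking to the origin. -/
noncomputable def bumpSeq (n k : ℕ) : ContDiffBump (0 : EuclideanSpace ℝ (Fin n)) where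
  rIn := 1 / (2 * ((k : ℝ) + 1))
  rOut := 1 / ((k : ℝ) + 1)
  rIn_pos := by positivity
  rIn_lt_rOut := by
    apply one_div_lt_one_div_of_lt <;> linarith [(Nat.cast_nonneg k : (0 : ℝ) ≤ k)]

theorem tendsto_bumpSeq_rOut : Tendsto (fun k => (bumpSeq n k).rOut) atTop (𝓝 0) :=
  tendsto_one_div_add_atTop_nhds_zero_nat

/-- Mollification at scale `1 / (k + 1)`. -/
noncomputable def mollify (k : ℕ) (v : EuclideanSpace ℝ (Fin n) → ℝ) :
    EuclideanSpace ℝ (Fin n) → ℝ :=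
  (bumpSeq n k).normed volume ⋆[lsmul ℝ ℝ, volume] v

variable {v w : EuclideanSpace ℝ (Fin n) → ℝ}

theorem contDiff_mollify {m : ℕ∞} (hv : Continuous v) (k : ℕ) : ContDiff ℝ m (mollify k v) :=
  (bumpSeq n k).hasCompactSupport_normed.contDiff_convolution_left _
    (bumpSeq n k).contDiff_normed hv.locallyIntegrable

theorem tendsto_mollify (hv : Continuous v) (x : EuclideanSpace ℝ (Fin n)) :
    Tendsto (fun z : ℕ × EuclideanSpace ℝ (Fin n) => mollify z.1 v z.2) (atTop ×ˢ 𝓝 x)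
      (𝓝 (v x)) :=
  ContDiffBump.convolution_tendsto_right (φ := fun z : ℕ × EuclideanSpace ℝ (Fin n) =>
    bumpSeq n z.1) (g := fun _ => v) (k := Prod.snd)
    (tendsto_bumpSeq_rOut.comp tendsto_fst)
    (Eventually.of_forall fun _ => hv.aestronglyMeasurable)
    ((hv.tendsto x).comp tendsto_snd) tendsto_snd

theorem pd_mollify (hc : HasCompactSupport v) (hv : ContDiff ℝ 1 v) (k : ℕ) (i : Fin n) :
    pd i (mollify k v) = mollify k (pd i v) := by
  funext x
  have h := hc.hasFDerivAt_convolution_right (lsmul ℝ ℝ)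
    ((bumpSeq n k).continuous_normed (μ := volume)).locallyIntegrable hv x (μ := volume)
  have h' := congrArg (fun T => T (EuclideanSpace.single i 1)) h.fderiv
  refine h'.trans ?_
  rw [convolution_precompR_apply]
  · rfl
  · exact (bumpSeq n k).continuous_normed.locallyIntegrable
  · exact hc.fderiv (𝕜 := ℝ)
  · exact hv.continuous_fderiv (by norm_num)

theorem mollify_congr {x : EuclideanSpace ℝ (Fin n)} {k : ℕ}
    (h : ∀ y ∈ Metric.ball x (bumpSeq n k).rOut, v y = w y) : mollify k v x = mollify k w x := by
  simp only [mollify, convolution_def]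
  refine integral_congr_ae (Eventually.of_forall fun t => ?_)
  by_cases ht : t ∈ Function.support ((bumpSeq n k).normed volume)
  · rw [(bumpSeq n k).support_normed_eq, mem_ball_zero_iff] at ht
    simp only
    rw [h (x - t) (by simpa [Metric.mem_ball, dist_eq_norm] using ht)]
  · rw [Function.notMem_support] at ht
    simp [ht]

theorem mollify_eventuallyEq {x : EuclideanSpace ℝ (Fin n)} (h : v =ᶠ[𝓝 x] w) :
    ∀ᶠ z : ℕ × EuclideanSpace ℝ (Fin n) in atTop ×ˢ 𝓝 x,
      mollify z.1 v =ᶠ[𝓝 z.2] mollify z.1 w := by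
  obtain ⟨ρ, hρ, hb⟩ := Metric.eventually_nhds_iff_ball.1 h
  have h1 : ∀ᶠ k in atTop, (bumpSeq n k).rOut < ρ / 2 :=
    tendsto_bumpSeq_rOut.eventually (gt_mem_nhds (by positivity))
  filter_upwards [h1.prod_mk (Metric.ball_mem_nhds x (half_pos hρ))] with z hz
  filter_upwards [Metric.isOpen_ball.mem_nhds hz.2] with y hy
  refine mollify_congr fun t ht => hb t ?_
  rw [Metric.mem_ball] at *
  linarith [dist_triangle t y x, hz.1]

theorem HasCompactSupport.pd (hc : HasCompactSupport v) (i : Fin n) :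
    HasCompactSupport (_root_.pd i v) :=
  HasCompactSupport.comp_left (g := fun T : EuclideanSpace ℝ (Fin n) →L[ℝ] ℝ =>
    T (EuclideanSpace.single i 1)) (hc.fderiv (𝕜 := ℝ)) (by simp)

theorem elaplacian_mollify (hc : HasCompactSupport v) (hv : ContDiff ℝ 2 v) (k : ℕ) :
    elaplacian (mollify k v) = mollify k (elaplacian v) := by
  have hv1 : ContDiff ℝ 1 v := hv.of_le (by norm_num)
  have hpd : ∀ i, ContDiff ℝ 1 (pd i v) := fun i => ContDiff.pd (m := 1) (k := 2) hv (by norm_num)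
  have h : ∀ i, pd i (pd i (mollify k v)) = mollify k (pd i (pd i v)) := fun i => by
    rw [pd_mollify hc hv1, pd_mollify (hc.pd i) (hpd i)]
  funext x
  rw [elaplacian_eq_sum_pd]
  simp only [h]
  simp only [mollify, convolution_def]
  rw [← integral_finsetSum]
  · refine integral_congr_ae (Eventually.of_forall fun t => ?_)
    simp [elaplacian_eq_sum_pd]
  · intro i _
    have hcont : Continuous (pd i (pd i v)) :=
      (ContDiff.pd (m := 0) (k := 1) (hpd i) (by norm_num)).continuous
    refine Continuous.integrable_of_hasCompactSupport ?_ ?_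
    · have := (bumpSeq n k).continuous_normed (μ := volume)
      simp only [lsmul_apply, smul_eq_mul]
      fun_prop
    · have := (bumpSeq n k).hasCompactSupport_normed (μ := volume)
      simp only [lsmul_apply, smul_eq_mul]
      exact this.mul_right

theorem exists_cutoff (x₀ : EuclideanSpace ℝ (Fin n)) {s : Set (EuclideanSpace ℝ (Fin n))}
    (hs : s ∈ 𝓝 x₀) : ∃ χ : EuclideanSpace ℝ (Fin n) → ℝ, ContDiff ℝ 2 χ ∧ HasCompactSupport χ ∧
      tsupport χ ⊆ s ∧ χ =ᶠ[𝓝 x₀] 1 := by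
  obtain ⟨ρ, hρ, hb⟩ := Metric.nhds_basis_closedBall.mem_iff.1 hs
  let χ : ContDiffBump x₀ := ⟨ρ / 2, ρ, by positivity, by linarith⟩
  exact ⟨χ, χ.contDiff, χ.hasCompactSupport, by rw [χ.tsupport_eq]; exact hb,
    χ.eventuallyEq_one⟩

/-- A `C²` function whose Laplacian is `C¹` near `x₀` admits approximations which also
approximate the Laplacians of its partial derivatives. -/
theorem exists_approxJet {f : EuclideanSpace ℝ (Fin n) → ℝ} {x₀ : EuclideanSpace ℝ (Fin n)}
    (hf : ContDiff ℝ 2 f) (hlap : ContDiffAt ℝ 1 (elaplacian f) x₀) :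
    ∃ w : ℕ → EuclideanSpace ℝ (Fin n) → ℝ,
      ApproxJet w x₀ f (fun i => pd i f x₀) (elaplacian f x₀) ∧
      ∀ j, ApproxJet (fun k => pd j (w k)) x₀ (pd j f) (fun i => pd i (pd j f) x₀)
        (pd j (elaplacian f) x₀) := by
  obtain ⟨χ, hχ, hχc, -, hχ1⟩ := exists_cutoff x₀ univ_mem
  set v : EuclideanSpace ℝ (Fin n) → ℝ := fun x => χ x * f x with hvdef
  have hvf : v =ᶠ[𝓝 x₀] f := by
    filter_upwards [hχ1] with x hx
    simp [hvdef, hx]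
  have hv : ContDiff ℝ 2 v := hχ.mul hf
  have hvc : HasCompactSupport v := hχc.mul_right
  have hv1 : ContDiff ℝ 1 v := hv.of_le (by norm_num)
  have hpd : ∀ i, ContDiff ℝ 1 (pd i v) := fun i => ContDiff.pd (m := 1) (k := 2) hv (by norm_num)
  have hpd2 : ∀ i j, Continuous (pd i (pd j v)) := fun i j =>
    (ContDiff.pd (m := 0) (k := 1) (hpd j) (by norm_num)).continuous
  have hL : Continuous (elaplacian v) := by
    have h : elaplacian v = fun x => ∑ i, pd i (pd i v) x := funext fun _ => rfl
    rw [h]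
    exact continuous_finsetSum _ fun i _ => hpd2 i i
  have hsm : ∀ k, ContDiff ℝ 3 (mollify k v) := fun k =>
    contDiff_mollify (m := 3) hv.continuous k
  obtain ⟨ζ, hζ, hζc, hζs, hζ1⟩ := exists_cutoff x₀ (hlap.eventually (by simp))
  set g : EuclideanSpace ℝ (Fin n) → ℝ := fun x => ζ x * elaplacian f x with hgdef
  have hg : ContDiff ℝ 1 g := by
    refine contDiff_iff_contDiffAt.2 fun x => ?_
    by_cases hx : x ∈ tsupport ζ
    · exact (hζ.contDiffAt.of_le (by norm_num)).mul (hζs hx)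
    · have : g =ᶠ[𝓝 x] fun _ => 0 := by
        filter_upwards [(isClosed_tsupport ζ).isOpen_compl.mem_nhds hx] with y hy
        simp [hgdef, image_eq_zero_of_notMem_tsupport hy]
      exact contDiffAt_const.congr_of_eventuallyEq this
  have hgc : HasCompactSupport g := hζc.mul_right
  have hgL : elaplacian v =ᶠ[𝓝 x₀] g := by
    filter_upwards [hvf.eventually_nhds, hζ1] with x hx hx'
    rw [elaplacian_congr hx]
    simp [hgdef, hx']
  have hgf : g =ᶠ[𝓝 x₀] elaplacian f := by
    filter_upwards [hζ1] with x hx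
    simp [hgdef, hx]
  refine ⟨fun k => mollify k v, ⟨hf.continuous.continuousAt, ?_, ?_, fun i => ?_, ?_⟩,
    fun j => ⟨?_, ?_, ?_, fun i => ?_, ?_⟩⟩
  · filter_upwards [hvf] with x hx
    rw [← hx]
    exact tendsto_mollify hv.continuous x
  · exact Eventually.of_forall fun z => (hsm z.1).contDiffAt.of_le (by norm_num)
  · simp only [pd_mollify hvc hv1, ← pd_congr hvf]
    exact tendsto_mollify (hpd i).continuous x₀
  · simp only [elaplacian_mollify hvc hv, ← elaplacian_congr hvf]
    exact tendsto_mollify hL x₀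
  · exact (ContDiff.pd (m := 1) (k := 2) hf (by norm_num)).continuous.continuousAt
  · filter_upwards [hvf.eventually_nhds] with x hx
    simp only [pd_mollify hvc hv1, ← pd_congr hx]
    exact tendsto_mollify (hpd j).continuous x
  · exact Eventually.of_forall fun z =>
      (ContDiff.pd (m := 2) (k := 3) (hsm z.1) (by norm_num)).contDiffAt
  · simp only [pd_mollify hvc hv1, pd_mollify (hvc.pd j) (hpd j),
      ← pd_congr (pd_eventuallyEq (i := j) hvf)]
    exact tendsto_mollify (hpd2 i j) x₀
  · rw [← pd_congr hgf]
    have hpg : Continuous (pd j g) := (ContDiff.pd (m := 0) (k := 1) hg (by norm_num)).continuous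
    refine (tendsto_mollify hpg x₀).congr' ?_
    filter_upwards [mollify_eventuallyEq hgL] with z hz
    rw [← pd_mollify hgc hg, ← pd_congr hz, ← elaplacian_mollify hvc hv]
    have hsm2 : ContDiff ℝ 2 (mollify z.1 v) := (hsm z.1).of_le (by norm_num)
    have hsmi : ∀ i, ContDiff ℝ 2 (pd i (mollify z.1 v)) := fun i =>
      ContDiff.pd (m := 2) (k := 3) (hsm z.1) (by norm_num)
    have e1 : pd j (elaplacian (mollify z.1 v)) z.2 =
        ∑ i, pd j (pd i (pd i (mollify z.1 v))) z.2 := by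
      have h : elaplacian (mollify z.1 v) = fun x => ∑ i, pd i (pd i (mollify z.1 v)) x :=
        funext fun _ => rfl
      rw [h, pd, fderiv_fun_sum]
      · simp [pd]
      · exact fun i _ => (ContDiff.pd (m := 1) (k := 2) (hsmi i)
          (by norm_num)).contDiffAt.differentiableAt (by norm_num)
    rw [e1, elaplacian_eq_sum_pd]
    refine Finset.sum_congr rfl fun i _ => ?_
    rw [pd_comm (hsmi i).contDiffAt]
    exact pd_congr (Eventually.of_forall fun x => pd_comm hsm2.contDiffAt j i)

end Mollification

section PointwiseAlgebra

variable {n : ℕ}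

theorem sq_trace_le_of_mulVec_eq_zero (hn : 2 ≤ n) {P : Fin n → ℝ} {B : Fin n → Fin n → ℝ} {s : ℝ}
    (hs : 0 < s) (hP : ∑ i, P i ^ 2 = s) (hBP : ∀ i, ∑ j, B i j * P j = 0) :
    (∑ i, B i i) ^ 2 / ((n : ℝ) - 1) ≤ ∑ i, ∑ j, B i j ^ 2 := by
  have hm : (0 : ℝ) < (n : ℝ) - 1 := by
    have : (2 : ℝ) ≤ n := by exact_mod_cast hn
    linarith
  set T := ∑ i, B i i with hT
  set l := T / ((n : ℝ) - 1) with hl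
  let E : Fin n → Fin n → ℝ := fun i j => (if i = j then 1 else 0) - P i * P j / s
  have hBE : ∑ i, ∑ j, B i j * E i j = T := by
    simp only [E, mul_sub, Finset.sum_sub_distrib]
    have h1 : ∀ i, ∑ j, B i j * (P i * P j / s) = 0 := fun i => by
      rw [show ∑ j, B i j * (P i * P j / s) = P i / s * ∑ j, B i j * P j by
        rw [Finset.mul_sum]; exact Finset.sum_congr rfl fun j _ => by ring, hBP, mul_zero]
    simp [h1, hT]
  have hEE : ∑ i, ∑ j, E i j ^ 2 = (n : ℝ) - 1 := by
    have h1 : ∀ i, ∑ j, E i j ^ 2 = 1 - P i ^ 2 / s := fun i => by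
      have h2 : ∀ j, E i j ^ 2 = (if i = j then 1 - 2 * (P i * P j / s) else 0)
          + P i ^ 2 / s ^ 2 * P j ^ 2 := fun j => by
        simp only [E]
        split_ifs <;> ring
      simp only [h2, Finset.sum_add_distrib, ← Finset.mul_sum, hP]
      simp
      field_simp
      ring
    simp only [h1, Finset.sum_sub_distrib, ← Finset.sum_div, hP]
    simp [hs.ne']
  have hpos : 0 ≤ ∑ i, ∑ j, (B i j - l * E i j) ^ 2 :=
    Finset.sum_nonneg fun _ _ => Finset.sum_nonneg fun _ _ => sq_nonneg _
  have hexp : ∑ i, ∑ j, (B i j - l * E i j) ^ 2 =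
      ∑ i, ∑ j, B i j ^ 2 - 2 * l * T + l ^ 2 * ((n : ℝ) - 1) := by
    rw [← hBE, ← hEE]
    simp only [Finset.mul_sum, ← Finset.sum_add_distrib, ← Finset.sum_sub_distrib]
    exact Finset.sum_congr rfl fun i _ => Finset.sum_congr rfl fun j _ => by ring
  have : 2 * l * T - l ^ 2 * ((n : ℝ) - 1) = T ^ 2 / ((n : ℝ) - 1) := by
    rw [hl]; field_simp; ring
  linarith

theorem hessian_sq_lower_bound (hn : 2 ≤ n) {P γ : Fin n → ℝ} {A : Fin n → Fin n → ℝ} {s L : ℝ}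
    (hs : 0 < s) (hP : ∑ i, P i ^ 2 = s) (hA : ∀ i, ∑ j, 2 * P j * A i j = s * γ i)
    (hL : ∑ i, A i i = L) :
    s * (∑ i, γ i ^ 2) / 4 + (L - (∑ i, P i * γ i) / 2) ^ 2 / ((n : ℝ) - 1) ≤
      ∑ i, ∑ j, A i j ^ 2 := by
  let B : Fin n → Fin n → ℝ := fun i j => A i j - γ i * P j / 2
  have hAP : ∀ i, ∑ j, A i j * P j = s * γ i / 2 := fun i => by
    rw [← hA i, Finset.sum_div]
    exact Finset.sum_congr rfl fun j _ => by ring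
  have hBP : ∀ i, ∑ j, B i j * P j = 0 := fun i => by
    have : ∀ j, B i j * P j = A i j * P j - γ i / 2 * P j ^ 2 := fun j => by
      simp only [B]; ring
    simp only [this, Finset.sum_sub_distrib, ← Finset.mul_sum, hP, hAP]
    ring
  have hT : ∑ i, B i i = L - (∑ i, P i * γ i) / 2 := by
    simp only [B, Finset.sum_sub_distrib, hL, Finset.sum_div]
    congr 1
    exact Finset.sum_congr rfl fun i _ => by ring
  have hBB : ∑ i, ∑ j, B i j ^ 2 = ∑ i, ∑ j, A i j ^ 2 - s * (∑ i, γ i ^ 2) / 4 := by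
    have h1 : ∀ i, ∑ j, B i j ^ 2 = ∑ j, A i j ^ 2 - s / 4 * γ i ^ 2 := fun i => by
      have : ∀ j, B i j ^ 2 = A i j ^ 2 - γ i * (A i j * P j) + γ i ^ 2 / 4 * P j ^ 2 :=
        fun j => by simp only [B]; ring
      simp only [this, Finset.sum_sub_distrib, Finset.sum_add_distrib, ← Finset.mul_sum, hP, hAP]
      ring
    simp only [h1, Finset.sum_sub_distrib, ← Finset.mul_sum]
    ring
  have := sq_trace_le_of_mulVec_eq_zero hn hs hP hBP
  rw [hT, hBB] at this
  linarith

/-- The quadratic form whose positivity drives the gradient estimate. -/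
noncomputable def bernsteinForm (n : ℕ) (p q t y ℓ : ℝ) : ℝ :=
  y * (((n : ℝ) - 1) - ((n : ℝ) - 2) * y)
    + t * (((n : ℝ) - ((n : ℝ) - 1) * q + 1) * y - ((n : ℝ) - 1) * p) + t ^ 2
    + ((n : ℝ) - 1) * ℓ

theorem bernstein_pointwise (hn : 2 ≤ n) {P γ ν : Fin n → ℝ} {A : Fin n → Fin n → ℝ}
    {s t p q ℓ₀ ℓ₁ D y μ : ℝ} (hs : 0 < s) (hD : 0 < D)
    (hP : ∑ i, P i ^ 2 = s) (hA : ∀ i, ∑ j, 2 * P j * A i j = s * γ i)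
    (hL : ∑ i, A i i = -s - t * s) (hDy : D * (y - 1) = -(p + q - 1) * ℓ₀)
    (hfirst : ∀ i, D * γ i + 2 * ℓ₀ * (p + q - 1) * P i + ν i = 0)
    (hsecond : D * ((∑ j, (2 * P j * (-(s * γ j) - t * s * (q / 2 * γ j + (p + q - 1) * P j)) +
        2 * ∑ i, A i j ^ 2)) / s - ∑ i, γ i ^ 2) + 2 * ℓ₀ * (p + q - 1) * (-s - t * s) +
        2 * ℓ₁ * ∑ i, ((q / 2 - 1) * γ i + (p + q - 1) * P i) ^ 2 + μ ≤ 0) :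
    2 * D * s / ((n : ℝ) - 1) *
        bernsteinForm n p q t y (ℓ₁ * (p + 1 + (q - 2) * y) ^ 2 / D) +
      (∑ i, P i * ν i) * (2 * y - 2 * (y + t) / ((n : ℝ) - 1) + t * q -
        2 * ℓ₁ * (p + 1 + (q - 2) * y) * (q - 2) / D) +
      (∑ i, ν i ^ 2) * (ℓ₁ * (q - 2) ^ 2 / (2 * D ^ 2) - 1 / (2 * D)) + μ ≤ 0 := by
  have hm : (0 : ℝ) < (n : ℝ) - 1 := by
    have : (2 : ℝ) ≤ n := by exact_mod_cast hn
    linarith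
  set N := ∑ i, P i * ν i with hN
  set β := ∑ i, ν i ^ 2 with hβ
  have hγ : ∀ i, γ i = 2 * (y - 1) * P i - ν i / D := fun i => by
    have h1 : D * (γ i - (2 * (y - 1) * P i - ν i / D)) = 0 := by
      have : D * (ν i / D) = ν i := by field_simp
      linear_combination hfirst i - 2 * P i * hDy + this
    have := (mul_eq_zero.1 h1).resolve_left hD.ne'
    linarith
  have hX : ∑ i, P i * γ i = 2 * (y - 1) * s - N / D := by
    rw [← hP, hN, Finset.mul_sum, Finset.sum_div, ← Finset.sum_sub_distrib]
    exact Finset.sum_congr rfl fun i _ => by rw [hγ]; ring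
  have hquad : ∀ a b : ℝ, ∑ i, (a * γ i + b * P i) ^ 2 =
      (2 * a * (y - 1) + b) ^ 2 * s - 2 * (2 * a * (y - 1) + b) * a * N / D + a ^ 2 * β / D ^ 2 := by
    intro a b
    rw [← hP, hN, hβ, Finset.mul_sum, Finset.mul_sum, Finset.mul_sum, Finset.sum_div,
      Finset.sum_div, ← Finset.sum_sub_distrib, ← Finset.sum_add_distrib]
    refine Finset.sum_congr rfl fun i _ => ?_
    rw [hγ]
    field_simp
    ring
  have hΓ : ∑ i, γ i ^ 2 = 4 * (y - 1) ^ 2 * s - 4 * (y - 1) * N / D + β / D ^ 2 := by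
    have := hquad 1 0
    simp only [one_mul, zero_mul, add_zero, mul_one] at this
    rw [this]; ring
  have hpc : ∑ j, (2 * P j * (-(s * γ j) - t * s * (q / 2 * γ j + (p + q - 1) * P j)) +
      2 * ∑ i, A i j ^ 2) =
      -(2 * s + t * s * q) * (∑ i, P i * γ i) - 2 * t * s * (p + q - 1) * s +
        2 * ∑ i, ∑ j, A i j ^ 2 := by
    rw [Finset.sum_add_distrib, ← Finset.mul_sum, Finset.sum_comm]
    congr 1
    nth_rw 6 [← hP]
    rw [Finset.mul_sum, Finset.mul_sum, ← Finset.sum_sub_distrib]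
    exact Finset.sum_congr rfl fun i _ => by ring
  have hH := hessian_sq_lower_bound hn hs hP hA hL
  rw [hquad, hpc] at hsecond
  have hstep : D * ((-(2 * s + t * s * q) * (∑ i, P i * γ i) - 2 * t * s * (p + q - 1) * s +
      2 * (s * (∑ i, γ i ^ 2) / 4 +
        (-s - t * s - (∑ i, P i * γ i) / 2) ^ 2 / ((n : ℝ) - 1))) / s - ∑ i, γ i ^ 2) ≤
      D * ((-(2 * s + t * s * q) * (∑ i, P i * γ i) - 2 * t * s * (p + q - 1) * s +
        2 * ∑ i, ∑ j, A i j ^ 2) / s - ∑ i, γ i ^ 2) := by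
    gcongr
  have hN2 : 0 ≤ N ^ 2 / (2 * D * s * ((n : ℝ) - 1)) := by positivity
  have hl : 2 * ℓ₀ * (p + q - 1) = -2 * D * (y - 1) := by linarith
  rw [hl] at hsecond
  rw [hX, hΓ] at hstep
  rw [hΓ, hX] at hsecond
  have key : 2 * D * s / ((n : ℝ) - 1) *
        bernsteinForm n p q t y (ℓ₁ * (p + 1 + (q - 2) * y) ^ 2 / D) +
      N * (2 * y - 2 * (y + t) / ((n : ℝ) - 1) + t * q -
        2 * ℓ₁ * (p + 1 + (q - 2) * y) * (q - 2) / D) +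
      β * (ℓ₁ * (q - 2) ^ 2 / (2 * D ^ 2) - 1 / (2 * D)) + N ^ 2 / (2 * D * s * ((n : ℝ) - 1)) =
    D * ((-(2 * s + t * s * q) * (2 * (y - 1) * s - N / D) - 2 * t * s * (p + q - 1) * s +
      2 * (s * (4 * (y - 1) ^ 2 * s - 4 * (y - 1) * N / D + β / D ^ 2) / 4 +
        (-s - t * s - (2 * (y - 1) * s - N / D) / 2) ^ 2 / ((n : ℝ) - 1))) / s -
          (4 * (y - 1) ^ 2 * s - 4 * (y - 1) * N / D + β / D ^ 2)) +
      -2 * D * (y - 1) * (-s - t * s) + 2 * ℓ₁ * ((2 * (q / 2 - 1) * (y - 1) + (p + q - 1)) ^ 2 * s -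
        2 * (2 * (q / 2 - 1) * (y - 1) + (p + q - 1)) * (q / 2 - 1) * N / D +
        (q / 2 - 1) ^ 2 * β / D ^ 2) := by
    unfold bernsteinForm
    field_simp
    ring
  linarith

end PointwiseAlgebra

theorem le_of_bernstein_inequality {a s t N β μ E₁ E₂ F C₁ C₂ r : ℝ} (ha : 0 < a) (hs : 0 < s)
    (ht : 0 ≤ t) (hF : a * (1 + t) ^ 2 ≤ F) (hE₁ : |E₁| ≤ C₁ * (1 + t)) (hE₂ : |E₂| ≤ C₂)
    (hN : N ^ 2 ≤ s * β) (hβ0 : 0 ≤ β) (hβ : β ≤ r) (hμ : -μ ≤ r)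
    (h : s * F + N * E₁ + β * E₂ + μ ≤ 0) :
    s ≤ 2 / a * (C₁ ^ 2 / (2 * a) + C₂ + 1) * r := by
  have hC₁ : 0 ≤ C₁ := by
    by_contra! hc
    nlinarith [abs_nonneg E₁]
  have hC₂ : 0 ≤ C₂ := (abs_nonneg _).trans hE₂
  have hr : 0 ≤ r := hβ0.trans hβ
  have h1 : |N| ≤ √s * √β := by
    rw [← Real.sqrt_mul hs.le]
    exact Real.abs_le_sqrt hN
  have h2 : -(N * E₁) ≤ √s * √β * (C₁ * (1 + t)) :=
    (neg_le_abs _).trans (by rw [abs_mul]; gcongr)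
  have h3 : √s * √β * (C₁ * (1 + t)) ≤ a * s * (1 + t) ^ 2 / 2 + C₁ ^ 2 * β / (2 * a) := by
    have e : a * s * (1 + t) ^ 2 / 2 + C₁ ^ 2 * β / (2 * a) - √s * √β * (C₁ * (1 + t)) =
        (a * √s * (1 + t) - C₁ * √β) ^ 2 / (2 * a) := by
      field_simp
      rw [sub_sq, mul_pow, mul_pow, mul_pow, Real.sq_sqrt hs.le, Real.sq_sqrt hβ0]
      ring
    have : 0 ≤ (a * √s * (1 + t) - C₁ * √β) ^ 2 / (2 * a) := by positivity
    linarith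
  have h4 : -(β * E₂) ≤ C₂ * r := by
    calc -(β * E₂) ≤ |β * E₂| := neg_le_abs _
      _ = β * |E₂| := by rw [abs_mul, abs_of_nonneg hβ0]
      _ ≤ r * C₂ := by gcongr
      _ = C₂ * r := mul_comm _ _
  have h5 : C₁ ^ 2 * β / (2 * a) ≤ C₁ ^ 2 / (2 * a) * r := by
    rw [mul_div_right_comm]; gcongr
  have h6 : s * (a * (1 + t) ^ 2) ≤ s * F := by gcongr
  have h7 : s * a ≤ s * (a * (1 + t) ^ 2) := by
    have : 1 ≤ (1 + t) ^ 2 := by nlinarith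
    nlinarith [mul_pos hs ha]
  have h8 : a / 2 * s ≤ (C₁ ^ 2 / (2 * a) + C₂ + 1) * r := by linarith
  calc s = 2 / a * (a / 2 * s) := by field_simp
    _ ≤ 2 / a * ((C₁ ^ 2 / (2 * a) + C₂ + 1) * r) := by gcongr
    _ = _ := by ring

/-- A bounded weight `G` whose generalized second-order lower jets make the Bernstein form
uniformly positive. -/
structure BernsteinProfile (n : ℕ) (p q K ε : ℝ) (G : ℝ → ℝ) : Prop where
  continuous : Continuous G
  abs_le : ∀ σ, |G σ| ≤ K
  exists_jet : ∀ τ, ∃ ℓ₀ ℓ₁ y D : ℝ, D = 1 + (q - 2) * ℓ₀ ∧ D * (y - 1) = -(p + q - 1) * ℓ₀ ∧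
    |ℓ₀| ≤ K ∧ |ℓ₁| ≤ K ∧ |y| ≤ K ∧ 1 ≤ K * D ∧
    (∀ᶠ σ in 𝓝 τ, G τ + 2 * ℓ₀ * (σ - τ) + ℓ₁ * (σ - τ) ^ 2 ≤ G σ) ∧
    ε * (1 + Real.exp τ) ^ 2 ≤
      bernsteinForm n p q (Real.exp τ) y (ℓ₁ * (p + 1 + (q - 2) * y) ^ 2 / D)

section Cutoff

variable {n : ℕ}

/-- The parabolic cutoff of the ball of radius `R` centred at `c`. -/
noncomputable def cutoff (c : EuclideanSpace ℝ (Fin n)) (R : ℝ) (x : EuclideanSpace ℝ (Fin n)) : ℝ :=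
  1 - (∑ i, (x i - c i) ^ 2) / R ^ 2

variable (c : EuclideanSpace ℝ (Fin n)) (R : ℝ) (x : EuclideanSpace ℝ (Fin n))

theorem contDiff_cutoff : ContDiff ℝ 2 (cutoff c R) := by
  unfold cutoff
  fun_prop

theorem cutoff_eq : cutoff c R x = 1 - dist x c ^ 2 / R ^ 2 := by
  rw [cutoff, EuclideanSpace.dist_eq, Real.sq_sqrt (Finset.sum_nonneg fun _ _ => sq_nonneg _)]
  simp [Real.dist_eq]

theorem pd_cutoff (i : Fin n) : pd i (cutoff c R) x = -2 * (x i - c i) / R ^ 2 := by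
  have h : ∀ j : Fin n, HasFDerivAt (fun x : EuclideanSpace ℝ (Fin n) => (x j - c j) ^ 2)
      ((2 * (x j - c j)) • (EuclideanSpace.proj j : EuclideanSpace ℝ (Fin n) →L[ℝ] ℝ)) x := by
    intro j
    have h1 : HasFDerivAt (fun x : EuclideanSpace ℝ (Fin n) => x j - c j)
      (EuclideanSpace.proj j : EuclideanSpace ℝ (Fin n) →L[ℝ] ℝ) x :=
      (EuclideanSpace.proj j : EuclideanSpace ℝ (Fin n) →L[ℝ] ℝ).hasFDerivAt.sub_const _
    simpa using h1.pow 2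
  have h2 := ((HasFDerivAt.fun_sum fun j (_ : j ∈ Finset.univ) => h j).mul_const
    ((R ^ 2)⁻¹)).const_sub 1
  have h3 : (cutoff c R) = fun x => 1 - (∑ i, (x i - c i) ^ 2) * (R ^ 2)⁻¹ := by
    funext x; simp [cutoff, div_eq_mul_inv]
  rw [pd, h3, h2.fderiv]
  simp
  ring

theorem elaplacian_cutoff : elaplacian (cutoff c R) x = -2 * n / R ^ 2 := by
  have h : ∀ i, pd i (pd i (cutoff c R)) x = -2 / R ^ 2 := fun i => by
    have h1 : HasFDerivAt (fun x : EuclideanSpace ℝ (Fin n) => -2 * (x i - c i) / R ^ 2)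
        ((R ^ 2)⁻¹ • (-2 : ℝ) • (EuclideanSpace.proj i : EuclideanSpace ℝ (Fin n) →L[ℝ] ℝ)) x := by
      simp only [div_eq_mul_inv]
      exact (((EuclideanSpace.proj i : EuclideanSpace ℝ (Fin n) →L[ℝ] ℝ).hasFDerivAt.sub_const
        _).const_mul _).mul_const _
    rw [show pd i (cutoff c R) = fun x => -2 * (x i - c i) / R ^ 2 from
      funext fun x => pd_cutoff c R x i, pd, h1.fderiv]
    simp
    ring
  rw [elaplacian_eq_sum_pd, Finset.sum_congr rfl fun i _ => h i]
  simp
  ring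

end Cutoff

section InteriorEstimate

variable {n : ℕ} {p q : ℝ} {f : EuclideanSpace ℝ (Fin n) → ℝ} {x₀ : EuclideanSpace ℝ (Fin n)}

/-- The squared length of the gradient, in coordinates. -/
noncomputable def gradSq (f : EuclideanSpace ℝ (Fin n) → ℝ) (x : EuclideanSpace ℝ (Fin n)) : ℝ :=
  ∑ j, pd j f x ^ 2

/-- The logarithm of the ratio of the two terms of the right-hand side of the equation for
`f = log u`. -/
noncomputable def logRatio (p q : ℝ) (f : EuclideanSpace ℝ (Fin n) → ℝ)
    (x : EuclideanSpace ℝ (Fin n)) : ℝ :=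
  (q / 2 - 1) * Real.log (gradSq f x) + (p + q - 1) * f x

theorem gradSq_nonneg (x : EuclideanSpace ℝ (Fin n)) : 0 ≤ gradSq f x :=
  Finset.sum_nonneg fun _ _ => sq_nonneg _

theorem contDiff_gradSq (hf : ContDiff ℝ 2 f) : ContDiff ℝ 1 (gradSq f) :=
  ContDiff.sum fun j _ => (ContDiff.pd (m := 1) (k := 2) (i := j) hf (by norm_num)).pow 2

theorem exp_logRatio_mul_gradSq (h : 0 < gradSq f x₀) :
    Real.exp (logRatio p q f x₀) * gradSq f x₀ =
      gradSq f x₀ ^ (q / 2) * Real.exp ((p + q - 1) * f x₀) := by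
  rw [logRatio, Real.exp_add, Real.rpow_def_of_pos h]
  nth_rw 2 [← Real.exp_log h]
  rw [← Real.exp_add, ← Real.exp_add, ← Real.exp_add]
  ring_nf

theorem pd_gradSq (hf : ContDiff ℝ 2 f) (i : Fin n) :
    pd i (gradSq f) x₀ = ∑ j, 2 * pd j f x₀ * pd i (pd j f) x₀ := by
  have h : ∀ j ∈ Finset.univ, HasFDerivAt (fun x => pd j f x ^ 2)
      ((2 * pd j f x₀) • fderiv ℝ (pd j f) x₀) x₀ := fun j _ => by
    have := ((ContDiff.pd (m := 1) (k := 2) (i := j) hf (by norm_num)).differentiable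
      (by norm_num) x₀).hasFDerivAt.pow 2
    simpa using this
  have h2 := HasFDerivAt.fun_sum h
  have h3 : gradSq f = fun x => ∑ j, pd j f x ^ 2 := rfl
  rw [pd, h3, h2.fderiv]
  simp [pd]

theorem contDiffAt_rhs (hf : ContDiff ℝ 2 f) (hs : 0 < gradSq f x₀) :
    ContDiffAt ℝ 1 (fun x => gradSq f x ^ (q / 2) * Real.exp ((p + q - 1) * f x)) x₀ := by
  have h1 := ((contDiff_gradSq hf).contDiffAt (x := x₀)).rpow_const_of_ne (p := q / 2) hs.ne'
  have h2 : ContDiffAt ℝ 1 f x₀ := (hf.of_le (by norm_num)).contDiffAt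
  exact h1.mul (contDiffAt_const.mul h2).exp

theorem pd_rhs (hf : ContDiff ℝ 2 f) (hs : 0 < gradSq f x₀) (j : Fin n) :
    pd j (fun x => -gradSq f x - gradSq f x ^ (q / 2) * Real.exp ((p + q - 1) * f x)) x₀ =
      -pd j (gradSq f) x₀ - gradSq f x₀ ^ (q / 2) * Real.exp ((p + q - 1) * f x₀) *
        (q / 2 * (pd j (gradSq f) x₀ / gradSq f x₀) + (p + q - 1) * pd j f x₀) := by
  have h1 := ((contDiff_gradSq hf).differentiable (by norm_num) x₀).hasFDerivAt
  have h2 := (hf.differentiable (by norm_num) x₀).hasFDerivAt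
  have h3 := h1.rpow_const (p := q / 2) (Or.inl hs.ne')
  have h4 := h1.neg.sub (h3.mul (h2.const_mul (p + q - 1)).exp)
  have h5 : (fun x => -gradSq f x - gradSq f x ^ (q / 2) * Real.exp ((p + q - 1) * f x)) =
    (-gradSq f - (fun x => gradSq f x ^ (q / 2)) * fun x => Real.exp ((p + q - 1) * f x)) := by
    funext x; rfl
  rw [pd, h5, h4.fderiv, Real.rpow_sub_one hs.ne']
  simp [pd]
  ring

variable {K ε : ℝ} {G : ℝ → ℝ}

theorem BernsteinProfile.contact_inequality (hn : 2 ≤ n) (hG : BernsteinProfile n p q K ε G)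
    (hf : ContDiff ℝ 2 f)
    (hEq : ∀ x, elaplacian f x =
      -gradSq f x - gradSq f x ^ (q / 2) * Real.exp ((p + q - 1) * f x))
    (hs : 0 < gradSq f x₀) {η : EuclideanSpace ℝ (Fin n) → ℝ} (hη : ContDiff ℝ 2 η)
    (hη0 : 0 < η x₀)
    (hmax : IsLocalMax (fun x => Real.log (gradSq f x) + G (logRatio p q f x) +
      2 * Real.log (η x)) x₀) :
    ∃ ℓ₁ y D : ℝ, |ℓ₁| ≤ K ∧ |y| ≤ K ∧ 1 ≤ K * D ∧
      ε * (1 + Real.exp (logRatio p q f x₀)) ^ 2 ≤ bernsteinForm n p q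
        (Real.exp (logRatio p q f x₀)) y (ℓ₁ * (p + 1 + (q - 2) * y) ^ 2 / D) ∧
      2 * D * gradSq f x₀ / ((n : ℝ) - 1) * bernsteinForm n p q
          (Real.exp (logRatio p q f x₀)) y (ℓ₁ * (p + 1 + (q - 2) * y) ^ 2 / D) +
        (∑ i, pd i f x₀ * (2 * (pd i η x₀ / η x₀))) *
          (2 * y - 2 * (y + Real.exp (logRatio p q f x₀)) / ((n : ℝ) - 1) +
            Real.exp (logRatio p q f x₀) * q -
            2 * ℓ₁ * (p + 1 + (q - 2) * y) * (q - 2) / D) +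
        (∑ i, (2 * (pd i η x₀ / η x₀)) ^ 2) * (ℓ₁ * (q - 2) ^ 2 / (2 * D ^ 2) - 1 / (2 * D)) +
        2 * (elaplacian η x₀ / η x₀ - (∑ i, pd i η x₀ ^ 2) / η x₀ ^ 2) ≤ 0 := by
  obtain ⟨ℓ₀, ℓ₁, y, D, hD, hDy, -, hℓ₁, hy, hKD, hsub, hQ⟩ := hG.exists_jet (logRatio p q f x₀)
  have hK : 0 ≤ K := (abs_nonneg _).trans hy
  have hD0 : 0 < D := by
    by_contra! hc
    nlinarith
  refine ⟨ℓ₁, y, D, hℓ₁, hy, hKD, hQ, ?_⟩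
  have hlapeq : elaplacian f =
      fun x => -gradSq f x - gradSq f x ^ (q / 2) * Real.exp ((p + q - 1) * f x) := funext hEq
  have hlap : ContDiffAt ℝ 1 (elaplacian f) x₀ := by
    rw [hlapeq]
    exact (contDiff_gradSq hf).contDiffAt.neg.sub (contDiffAt_rhs hf hs)
  obtain ⟨w, hw, hwj⟩ := exists_approxJet hf hlap
  have hsj := ApproxJet.sum Finset.univ fun j _ => (hwj j).sub_const_sq 0
  have hgj := (hsj.congr_limit (a' := gradSq f)
    (Eventually.of_forall fun x => by simp [gradSq]) rfl rfl).log hs.ne'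
  have hηj := ((ApproxJet.of_contDiff (x₀ := x₀) hη).log hη0.ne').const_mul 2
  have hτj := (hgj.const_mul (q / 2 - 1)).add (hw.const_mul (p + q - 1))
  have hFj := (((hgj.const_mul D).add (hw.const_mul (2 * ℓ₀ * (p + q - 1)))).add
    ((hτj.sub_const_sq (logRatio p q f x₀)).const_mul ℓ₁)).add hηj
  have hτc : ContinuousAt (logRatio p q f) x₀ := hτj.continuousAt
  have hFmax := hFj.of_isLocalMax (by
    have hev := hτc.eventually hsub
    filter_upwards [hmax, hev] with x h1 h2
    have e1 : ∀ x, logRatio p q f x =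
        (q / 2 - 1) * Real.log (gradSq f x) + (p + q - 1) * f x := fun _ => rfl
    simp only [← e1, sub_self]
    simp only [e1] at h1 h2 ⊢
    rw [hD]
    linarith)
  obtain ⟨h1, h2⟩ := hFmax
  have ht := exp_logRatio_mul_gradSq (p := p) (q := q) hs
  set t := Real.exp (logRatio p q f x₀) with htdef
  set s := gradSq f x₀ with hsdef
  have hbs : ∀ i, ∑ j, 2 * (pd j f x₀ - 0) * pd i (pd j f) x₀ = pd i (gradSq f) x₀ := fun i => by
    rw [pd_gradSq hf]; simp
  have e0 : (q / 2 - 1) * Real.log s + (p + q - 1) * f x₀ - logRatio p q f x₀ = 0 := sub_self _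
  simp only [hbs] at h1 h2
  simp only [e0, mul_zero, zero_mul, add_zero, zero_add] at h1 h2
  have hpl : ∀ j, pd j (elaplacian f) x₀ = -(s * (pd j (gradSq f) x₀ / s)) -
      t * s * (q / 2 * (pd j (gradSq f) x₀ / s) + (p + q - 1) * pd j f x₀) := fun j => by
    rw [hlapeq, pd_rhs hf hs, ht, mul_div_cancel₀ _ hs.ne']
  have hE0 : elaplacian f x₀ = -s - t * s := by rw [hEq, ht]
  refine bernstein_pointwise (ℓ₀ := ℓ₀) (P := fun i => pd i f x₀)
    (γ := fun i => pd i (gradSq f) x₀ / s)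
    (A := fun i j => pd i (pd j f) x₀) (t := t) hn hs hD0 rfl ?_ ?_ hDy ?_ ?_
  · intro i
    rw [mul_div_cancel₀ _ hs.ne', pd_gradSq hf]
  · exact hE0
  · intro i
    exact h1 i
  · have h3 : (∑ i, pd i (gradSq f) x₀ ^ 2) / s ^ 2 = ∑ i, (pd i (gradSq f) x₀ / s) ^ 2 := by
      simp only [div_pow, Finset.sum_div]
    simp only [hpl, h3, sub_zero, hE0] at h2
    linarith

end InteriorEstimate

section GradientEstimate

variable {n : ℕ} {p q K ε : ℝ} {f : EuclideanSpace ℝ (Fin n) → ℝ} {G : ℝ → ℝ}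

set_option maxHeartbeats 800000 in
theorem BernsteinProfile.exists_gradSq_cutoff_bound (hn : 2 ≤ n) (hq : 0 ≤ q) (hε : 0 < ε)
    (hG : BernsteinProfile n p q K ε G) :
    ∃ C : ℝ, ∀ f : EuclideanSpace ℝ (Fin n) → ℝ, ContDiff ℝ 2 f →
      (∀ x, elaplacian f x =
        -gradSq f x - gradSq f x ^ (q / 2) * Real.exp ((p + q - 1) * f x)) →
      ∀ c x₀ : EuclideanSpace ℝ (Fin n), ∀ R : ℝ, 0 < R → 0 < gradSq f x₀ → dist x₀ c < R →
        IsLocalMax (fun x => Real.log (gradSq f x) + G (logRatio p q f x) +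
          2 * Real.log (cutoff c R x)) x₀ →
        gradSq f x₀ * cutoff c R x₀ ^ 2 ≤ C / R ^ 2 := by
  have hm : (0 : ℝ) < (n : ℝ) - 1 := by
    have : (2 : ℝ) ≤ n := by exact_mod_cast hn
    linarith
  have hK : 0 < K := by
    obtain ⟨ℓ₀, ℓ₁, y, D, -, -, -, -, hy, hKD, -⟩ := hG.exists_jet 0
    have : 0 ≤ K := (abs_nonneg _).trans hy
    by_contra! h
    have : K = 0 := le_antisymm h this
    subst this
    linarith
  set a : ℝ := 2 / (K * ((n : ℝ) - 1)) * ε with ha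
  have ha0 : 0 < a := by positivity
  set C₁ : ℝ := 2 * K + (2 * K + 2) / ((n : ℝ) - 1) + q +
    2 * K * (|p + 1| + |q - 2| * K) * |q - 2| * K with hC₁
  set C₂ : ℝ := K * (q - 2) ^ 2 / 2 * K ^ 2 + K / 2 with hC₂
  refine ⟨2 / a * (C₁ ^ 2 / (2 * a) + C₂ + 1) * (16 + 4 * n), ?_⟩
  intro f hf hEq c x₀ R hR hs hdist hmax
  set η := cutoff c R x₀ with hη
  have hd2 : dist x₀ c ^ 2 / R ^ 2 < 1 := by
    rw [div_lt_one (by positivity)]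
    exact pow_lt_pow_left₀ hdist dist_nonneg (by norm_num)
  have hd0 : 0 ≤ dist x₀ c ^ 2 / R ^ 2 := by positivity
  have hη_eq : η = 1 - dist x₀ c ^ 2 / R ^ 2 := cutoff_eq c R x₀
  have hη0 : 0 < η := by linarith
  have hη1 : η ≤ 1 := by linarith
  obtain ⟨ℓ₁, y, D, hℓ₁, hy, hKD, hQ, hineq⟩ :=
    hG.contact_inequality hn hf hEq hs (contDiff_cutoff c R) hη0 hmax
  set t := Real.exp (logRatio p q f x₀) with ht
  have ht0 : 0 < t := Real.exp_pos _
  set s := gradSq f x₀ with hsdef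
  have hD0 : 0 < D := by
    by_contra! hc
    linarith [mul_nonneg hK.le (neg_nonneg.2 hc)]
  have hDinv : 1 / D ≤ K := by rwa [div_le_iff₀ hD0]
  have hgrad : ∑ i, pd i (cutoff c R) x₀ ^ 2 ≤ 4 / R ^ 2 := by
    have : ∑ i, pd i (cutoff c R) x₀ ^ 2 = 4 / R ^ 2 * (dist x₀ c ^ 2 / R ^ 2) := by
      rw [EuclideanSpace.dist_eq, Real.sq_sqrt (Finset.sum_nonneg fun _ _ => sq_nonneg _),
        Finset.sum_div, Finset.mul_sum]
      refine Finset.sum_congr rfl fun i _ => ?_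
      rw [pd_cutoff, Real.dist_eq, sq_abs]
      field_simp
      ring
    rw [this]
    exact mul_le_of_le_one_right (by positivity) hd2.le
  have hν : ∑ i, (2 * (pd i (cutoff c R) x₀ / η)) ^ 2 =
      4 * (∑ i, pd i (cutoff c R) x₀ ^ 2) / η ^ 2 := by
    rw [Finset.mul_sum, Finset.sum_div]
    exact Finset.sum_congr rfl fun i _ => by ring
  have hRη : 0 < R ^ 2 * η ^ 2 := by positivity
  have hν_le : ∑ i, (2 * (pd i (cutoff c R) x₀ / η)) ^ 2 ≤ (16 + 4 * n) / (R ^ 2 * η ^ 2) := by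
    rw [hν]
    calc 4 * (∑ i, pd i (cutoff c R) x₀ ^ 2) / η ^ 2 ≤ 4 * (4 / R ^ 2) / η ^ 2 := by gcongr
      _ = 16 / (R ^ 2 * η ^ 2) := by field_simp; norm_num
      _ ≤ _ := by gcongr; linarith [(Nat.cast_nonneg n : (0 : ℝ) ≤ n)]
  have hμ : -(2 * (elaplacian (cutoff c R) x₀ / η - (∑ i, pd i (cutoff c R) x₀ ^ 2) / η ^ 2)) ≤
      (16 + 4 * n) / (R ^ 2 * η ^ 2) := by
    rw [elaplacian_cutoff]
    have h1 : (∑ i, pd i (cutoff c R) x₀ ^ 2) / η ^ 2 ≤ 4 / R ^ 2 / η ^ 2 := by gcongr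
    have h2 : 4 * n / R ^ 2 / η ≤ 4 * n / R ^ 2 / η ^ 2 := by
      gcongr
      exact pow_le_of_le_one hη0.le hη1 (by norm_num)
    calc _ = 4 * n / R ^ 2 / η + 2 * ((∑ i, pd i (cutoff c R) x₀ ^ 2) / η ^ 2) := by
          field_simp; ring
      _ ≤ 4 * n / R ^ 2 / η ^ 2 + 4 * (4 / R ^ 2 / η ^ 2) := by
          have : 0 ≤ 4 / R ^ 2 / η ^ 2 := by positivity
          linarith
      _ = _ := by field_simp; ring
  have hV : |p + 1 + (q - 2) * y| ≤ |p + 1| + |q - 2| * K := by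
    refine (abs_add_le _ _).trans ?_
    rw [abs_mul]
    gcongr
  have hE₁ : |2 * y - 2 * (y + t) / ((n : ℝ) - 1) + t * q -
      2 * ℓ₁ * (p + 1 + (q - 2) * y) * (q - 2) / D| ≤ C₁ * (1 + t) := by
    have h1 : |2 * ℓ₁ * (p + 1 + (q - 2) * y) * (q - 2) / D| ≤
        2 * K * (|p + 1| + |q - 2| * K) * |q - 2| * K := by
      rw [div_eq_mul_one_div, abs_mul, abs_mul, abs_mul, abs_mul, abs_of_pos (by norm_num : (0:ℝ) < 2),
        abs_of_pos (by positivity : 0 < 1 / D)]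
      gcongr
    have h2 : |2 * (y + t) / ((n : ℝ) - 1)| ≤ (2 * K + 2) / ((n : ℝ) - 1) * (1 + t) := by
      rw [abs_div, abs_mul, abs_of_pos hm, abs_of_pos (by norm_num : (0:ℝ) < 2),
        div_mul_eq_mul_div]
      refine div_le_div_of_nonneg_right ?_ hm.le
      have : |y + t| ≤ K + t := (abs_add_le _ _).trans (by rw [abs_of_pos ht0]; linarith)
      linarith [mul_pos hK ht0]
    have h3 : |2 * y| ≤ 2 * K := by rw [abs_mul, abs_of_pos (by norm_num : (0:ℝ) < 2)]; linarith
    have h4 : |t * q| = t * q := abs_of_nonneg (by positivity)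
    have h5 := abs_sub (2 * y - 2 * (y + t) / ((n : ℝ) - 1) + t * q)
      (2 * ℓ₁ * (p + 1 + (q - 2) * y) * (q - 2) / D)
    have h6 := abs_add_le (2 * y - 2 * (y + t) / ((n : ℝ) - 1)) (t * q)
    have h7 := abs_sub (2 * y) (2 * (y + t) / ((n : ℝ) - 1))
    have h8 : 0 ≤ 2 * K * (|p + 1| + |q - 2| * K) * |q - 2| * K := by positivity
    rw [hC₁]
    linarith [mul_pos hK ht0, mul_nonneg h8 ht0.le]
  have hE₂ : |ℓ₁ * (q - 2) ^ 2 / (2 * D ^ 2) - 1 / (2 * D)| ≤ C₂ := by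
    have h1 : |ℓ₁ * (q - 2) ^ 2 / (2 * D ^ 2)| ≤ K * (q - 2) ^ 2 / 2 * K ^ 2 := by
      rw [show ℓ₁ * (q - 2) ^ 2 / (2 * D ^ 2) = ℓ₁ * (q - 2) ^ 2 / 2 * (1 / D) ^ 2 by
        field_simp, abs_mul, abs_div, abs_mul, abs_of_nonneg (sq_nonneg (q - 2)),
        abs_of_pos (by norm_num : (0:ℝ) < 2), abs_of_nonneg (sq_nonneg (1 / D))]
      gcongr
    have h2 : |1 / (2 * D)| ≤ K / 2 := by
      rw [abs_of_pos (by positivity), show 1 / (2 * D) = 1 / D / 2 by field_simp]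
      gcongr
    exact (abs_sub _ _).trans (add_le_add h1 h2)
  have hF : a * (1 + t) ^ 2 ≤ 2 * D / ((n : ℝ) - 1) *
      bernsteinForm n p q t y (ℓ₁ * (p + 1 + (q - 2) * y) ^ 2 / D) := by
    have h1 : 2 / (K * ((n : ℝ) - 1)) ≤ 2 * D / ((n : ℝ) - 1) := by
      rw [div_le_div_iff₀ (by positivity) hm]
      linarith [mul_le_mul_of_nonneg_right hKD hm.le]
    rw [ha, mul_assoc]
    gcongr
  have hN : (∑ i, pd i f x₀ * (2 * (pd i (cutoff c R) x₀ / η))) ^ 2 ≤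
      s * ∑ i, (2 * (pd i (cutoff c R) x₀ / η)) ^ 2 :=
    Finset.sum_mul_sq_le_sq_mul_sq _ _ _
  have hfin := le_of_bernstein_inequality ha0 hs ht0.le hF hE₁ hE₂ hN
    (Finset.sum_nonneg fun _ _ => sq_nonneg _) hν_le hμ (by
      convert hineq using 4
      ring)
  calc s * η ^ 2 ≤ 2 / a * (C₁ ^ 2 / (2 * a) + C₂ + 1) * ((16 + 4 * n) / (R ^ 2 * η ^ 2)) *
        η ^ 2 := by gcongr
    _ = _ := by field_simp

theorem continuous_gradSq_mul_exp (hf : ContDiff ℝ 2 f) (hG : Continuous G)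
    (hGK : ∀ σ, |G σ| ≤ K) :
    Continuous fun x => gradSq f x * Real.exp (G (logRatio p q f x)) := by
  have hsc := (contDiff_gradSq hf).continuous
  refine continuous_iff_continuousAt.2 fun x => ?_
  by_cases hx : gradSq f x = 0
  · have hlim : Tendsto (fun x => gradSq f x * Real.exp K) (𝓝 x) (𝓝 0) := by
      have h : Continuous fun x => gradSq f x * Real.exp K := hsc.mul continuous_const
      have h0 : gradSq f x * Real.exp K = 0 := by rw [hx, zero_mul]
      rw [← h0]
      exact h.tendsto x
    rw [ContinuousAt, hx, zero_mul]
    refine squeeze_zero (fun y => mul_nonneg (gradSq_nonneg y) (Real.exp_pos _).le)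
      (fun y => ?_) hlim
    gcongr
    · exact gradSq_nonneg y
    · exact (le_abs_self _).trans (hGK _)
  · have h1 : ContinuousAt (logRatio p q f) x :=
      ((hsc.continuousAt.log hx).const_mul _).add (hf.continuous.continuousAt.const_mul _)
    exact hsc.continuousAt.mul (hG.continuousAt.comp h1).rexp

theorem BernsteinProfile.gradSq_eq_zero (hn : 2 ≤ n) (hq : 0 ≤ q) (hε : 0 < ε)
    (hG : BernsteinProfile n p q K ε G) (hf : ContDiff ℝ 2 f)
    (hEq : ∀ x, elaplacian f x =
      -gradSq f x - gradSq f x ^ (q / 2) * Real.exp ((p + q - 1) * f x))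
    (c : EuclideanSpace ℝ (Fin n)) : gradSq f c = 0 := by
  obtain ⟨C, hC⟩ := hG.exists_gradSq_cutoff_bound hn hq hε
  by_contra hne
  have hpos : 0 < gradSq f c := lt_of_le_of_ne (gradSq_nonneg c) (Ne.symm hne)
  let H := fun x => gradSq f x * Real.exp (G (logRatio p q f x))
  have hHc : Continuous H := continuous_gradSq_mul_exp hf hG.continuous hG.abs_le
  have key : ∀ R : ℝ, 0 < R → H c ≤ Real.exp K * (C / R ^ 2) := by
    intro R hR
    have hcut : Continuous (cutoff c R) := (contDiff_cutoff c R).continuous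
    obtain ⟨x₀, hx₀, hmax⟩ := (isCompact_closedBall c R).exists_isMaxOn
      ⟨c, Metric.mem_closedBall_self hR.le⟩ ((hHc.mul (hcut.pow 2)).continuousOn)
    have hcc : cutoff c R c = 1 := by rw [cutoff_eq]; simp
    have hcx : H c ≤ H x₀ * cutoff c R x₀ ^ 2 := by
      have := hmax (Metric.mem_closedBall_self hR.le)
      simpa [hcc] using this
    have hHpos : 0 < H c := mul_pos hpos (Real.exp_pos _)
    have hprod : 0 < H x₀ * cutoff c R x₀ ^ 2 := hHpos.trans_le hcx
    have hs0 : 0 < gradSq f x₀ := by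
      refine lt_of_le_of_ne (gradSq_nonneg _) fun h => ?_
      simp [H, ← h] at hprod
    have hdist : dist x₀ c < R := by
      refine lt_of_le_of_ne hx₀ fun h => ?_
      rw [cutoff_eq, h, div_self (by positivity)] at hprod
      simp at hprod
    have hη0 : 0 < cutoff c R x₀ := by
      rw [cutoff_eq, sub_pos, div_lt_one (by positivity)]
      exact pow_lt_pow_left₀ hdist dist_nonneg (by norm_num)
    have hlog : ∀ x, 0 < gradSq f x → 0 < cutoff c R x →
        Real.log (gradSq f x) + G (logRatio p q f x) + 2 * Real.log (cutoff c R x) =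
          Real.log (H x * cutoff c R x ^ 2) := fun x h1 h2 => by
      rw [Real.log_mul (mul_pos h1 (Real.exp_pos _)).ne' (by positivity),
        Real.log_mul h1.ne' (Real.exp_pos _).ne', Real.log_exp, Real.log_pow]
      norm_num
    have hloc : IsLocalMax (fun x => Real.log (gradSq f x) + G (logRatio p q f x) +
        2 * Real.log (cutoff c R x)) x₀ := by
      filter_upwards [(contDiff_gradSq hf).continuous.continuousAt.eventually (lt_mem_nhds hs0),
        hcut.continuousAt.eventually (lt_mem_nhds hη0), Metric.isOpen_ball.mem_nhds
          (Metric.mem_ball.2 hdist)] with x h1 h2 h3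
      rw [hlog x h1 h2, hlog x₀ hs0 hη0]
      refine Real.log_le_log (mul_pos (mul_pos h1 (Real.exp_pos _)) (by positivity)) ?_
      exact hmax (Metric.ball_subset_closedBall h3)
    have hb := hC f hf hEq c x₀ R hR hs0 hdist hloc
    calc H c ≤ H x₀ * cutoff c R x₀ ^ 2 := hcx
      _ = Real.exp (G (logRatio p q f x₀)) * (gradSq f x₀ * cutoff c R x₀ ^ 2) := by
          simp only [H]; ring
      _ ≤ Real.exp K * (gradSq f x₀ * cutoff c R x₀ ^ 2) := by
          gcongr
          exact (le_abs_self _).trans (hG.abs_le _)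
      _ ≤ Real.exp K * (C / R ^ 2) := by gcongr
  have hlim : Tendsto (fun R : ℝ => Real.exp K * (C / R ^ 2)) atTop (𝓝 0) := by
    have := (tendsto_pow_atTop (α := ℝ) (n := 2) (by norm_num)).const_div_atTop C
    simpa using this.const_mul (Real.exp K)
  have : H c ≤ 0 := ge_of_tendsto hlim ((eventually_gt_atTop 0).mono key)
  exact absurd (mul_pos hpos (Real.exp_pos _)) (not_lt.2 this)

end GradientEstimate

section SlopeProfiles

variable {n : ℕ} {p q κ ε L c : ℝ} {y : ℝ → ℝ} {S : Set ℝ}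

/-- The Bernstein form along a curve `y(τ)` of slope `d`, where `t = exp τ`. -/
noncomputable def slopeForm (n : ℕ) (p q t y d : ℝ) : ℝ :=
  bernsteinForm n p q t y (-(d * (p + 1 + (q - 2) * y)))

/-- On `S`, the curve `y` has upper slopes bounded by `L` along which the Bernstein form is
uniformly positive. -/
def HasUpperSlopes (n : ℕ) (p q ε L : ℝ) (y : ℝ → ℝ) (S : Set ℝ) : Prop :=
  ∀ τ ∈ S, 0 < p + 1 + (q - 2) * y τ ∧ ∃ d, |d| ≤ L ∧
    (∀ᶠ σ in 𝓝 τ, σ ∈ S → (y σ - y τ) * (σ - τ) ≤ d * (σ - τ) ^ 2) ∧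
    ε * (1 + Real.exp τ) ^ 2 ≤ slopeForm n p q (Real.exp τ) (y τ) d

theorem HasUpperSlopes.mono {ε' L' : ℝ} (h : HasUpperSlopes n p q ε L y S) (hε : ε' ≤ ε)
    (hL : L ≤ L') : HasUpperSlopes n p q ε' L' y S := by
  intro τ hτ
  obtain ⟨hV, d, hd, hs, hQ⟩ := h τ hτ
  exact ⟨hV, d, hd.trans hL, hs, le_trans (by gcongr) hQ⟩

theorem HasUpperSlopes.glue {y₁ y₂ : ℝ → ℝ} (h₁ : HasUpperSlopes n p q ε L y₁ (Iic c))
    (h₂ : HasUpperSlopes n p q ε L y₂ S) (hS : S ⊆ Ici c) (hcS : c ∈ S) (hc : y₁ c = y₂ c) :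
    HasUpperSlopes n p q ε L (fun τ => if τ ≤ c then y₁ τ else y₂ τ) (Iic c ∪ S) := by
  intro τ hτ
  rcases lt_trichotomy τ c with hlt | rfl | hgt
  · obtain ⟨hV, d, hd, hs, hQ⟩ := h₁ τ hlt.le
    simp only [hlt.le, if_true]
    refine ⟨hV, d, hd, ?_, hQ⟩
    filter_upwards [hs, Iio_mem_nhds hlt] with σ h1 (h2 : σ < c) _
    simpa only [h2.le, if_true] using h1 h2.le
  · obtain ⟨hV, d₁, hd₁, hs₁, hQ₁⟩ := h₁ τ self_mem_Iic
    obtain ⟨-, d₂, hd₂, hs₂, hQ₂⟩ := h₂ τ hcS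
    simp only [le_rfl, if_true]
    refine ⟨hV, max d₁ d₂, ?_, ?_, ?_⟩
    · rcases max_choice d₁ d₂ with h | h <;> rw [h] <;> assumption
    · filter_upwards [hs₁, hs₂] with σ h1 h2 hσ
      by_cases hle : σ ≤ τ
      · simp only [hle, if_true]
        exact (h1 hle).trans (by gcongr; exact le_max_left _ _)
      · simp only [hle, if_false]
        rw [hc]
        exact (h2 (hσ.resolve_left hle)).trans (by gcongr; exact le_max_right _ _)
    · rw [← hc] at hQ₂
      rcases max_choice d₁ d₂ with h | h <;> rw [h] <;> assumption
  · obtain ⟨hV, d, hd, hs, hQ⟩ := h₂ τ (hτ.resolve_left (not_le.2 hgt))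
    simp only [not_le.2 hgt, if_false]
    refine ⟨hV, d, hd, ?_, hQ⟩
    filter_upwards [hs, Ioi_mem_nhds hgt] with σ h1 (h2 : c < σ) hσ
    simpa only [not_le.2 h2, if_false] using h1 (hσ.resolve_left (not_le.2 h2))

theorem hasUpperSlopes_one (hκ : 0 < p + q - 1)
    (h : ∀ τ ∈ S, ε * (1 + Real.exp τ) ^ 2 ≤ slopeForm n p q (Real.exp τ) 1 0) :
    HasUpperSlopes n p q ε 0 (fun _ => 1) S := by
  intro τ hτ
  exact ⟨by linarith, 0, by simp, Eventually.of_forall fun σ _ => by simp, h τ hτ⟩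

theorem exists_hasUpperSlopes_Icc {c' : ℝ} {y' : ℝ → ℝ} (hy : ∀ τ, HasDerivAt y (y' τ) τ)
    (hy' : Continuous y')
    (hV : ∀ τ ∈ Icc c c', 0 < p + 1 + (q - 2) * y τ)
    (hQ : ∀ τ ∈ Icc c c', 0 < slopeForm n p q (Real.exp τ) (y τ) (y' τ)) :
    ∃ ε > 0, ∃ L, HasUpperSlopes n p q ε L y (Icc c c') := by
  have hyc : Continuous y := continuous_iff_continuousAt.2 fun τ => (hy τ).continuousAt
  rcases (Icc c c').eq_empty_or_nonempty with he | hne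
  · exact ⟨1, one_pos, 0, by simp [HasUpperSlopes, he]⟩
  have hFc : Continuous fun z : ℝ × ℝ => slopeForm n p q (Real.exp z.2) (y z.2) (y' z.2 + z.1) := by
    unfold slopeForm bernsteinForm
    fun_prop
  obtain ⟨s, hs0, hs⟩ : ∃ s > 0, ∀ τ ∈ Icc c c',
      0 < slopeForm n p q (Real.exp τ) (y τ) (y' τ + s) := by
    have hev : ∀ᶠ s in 𝓝 (0 : ℝ), ∀ τ ∈ Icc c c',
        0 < slopeForm n p q (Real.exp τ) (y τ) (y' τ + s) := by
      refine isCompact_Icc.eventually_forall_of_forall_eventually fun τ hτ => ?_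
      refine (hFc.continuousAt (x := (0, τ))).eventually (lt_mem_nhds ?_)
      simpa using hQ τ hτ
    obtain ⟨s, h1, h2⟩ := ((hev.filter_mono nhdsWithin_le_nhds).and
      (self_mem_nhdsWithin : Ioi (0 : ℝ) ∈ 𝓝[>] 0)).exists
    exact ⟨s, h2, h1⟩
  have hRc : Continuous fun τ =>
      slopeForm n p q (Real.exp τ) (y τ) (y' τ + s) / (1 + Real.exp τ) ^ 2 :=
    (hFc.comp (Continuous.prodMk_right s)).div₀ (by fun_prop) fun τ => by positivity
  obtain ⟨τ₀, hτ₀, hmin⟩ := isCompact_Icc.exists_isMinOn hne hRc.continuousOn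
  obtain ⟨L, hL⟩ := isCompact_Icc.exists_bound_of_continuousOn
    ((hy'.add continuous_const : Continuous fun τ => y' τ + s).continuousOn (s := Icc c c'))
  refine ⟨_, div_pos (hs τ₀ hτ₀) (by positivity : 0 < (1 + Real.exp τ₀) ^ 2), L, ?_⟩
  intro τ hτ
  refine ⟨hV τ hτ, y' τ + s, hL τ hτ, ?_, ?_⟩
  · have h1 := (hasDerivAt_iff_isLittleO.1 (hy τ)).bound hs0
    filter_upwards [h1] with σ h2 _
    rw [Real.norm_eq_abs, Real.norm_eq_abs, smul_eq_mul] at h2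
    have h3 : (y σ - y τ - (σ - τ) * y' τ) * (σ - τ) ≤ s * (σ - τ) ^ 2 := by
      calc _ ≤ |(y σ - y τ - (σ - τ) * y' τ) * (σ - τ)| := le_abs_self _
        _ = |y σ - y τ - (σ - τ) * y' τ| * |σ - τ| := abs_mul _ _
        _ ≤ s * |σ - τ| * |σ - τ| := by gcongr
        _ = s * (σ - τ) ^ 2 := by rw [mul_assoc, abs_mul_abs_self]; ring
    linarith
  · have := hmin hτ
    simp only [mem_ofPred_eq] at this
    rwa [le_div_iff₀ (by positivity)] at this

/-- An admissible curve on `(-∞, c]`, equal to `1` near `-∞`, ending at the value `v`. -/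
def ReachesValue (n : ℕ) (p q c v : ℝ) : Prop :=
  ∃ y : ℝ → ℝ, Continuous y ∧ (∃ a, ∀ τ ≤ a, y τ = 1) ∧ y c = v ∧
    ∃ ε > 0, ∃ L, HasUpperSlopes n p q ε L y (Iic c)

theorem reachesValue_one (hκ : 0 < p + q - 1) (hε : 0 < ε)
    (h : ∀ τ ≤ c, ε * (1 + Real.exp τ) ^ 2 ≤ slopeForm n p q (Real.exp τ) 1 0) :
    ReachesValue n p q c 1 :=
  ⟨fun _ => 1, continuous_const, ⟨c, fun _ _ => rfl⟩, rfl, ε, hε, 0, hasUpperSlopes_one hκ h⟩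

theorem ReachesValue.trans {c' v : ℝ} {y' : ℝ → ℝ} (h : ReachesValue n p q c v) (hcc : c ≤ c')
    (hy : ∀ τ, HasDerivAt y (y' τ) τ) (hy' : Continuous y') (hyc : y c = v)
    (hV : ∀ τ ∈ Icc c c', 0 < p + 1 + (q - 2) * y τ)
    (hQ : ∀ τ ∈ Icc c c', 0 < slopeForm n p q (Real.exp τ) (y τ) (y' τ)) :
    ReachesValue n p q c' (y c') := by
  obtain ⟨y₁, hy₁, ⟨a, ha⟩, hv, ε₁, hε₁, L₁, h₁⟩ := h
  obtain ⟨ε₂, hε₂, L₂, h₂⟩ := exists_hasUpperSlopes_Icc hy hy' hV hQ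
  have hyco : Continuous y := continuous_iff_continuousAt.2 fun τ => (hy τ).continuousAt
  refine ⟨fun τ => if τ ≤ c then y₁ τ else y τ, ?_, ⟨min a c, fun τ hτ => ?_⟩, ?_,
    min ε₁ ε₂, lt_min hε₁ hε₂, max L₁ L₂, ?_⟩
  · exact hy₁.if_le hyco continuous_id continuous_const fun τ hτ => by
      rw [show τ = c from hτ, hv, hyc]
  · simp only [hτ.trans (min_le_right _ _), if_true]
    exact ha τ (hτ.trans (min_le_left _ _))
  · rcases hcc.eq_or_lt with rfl | hlt
    · simp [hv, hyc]
    · simp [not_le.2 hlt]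
  · have := (h₁.mono (min_le_left _ _) (le_max_left _ _)).glue
      (h₂.mono (min_le_right _ _) (le_max_right _ _)) Icc_subset_Ici_self
      (left_mem_Icc.2 hcc) (hv.trans hyc.symm)
    rwa [Iic_union_Icc_eq_Iic hcc] at this

theorem ReachesValue.exists_profile (h : ReachesValue n p q c 1) (hκ : 0 < p + q - 1) (hε : 0 < ε)
    (hQ : ∀ τ ≥ c, ε * (1 + Real.exp τ) ^ 2 ≤ slopeForm n p q (Real.exp τ) 1 0) :
    ∃ y : ℝ → ℝ, Continuous y ∧ (∃ a b, ∀ τ ∉ Icc a b, y τ = 1) ∧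
      ∃ ε > 0, ∃ L, HasUpperSlopes n p q ε L y univ := by
  obtain ⟨y₁, hy₁, ⟨a, ha⟩, hv, ε₁, hε₁, L₁, h₁⟩ := h
  refine ⟨fun τ => if τ ≤ c then y₁ τ else 1, ?_, ⟨min a c, c, fun τ hτ => ?_⟩,
    min ε₁ ε, lt_min hε₁ hε, max L₁ 0, ?_⟩
  · exact hy₁.if_le continuous_const continuous_id continuous_const fun τ hτ => by
      rw [show τ = c from hτ, hv]
  · by_cases hτc : τ ≤ c
    · simp only [hτc, if_true]
      by_contra hne
      exact hτ ⟨by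
        by_contra! hlt
        exact hne (ha τ (hlt.le.trans (min_le_left _ _))), hτc⟩
    · simp [hτc]
  · have := (h₁.mono (min_le_left _ _) (le_max_left _ _)).glue
      ((hasUpperSlopes_one (S := Ici c) hκ hQ).mono (min_le_right _ _) (le_max_right _ _))
      Subset.rfl self_mem_Ici hv
    rwa [Iic_union_Ici] at this

end SlopeProfiles

section ProfileOfCurve

variable {n : ℕ} {p q ε L a b : ℝ} {y : ℝ → ℝ}

theorem exists_abs_integral_le {g : ℝ → ℝ} (hg : Continuous g) (hsupp : ∀ τ ∉ Icc a b, g τ = 0) :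
    ∃ M, 0 ≤ M ∧ ∀ σ, |∫ x in (0 : ℝ)..σ, g x| ≤ M := by
  have hc : HasCompactSupport g := HasCompactSupport.intro isCompact_Icc hsupp
  have hi : MeasureTheory.Integrable (fun x => ‖g x‖) := (hg.integrable_of_hasCompactSupport hc).norm
  refine ⟨∫ x, ‖g x‖, MeasureTheory.integral_nonneg fun _ => norm_nonneg _, fun σ => ?_⟩
  exact intervalIntegral.norm_integral_le_integral_norm_uIoc.trans
    (MeasureTheory.setIntegral_le_integral hi (Eventually.of_forall fun _ => norm_nonneg _))

theorem isLocalMin_primitive_sub_quadratic {g : ℝ → ℝ} (hg : Continuous g) {τ m : ℝ}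
    (h : ∀ᶠ σ in 𝓝 τ, 2 * m * (σ - τ) ^ 2 ≤ (g σ - g τ) * (σ - τ)) :
    IsLocalMin (fun σ => (∫ x in (0 : ℝ)..σ, g x) - g τ * (σ - τ) - m * (σ - τ) ^ 2) τ := by
  have hd : ∀ σ, HasDerivAt (fun σ => (∫ x in (0 : ℝ)..σ, g x) - g τ * (σ - τ) - m * (σ - τ) ^ 2)
      (g σ - g τ - 2 * m * (σ - τ)) σ := fun σ => by
    have h1 := intervalIntegral.integral_hasDerivAt_right (hg.intervalIntegrable 0 σ)
      (hg.stronglyMeasurableAtFilter _ _) hg.continuousAt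
    have h2 := (hasDerivAt_id σ).sub_const τ
    refine ((h1.sub (h2.const_mul (g τ))).sub ((h2.pow 2).const_mul m)).congr_deriv ?_
    simp
    ring
  refine isLocalMin_of_deriv (hd τ).continuousAt
    (Eventually.of_forall fun σ => (hd σ).differentiableAt) ?_ ?_
  · filter_upwards [h.filter_mono nhdsWithin_le_nhds, self_mem_nhdsWithin] with σ h1 (h2 : σ < τ)
    rw [(hd σ).deriv]
    by_contra! hc
    nlinarith [mul_pos hc (sub_pos.2 h2)]
  · filter_upwards [h.filter_mono nhdsWithin_le_nhds, self_mem_nhdsWithin] with σ h1 (h2 : τ < σ)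
    rw [(hd σ).deriv]
    by_contra! hc
    nlinarith [mul_pos (neg_pos.2 hc) (sub_pos.2 h2)]

set_option maxHeartbeats 800000 in
theorem exists_bernsteinProfile_of_curve (hn : 2 ≤ n) (hκ : 0 < p + q - 1) (hε : 0 < ε)
    (hy : Continuous y) (hone : ∀ τ ∉ Icc a b, y τ = 1)
    (hslope : HasUpperSlopes n p q ε L y univ) :
    ∃ K G, BernsteinProfile n p q K (ε / 2) G := by
  have hm : (0 : ℝ) < (n : ℝ) - 1 := by
    have : (2 : ℝ) ≤ n := by exact_mod_cast hn
    linarith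
  set V : ℝ → ℝ := fun z => p + 1 + (q - 2) * z with hVdef
  have hVpos : ∀ τ, 0 < V (y τ) := fun τ => (hslope τ (mem_univ _)).1
  have hVc : Continuous V := by fun_prop
  have hcomp : IsCompact (insert 1 (y '' Icc a b)) := (isCompact_Icc.image hy).insert 1
  have hmem : ∀ τ, y τ ∈ insert 1 (y '' Icc a b) := fun τ => by
    by_cases hτ : τ ∈ Icc a b
    · exact Or.inr (mem_image_of_mem _ hτ)
    · exact Or.inl (hone τ hτ)
  have hV1 : V 1 = p + q - 1 := by simp only [hVdef]; ring
  obtain ⟨z₀, hz₀, hmin⟩ := hcomp.exists_isMinOn ⟨1, Or.inl rfl⟩ hVc.continuousOn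
  obtain ⟨v₂, hv₂⟩ := hcomp.exists_bound_of_continuousOn hVc.continuousOn
  obtain ⟨Y, hY⟩ := hcomp.exists_bound_of_continuousOn continuousOn_id
  have hv₁ : 0 < V z₀ := by
    rcases hz₀ with rfl | ⟨τ, -, rfl⟩
    · rwa [hV1]
    · exact hVpos τ
  set v₁ := V z₀
  have hV1le : ∀ τ, v₁ ≤ V (y τ) := fun τ => hmin (hmem τ)
  have hV2le : ∀ τ, V (y τ) ≤ v₂ := fun τ => (le_abs_self _).trans (hv₂ _ (hmem τ))
  have hYle : ∀ τ, |y τ| ≤ Y := fun τ => hY _ (hmem τ)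
  have hv₂0 : 0 < v₂ := (hVpos 0).trans_le (hV2le 0)
  have hY0 : 0 ≤ Y := (abs_nonneg _).trans (hYle 0)
  have hL0 : 0 ≤ L := by
    obtain ⟨-, d, hd, -⟩ := hslope 0 (mem_univ _)
    exact (abs_nonneg _).trans hd
  set l : ℝ → ℝ := fun x => (1 - y x) / V (y x) with hl
  have hlc : Continuous fun x => 2 * l x :=
    continuous_const.mul ((continuous_const.sub hy).div₀ (hVc.comp hy) fun x => (hVpos x).ne')
  obtain ⟨M, hM0, hM⟩ := exists_abs_integral_le (a := a) (b := b) hlc fun τ hτ => by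
    simp [hl, hone τ hτ]
  set δ := ε / (2 * ((n : ℝ) - 1) * v₂) with hδ
  have hδ0 : 0 < δ := by positivity
  refine ⟨M + (1 + Y) / v₁ + (p + q - 1) * (L + δ) / v₁ ^ 2 + Y + v₂ / (p + q - 1),
    fun σ => ∫ x in (0 : ℝ)..σ, 2 * l x, ?_, fun σ => ?_, fun τ => ?_⟩
  · exact continuous_iff_continuousAt.2 fun σ => (intervalIntegral.integral_hasDerivAt_right
      (hlc.intervalIntegrable 0 σ) (hlc.stronglyMeasurableAtFilter _ _) hlc.continuousAt).continuousAt
  · have : 0 ≤ (1 + Y) / v₁ + (p + q - 1) * (L + δ) / v₁ ^ 2 + Y + v₂ / (p + q - 1) := by positivity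
    linarith [hM σ]
  · obtain ⟨-, d, hd, hs, hQ⟩ := hslope τ (mem_univ _)
    have hVτ := hVpos τ
    have hκV : (p + 1 + (q - 2) * y τ) + (q - 2) * (1 - y τ) = p + q - 1 := by ring
    have hVτ' : p + 1 + (q - 2) * y τ = V (y τ) := rfl
    have k1 : 0 ≤ (1 + Y) / v₁ := by positivity
    have k2 : 0 ≤ (p + q - 1) * (L + δ) / v₁ ^ 2 := by positivity
    have k3 : 0 ≤ v₂ / (p + q - 1) := by positivity
    refine ⟨l τ, -((p + q - 1) * (d + δ) / V (y τ) ^ 2), y τ, (p + q - 1) / V (y τ),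
      ?_, ?_, ?_, ?_, ?_, ?_, ?_, ?_⟩
    · simp only [hl]
      rw [← hκV, hVτ']
      field_simp
    · simp only [hl]
      field_simp
      ring
    · have : |l τ| ≤ (1 + Y) / v₁ := by
        simp only [hl]
        rw [abs_div, abs_of_pos hVτ]
        gcongr
        · exact (abs_sub _ _).trans (by simpa using hYle τ)
        · exact hV1le τ
      linarith
    · have : |-((p + q - 1) * (d + δ) / V (y τ) ^ 2)| ≤ (p + q - 1) * (L + δ) / v₁ ^ 2 := by
        rw [abs_neg, abs_div, abs_mul, abs_of_pos hκ, abs_of_pos (by positivity : 0 < V (y τ) ^ 2)]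
        gcongr
        · exact (abs_add_le _ _).trans (by rw [abs_of_pos hδ0]; gcongr)
        · exact hV1le τ
      linarith
    · linarith [hYle τ]
    · have h1 : 1 ≤ v₂ / (p + q - 1) * ((p + q - 1) / V (y τ)) := by
        rw [div_mul_div_cancel₀ hκ.ne', one_le_div hVτ]
        exact hV2le τ
      refine h1.trans ?_
      gcongr
      linarith
    · have hev : ∀ᶠ σ in 𝓝 τ, d * V (y τ) < (d + δ) * V (y σ) := by
        have hcont : Continuous fun σ => (d + δ) * V (y σ) := by fun_prop
        refine hcont.continuousAt.eventually (lt_mem_nhds ?_)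
        linarith [mul_pos hδ0 hVτ]
      have hmin := isLocalMin_primitive_sub_quadratic hlc (τ := τ)
        (m := -((p + q - 1) * (d + δ) / V (y τ) ^ 2)) (by
        filter_upwards [hs, hev] with σ h1 h2
        have hVσ := hVpos σ
        have h3 := h1 (mem_univ _)
        have e : (2 * l σ - 2 * l τ) * (σ - τ) - 2 * -((p + q - 1) * (d + δ) / V (y τ) ^ 2) *
            (σ - τ) ^ 2 = 2 * (p + q - 1) / (V (y τ) ^ 2 * V (y σ)) *
              ((d + δ) * V (y σ) * (σ - τ) ^ 2 - V (y τ) * ((y σ - y τ) * (σ - τ))) := by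
          have e1 : l σ - l τ = -(p + q - 1) * (y σ - y τ) / (V (y σ) * V (y τ)) := by
            simp only [hl]
            rw [div_sub_div _ _ hVσ.ne' hVτ.ne']
            congr 1
            simp only [hVdef]
            ring
          rw [← mul_sub, e1]
          field_simp
          ring
        have h4 : 0 ≤ (d + δ) * V (y σ) * (σ - τ) ^ 2 - V (y τ) * ((y σ - y τ) * (σ - τ)) := by
          have h5 : V (y τ) * ((y σ - y τ) * (σ - τ)) ≤ V (y τ) * (d * (σ - τ) ^ 2) := by gcongr
          linarith [mul_le_mul_of_nonneg_right h2.le (sq_nonneg (σ - τ))]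
        have h6 : 0 ≤ 2 * (p + q - 1) / (V (y τ) ^ 2 * V (y σ)) := by positivity
        have h7 := mul_nonneg h6 h4
        rw [← e] at h7
        linarith)
      filter_upwards [hmin] with σ hσ
      simp only [sub_self, mul_zero] at hσ
      linarith
    · have e : -((p + q - 1) * (d + δ) / V (y τ) ^ 2) * (p + 1 + (q - 2) * y τ) ^ 2 /
          ((p + q - 1) / V (y τ)) = -(d * V (y τ)) - δ * V (y τ) := by
        rw [hVτ']
        field_simp
        ring
      rw [e]
      have h1 : ((n : ℝ) - 1) * (δ * V (y τ)) ≤ ε / 2 := by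
        calc _ ≤ ((n : ℝ) - 1) * (δ * v₂) := by gcongr; exact hV2le τ
          _ = ε / 2 := by rw [hδ]; field_simp
      have h2 : 1 ≤ (1 + Real.exp τ) ^ 2 := by nlinarith [Real.exp_pos τ]
      have h3 : ε / 2 ≤ ε / 2 * (1 + Real.exp τ) ^ 2 := le_mul_of_one_le_right (by positivity) h2
      have h4 : slopeForm n p q (Real.exp τ) (y τ) d - ((n : ℝ) - 1) * (δ * V (y τ)) =
          bernsteinForm n p q (Real.exp τ) (y τ) (-(d * V (y τ)) - δ * V (y τ)) := by
        simp only [slopeForm, bernsteinForm, hVdef]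
        ring
      linarith

end ProfileOfCurve

section Construction

variable {n : ℕ} {p q c v : ℝ}

theorem slopeForm_one_zero (t : ℝ) :
    slopeForm n p q t 1 0 = 1 + (2 - ((n : ℝ) - 1) * (p + q - 1)) * t + t ^ 2 := by
  unfold slopeForm bernsteinForm
  ring

theorem le_one_add_mul_add_sq_of_le {b t : ℝ} (ht : 0 < t) (ht1 : t * (2 * (|b| + 1)) ≤ 1) :
    1 / 8 * (1 + t) ^ 2 ≤ 1 + b * t + t ^ 2 := by
  have h1 : -(|b| * t) ≤ b * t := by nlinarith [neg_abs_le b]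
  have h2 : 0 ≤ |b| * t := by positivity
  nlinarith

theorem le_one_add_mul_add_sq_of_ge {b t : ℝ} (ht1 : 2 * (|b| + 1) ≤ t) :
    1 / 8 * (1 + t) ^ 2 ≤ 1 + b * t + t ^ 2 := by
  have hb := abs_nonneg b
  have h1 : -(|b| * t) ≤ b * t := by nlinarith [neg_abs_le b]
  nlinarith

theorem exists_reachesValue_one (hκ : 0 < p + q - 1) :
    ∃ a, ∀ c ≤ a, ReachesValue n p q c 1 := by
  set b := 2 - ((n : ℝ) - 1) * (p + q - 1) with hb
  refine ⟨Real.log (1 / (2 * (|b| + 1))), fun c hc =>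
    reachesValue_one hκ (by norm_num : (0 : ℝ) < 1 / 8) fun τ hτ => ?_⟩
  rw [slopeForm_one_zero]
  refine le_one_add_mul_add_sq_of_le (Real.exp_pos τ) ?_
  rw [← le_div_iff₀ (by positivity)]
  exact (Real.le_log_iff_exp_le (by positivity)).1 (hτ.trans hc)

theorem exists_bernsteinProfile_of_reachesValue_one (hn : 2 ≤ n) (hκ : 0 < p + q - 1) :
    ∃ b, ∀ c ≥ b, ReachesValue n p q c 1 → ∃ K ε G, 0 < ε ∧ BernsteinProfile n p q K ε G := by
  set b := 2 - ((n : ℝ) - 1) * (p + q - 1) with hb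
  refine ⟨Real.log (2 * (|b| + 1)), fun c hc h => ?_⟩
  obtain ⟨y, hy, ⟨a₁, b₁, hone⟩, ε, hε, L, hslope⟩ :=
    h.exists_profile hκ (by norm_num : (0 : ℝ) < 1 / 8) fun τ hτ => by
      rw [slopeForm_one_zero]
      refine le_one_add_mul_add_sq_of_ge ?_
      exact (Real.log_le_iff_le_exp (by positivity)).1 (hc.le.trans hτ)
  obtain ⟨K, G, hG⟩ := exists_bernsteinProfile_of_curve hn hκ hε hy hone hslope
  exact ⟨K, ε / 2, G, half_pos hε, hG⟩

theorem ReachesValue.affine {c' : ℝ} (h : ReachesValue n p q c v) (hcc : c ≤ c') (s : ℝ)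
    (hV : ∀ τ ∈ Icc c c', 0 < p + 1 + (q - 2) * (v + s * (τ - c)))
    (hQ : ∀ τ ∈ Icc c c', 0 < slopeForm n p q (Real.exp τ) (v + s * (τ - c)) s) :
    ReachesValue n p q c' (v + s * (c' - c)) :=
  h.trans (y := fun τ => v + s * (τ - c)) (y' := fun _ => s) hcc
    (fun τ => by simpa using (((hasDerivAt_id τ).sub_const c).const_mul s).const_add v)
    continuous_const (by simp) hV hQ

theorem exists_bernsteinProfile_of_lt (hκ : ((n : ℝ) - 1) * (p + q - 1) < 4) :
    ∃ K ε G, 0 < ε ∧ BernsteinProfile n p q K ε G := by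
  set b := 2 - ((n : ℝ) - 1) * (p + q - 1) with hb
  refine ⟨1, min 1 ((2 + b) / 4), fun _ => 0, lt_min one_pos (by linarith), continuous_const,
    by simp, fun τ => ⟨0, 0, 1, 1, by simp, by simp, by simp, by simp, by simp, by simp, by simp, ?_⟩⟩
  have h1 : bernsteinForm n p q (Real.exp τ) 1 (0 * (p + 1 + (q - 2) * 1) ^ 2 / 1) =
      1 + b * Real.exp τ + Real.exp τ ^ 2 := by
    rw [hb, ← slopeForm_one_zero]
    simp [slopeForm]
  rw [h1]
  have ht := Real.exp_pos τ
  set t := Real.exp τ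
  rcases le_total b 2 with hb2 | hb2
  · have : min 1 ((2 + b) / 4) * (1 + t) ^ 2 ≤ (2 + b) / 4 * (1 + t) ^ 2 := by
      gcongr
      exact min_le_right _ _
    nlinarith [mul_nonneg (sub_nonneg.2 hb2) (sq_nonneg (1 - t))]
  · have : min 1 ((2 + b) / 4) * (1 + t) ^ 2 ≤ 1 * (1 + t) ^ 2 := by
      gcongr
      exact min_le_left _ _
    nlinarith

theorem abs_linear_coeff_le {Y y : ℝ} (hy : |y| ≤ Y) :
    |((n : ℝ) - ((n : ℝ) - 1) * q + 1) * y - ((n : ℝ) - 1) * p| ≤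
      |(n : ℝ) - ((n : ℝ) - 1) * q + 1| * Y + |((n : ℝ) - 1) * p| := by
  refine (abs_sub _ _).trans ?_
  rw [abs_mul]
  gcongr

theorem slopeForm_curve (t a x η : ℝ) :
    slopeForm n p q t (c - a * (1 - x) * t) (-(t * (a * (1 - x) - η * (a * x)))) =
      c * (((n : ℝ) - 1) - ((n : ℝ) - 2) * c) +
      (((1 - a) * (c * ((n : ℝ) - ((n : ℝ) - 1) * q + 1) - ((n : ℝ) - 1) * p) +
          ((n : ℝ) - 1) * a * c) +
        (((n : ℝ) - 1) - 2 * ((n : ℝ) - 2) * c -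
          ((n : ℝ) - 1) * (1 + η) * (p + 1 - (2 - q) * c)) * (a * x)) * t +
      ((1 - a * (1 - x)) * (1 - ((n : ℝ) - ((n : ℝ) - 1) * q) * (a * (1 - x))) -
        ((n : ℝ) - 1) * (2 - q) * η * (a * (1 - x)) * (a * x)) * t ^ 2 := by
  unfold slopeForm bernsteinForm
  ring

theorem hasDerivAt_curve (c a η τ₂ τ : ℝ) :
    HasDerivAt (fun τ => c - a * (1 - Real.exp (η * (τ - τ₂))) * Real.exp τ)
      (-(Real.exp τ * (a * (1 - Real.exp (η * (τ - τ₂))) - η * (a * Real.exp (η * (τ - τ₂)))))) τ := by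
  have h1 := ((((hasDerivAt_id τ).sub_const τ₂).const_mul η).exp.const_sub 1).const_mul a
  refine ((h1.mul (Real.hasDerivAt_exp τ)).const_sub c).congr_deriv ?_
  simp
  ring

end Construction

section Construction

variable {n : ℕ} {p q c v : ℝ}

theorem le_slopeForm {t y Y : ℝ} (hy : |y| ≤ Y) (ht : 0 ≤ t) (d : ℝ) :
    y * (((n : ℝ) - 1) - ((n : ℝ) - 2) * y) -
      t * (|(n : ℝ) - ((n : ℝ) - 1) * q + 1| * Y + |((n : ℝ) - 1) * p|) + t ^ 2 -
      ((n : ℝ) - 1) * (d * (p + 1 + (q - 2) * y)) ≤ slopeForm n p q t y d := by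
  have h1 := (abs_le.1 (abs_linear_coeff_le (n := n) (p := p) (q := q) hy)).1
  unfold slopeForm bernsteinForm
  nlinarith [mul_le_mul_of_nonneg_left h1 ht]

theorem exists_reachesValue_of_le (hn : 3 ≤ n) (hq : q ≤ 2) (hκ : 0 < p + q - 1)
    (hcm : ((n : ℝ) - 2) * c < (n : ℝ) - 1) (hV : 0 < p + 1 - (2 - q) * c) :
    ∃ b, ∀ τ ≤ b, ∀ v ∈ Icc 1 c, ReachesValue n p q τ v := by
  have hn' : (3 : ℝ) ≤ n := by exact_mod_cast hn
  obtain ⟨b, hb⟩ := exists_reachesValue_one (n := n) hκ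
  set M := |(n : ℝ) - ((n : ℝ) - 1) * q + 1| * c + |((n : ℝ) - 1) * p| with hM
  set C := ((n : ℝ) - 1) - ((n : ℝ) - 2) * c with hC
  have hC0 : 0 < C := by linarith
  set s := C / (3 * (((n : ℝ) - 1) * (p + q - 1))) with hs
  have hm : 0 < (n : ℝ) - 1 := by linarith
  have hs0 : 0 < s := by positivity
  have hsC : ((n : ℝ) - 1) * (s * (p + q - 1)) = C / 3 := by
    rw [hs]; field_simp
  refine ⟨min b (Real.log (C / (3 * (|M| + 1)))), fun τ hτ v hv => ?_⟩
  have hle : τ - (v - 1) / s ≤ τ := sub_le_self _ (div_nonneg (by linarith [hv.1]) hs0.le)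
  have htM : Real.exp τ * (3 * (|M| + 1)) ≤ C := by
    rw [← le_div_iff₀ (by positivity)]
    exact (Real.le_log_iff_exp_le (by positivity)).1 (hτ.trans (min_le_right _ _))
  have hy : ∀ σ ∈ Icc (τ - (v - 1) / s) τ, 1 + s * (σ - (τ - (v - 1) / s)) ∈ Icc 1 c := by
    intro σ hσ
    have h1 : s * ((v - 1) / s) = v - 1 := by field_simp
    constructor
    · nlinarith [hσ.1]
    · nlinarith [hσ.2, hv.2]
  have h := (hb (τ - (v - 1) / s) (hle.trans (hτ.trans (min_le_left _ _)))).affine hle s ?_ ?_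
  · convert h using 1
    field_simp
    ring
  · intro σ hσ
    nlinarith [(hy σ hσ).2]
  · intro σ hσ
    obtain ⟨h1, h2⟩ := hy σ hσ
    set y := 1 + s * (σ - (τ - (v - 1) / s))
    have hyc : |y| ≤ c := by rwa [abs_of_nonneg (by linarith)]
    refine lt_of_lt_of_le ?_ (le_slopeForm hyc (Real.exp_pos σ).le s)
    rw [← hM]
    have h3 : C ≤ y * (((n : ℝ) - 1) - ((n : ℝ) - 2) * y) := by
      have : C ≤ ((n : ℝ) - 1) - ((n : ℝ) - 2) * y := by nlinarith
      nlinarith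
    have h4 : Real.exp σ * M ≤ C / 3 := by
      have : Real.exp σ ≤ Real.exp τ := Real.exp_le_exp.2 hσ.2
      nlinarith [le_abs_self M, abs_nonneg M, Real.exp_pos σ]
    have h5 : ((n : ℝ) - 1) * (s * (p + 1 + (q - 2) * y)) ≤ C / 3 := by
      rw [← hsC]
      gcongr
      nlinarith
    nlinarith [sq_nonneg (Real.exp σ)]

theorem exists_bernsteinProfile_of_reachesValue (hn : 3 ≤ n) (hq : q ≤ 2) (hκ : 0 < p + q - 1)
    (hc : 1 < c) (hcm : ((n : ℝ) - 2) * c < (n : ℝ) - 1) (hV : 0 < p + 1 - (2 - q) * c) :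
    ∃ b, ∀ τ ≥ b, ReachesValue n p q τ c → ∃ K ε G, 0 < ε ∧ BernsteinProfile n p q K ε G := by
  have hn' : (3 : ℝ) ≤ n := by exact_mod_cast hn
  have hm : 0 < (n : ℝ) - 1 := by linarith
  have hq2 : 0 ≤ 2 - q := by linarith
  obtain ⟨b₀, hb₀⟩ := exists_bernsteinProfile_of_reachesValue_one (n := n) (by lia) hκ
  set M := |(n : ℝ) - ((n : ℝ) - 1) * q + 1| * c + |((n : ℝ) - 1) * p| with hM
  have hM0 : 0 ≤ M := by positivity
  refine ⟨max b₀ (Real.log (M + 1)), fun τ₂ hτ₂ h2 => ?_⟩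
  have htM : M + 1 ≤ Real.exp τ₂ := (Real.log_le_iff_le_exp (by positivity)).1
    ((le_max_right _ _).trans hτ₂)
  have h3 := h2.affine (c' := τ₂ + (c - 1)) (by linarith) (-1) ?_ ?_
  · refine hb₀ (τ₂ + (c - 1)) ?_ (by simpa using h3)
    have : b₀ ≤ τ₂ := (le_max_left _ _).trans hτ₂
    linarith
  · intro τ hτ
    nlinarith [hτ.1]
  · intro τ hτ
    have hy1 : 1 ≤ c + -1 * (τ - τ₂) := by linarith [hτ.2]
    have hyc : c + -1 * (τ - τ₂) ≤ c := by linarith [hτ.1]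
    set y := c + -1 * (τ - τ₂)
    refine lt_of_lt_of_le ?_
      (le_slopeForm (abs_le.2 ⟨by linarith, hyc⟩) (Real.exp_pos τ).le (-1))
    rw [← hM]
    have h4 : 0 < y * (((n : ℝ) - 1) - ((n : ℝ) - 2) * y) :=
      mul_pos (by linarith) (by nlinarith)
    have h5 : M + 1 ≤ Real.exp τ := htM.trans (Real.exp_le_exp.2 hτ.1)
    have h6 : 0 < p + 1 + (q - 2) * y := by nlinarith
    nlinarith [mul_pos hm h6]

theorem quadratic_coeff_ge {a x ω m η : ℝ} (hq : q ≤ 2) (ha : 0 < a) (ha1 : a < 1)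
    (hωa : ω * a < 1) (hm : 0 ≤ m) (hη : 0 ≤ η)
    (hη' : m * (2 - q) * a ^ 2 * η ≤ (1 - a) * min 1 (1 - ω * a) / 2) (hx : 0 ≤ x) (hx1 : x ≤ 1) :
    (1 - a) * min 1 (1 - ω * a) / 2 ≤
      (1 - a * (1 - x)) * (1 - ω * (a * (1 - x))) - m * (2 - q) * η * (a * (1 - x)) * (a * x) := by
  set A := min 1 (1 - ω * a) with hA
  have hA0 : 0 < A := lt_min one_pos (by linarith)
  have h1 : A ≤ 1 - ω * (a * (1 - x)) := by
    have h2 : A ≤ 1 := min_le_left _ _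
    have h3 : A ≤ 1 - ω * a := min_le_right _ _
    nlinarith
  have h2 : (1 - a) * A ≤ (1 - a * (1 - x)) * (1 - ω * (a * (1 - x))) := by
    apply mul_le_mul _ h1 hA0.le <;> nlinarith [mul_nonneg ha.le hx]
  have h3 : m * (2 - q) * η * (a * (1 - x)) * (a * x) ≤ m * (2 - q) * a ^ 2 * η := by
    have h4 : 0 ≤ m * (2 - q) * a ^ 2 * η := by
      have : 0 ≤ 2 - q := by linarith
      positivity
    have h5 : (1 - x) * x ≤ 1 := by nlinarith
    nlinarith
  linarith

theorem curve_form_pos {a x t B A K K₁ C F : ℝ} (ha : 0 < a) (hx : 0 ≤ x) (hx1 : x ≤ 1)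
    (ht : 0 < t) (hC : 0 < C) (hA : 0 ≤ A) (hK₁ : |K₁| ≤ K) (hF : A ≤ F)
    (h : B < K * (a * x) → K * a ≤ A * t) (hB : 0 < B) :
    0 < C + (B + K₁ * (a * x)) * t + F * t ^ 2 := by
  have hK : 0 ≤ K := (abs_nonneg _).trans hK₁
  have hax : 0 ≤ a * x := by positivity
  have hlin : B - K * (a * x) ≤ B + K₁ * (a * x) := by
    nlinarith [(abs_le.1 hK₁).1]
  have hmain : 0 ≤ (B - K * (a * x)) * t + A * t ^ 2 := by
    rcases le_or_gt (K * (a * x)) B with hle | hlt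
    · have : 0 ≤ B - K * (a * x) := by linarith
      positivity
    · have h10 : K * (a * x) ≤ K * a := by
        have : a * x ≤ a := mul_le_of_le_one_right ha.le hx1
        gcongr
      nlinarith [h hlt]
  nlinarith [mul_le_mul_of_nonneg_right hlin ht.le,
    mul_le_mul_of_nonneg_right hF (sq_nonneg t)]

theorem exists_bernsteinProfile_of_params {a : ℝ} (hn : 3 ≤ n) (hq : q ≤ 2) (hκ : 0 < p + q - 1)
    (hc : 1 < c) (hcm : ((n : ℝ) - 2) * c < (n : ℝ) - 1) (hV : 0 < p + 1 - (2 - q) * c)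
    (ha : 0 < a) (ha1 : a < 1) (hωa : ((n : ℝ) - ((n : ℝ) - 1) * q) * a < 1)
    (hB : 0 < (1 - a) * (c * ((n : ℝ) - ((n : ℝ) - 1) * q + 1) - ((n : ℝ) - 1) * p) +
      ((n : ℝ) - 1) * a * c) :
    ∃ K ε G, 0 < ε ∧ BernsteinProfile n p q K ε G := by
  have hn' : (3 : ℝ) ≤ n := by exact_mod_cast hn
  have hm : 0 < (n : ℝ) - 1 := by linarith
  have hq2 : 0 ≤ 2 - q := by linarith
  obtain ⟨a₀, ha₀⟩ := exists_reachesValue_of_le hn hq hκ hcm hV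
  obtain ⟨b₀, hb₀⟩ := exists_bernsteinProfile_of_reachesValue hn hq hκ hc hcm hV
  set B := (1 - a) * (c * ((n : ℝ) - ((n : ℝ) - 1) * q + 1) - ((n : ℝ) - 1) * p) +
      ((n : ℝ) - 1) * a * c with hBdef
  set A := (1 - a) * min 1 (1 - ((n : ℝ) - ((n : ℝ) - 1) * q) * a) / 2 with hA
  have hA0 : 0 < A := by
    have : 0 < min 1 (1 - ((n : ℝ) - ((n : ℝ) - 1) * q) * a) := lt_min one_pos (by linarith)
    have : 0 < 1 - a := by linarith
    positivity
  set K := |((n : ℝ) - 1) - 2 * ((n : ℝ) - 2) * c| + 2 * ((n : ℝ) - 1) * (p + 1 - (2 - q) * c)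
    with hK
  have hK0 : 0 < K := by positivity
  obtain ⟨η, hη0, hη1, hη⟩ : ∃ η : ℝ, 0 < η ∧ η ≤ 1 ∧ ((n : ℝ) - 1) * (2 - q) * a ^ 2 * η ≤ A := by
    have hD : 0 < ((n : ℝ) - 1) * (2 - q) * a ^ 2 + 1 := by positivity
    refine ⟨min 1 (A / (((n : ℝ) - 1) * (2 - q) * a ^ 2 + 1)), lt_min one_pos (by positivity),
      min_le_left _ _, ?_⟩
    calc _ ≤ (((n : ℝ) - 1) * (2 - q) * a ^ 2 + 1) *
          (A / (((n : ℝ) - 1) * (2 - q) * a ^ 2 + 1)) := by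
          gcongr
          · linarith
          · exact min_le_right _ _
      _ = A := by field_simp
  have hK1 : |((n : ℝ) - 1) - 2 * ((n : ℝ) - 2) * c -
      ((n : ℝ) - 1) * (1 + η) * (p + 1 - (2 - q) * c)| ≤ K := by
    refine (abs_sub _ _).trans ?_
    rw [hK, abs_of_nonneg (a := ((n : ℝ) - 1) * (1 + η) * (p + 1 - (2 - q) * c)) (by positivity)]
    have := mul_le_mul_of_nonneg_right (mul_le_mul_of_nonneg_left hη1 hm.le) hV.le
    linarith
  set τ₂ := max b₀ (Real.log (K * a / A) - Real.log (B / (K * a)) / η)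
    with hτ₂
  have hBK : 0 < B / (K * a) := by positivity
  have hKA : 0 < K * a / A := by positivity
  set τ₁ := min (min a₀ τ₂) (Real.log (c - 1)) with hτ₁
  have hτ₁c : Real.exp τ₁ ≤ c - 1 :=
    (Real.le_log_iff_exp_le (by linarith)).1 (min_le_right _ _)
  have hτ₁₂ : τ₁ ≤ τ₂ := (min_le_left _ _).trans (min_le_right _ _)
  have hx : ∀ τ ≤ τ₂, Real.exp (η * (τ - τ₂)) ≤ 1 := fun τ hτ =>
    Real.exp_le_one_iff.2 (mul_nonpos_of_nonneg_of_nonpos hη0.le (by linarith))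
  have hz : ∀ τ ≤ τ₂, 0 ≤ a * (1 - Real.exp (η * (τ - τ₂))) := fun τ hτ =>
    mul_nonneg ha.le (by linarith [hx τ hτ])
  have h1 : ReachesValue n p q τ₁
      (c - a * (1 - Real.exp (η * (τ₁ - τ₂))) * Real.exp τ₁) := by
    refine ha₀ τ₁ ((min_le_left _ _).trans (min_le_left _ _)) _ ⟨?_, ?_⟩
    · have : a * (1 - Real.exp (η * (τ₁ - τ₂))) ≤ 1 := by
        nlinarith [Real.exp_pos (η * (τ₁ - τ₂))]
      nlinarith [Real.exp_pos τ₁]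
    · nlinarith [mul_nonneg (hz τ₁ hτ₁₂) (Real.exp_pos τ₁).le]
  refine hb₀ τ₂ (le_max_left _ _) ?_
  have h := h1.trans hτ₁₂ (hasDerivAt_curve c a η τ₂) (by fun_prop) rfl ?_ ?_
  · simpa using h
  · intro τ hτ
    have := mul_nonneg hq2 (mul_nonneg (hz τ hτ.2) (Real.exp_pos τ).le)
    linarith
  · intro τ hτ
    rw [slopeForm_curve, ← hBdef]
    have hx0 := Real.exp_pos (η * (τ - τ₂))
    have hx1 := hx τ hτ.2
    have hquad := quadratic_coeff_ge hq ha ha1 hωa hm.le hη0.le hη hx0.le hx1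
    rw [← hA] at hquad
    have hC : 0 < c * (((n : ℝ) - 1) - ((n : ℝ) - 2) * c) := mul_pos (by linarith) (by linarith)
    refine curve_form_pos ha hx0.le hx1 (Real.exp_pos τ) hC hA0.le hK1 hquad (fun hlt => ?_) hB
    have h5 : B / (K * a) ≤ Real.exp (η * (τ - τ₂)) := by
      rw [div_le_iff₀ (by positivity)]
      linarith
    have h6 : Real.log (B / (K * a)) ≤ η * (τ - τ₂) := (Real.log_le_iff_le_exp hBK).2 h5
    have h7 : Real.log (B / (K * a)) / η ≤ τ - τ₂ := by
      rw [div_le_iff₀ hη0]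
      linarith
    have h8 : Real.log (K * a / A) ≤ τ := by
      have := le_max_right b₀
        (Real.log (K * a / A) - Real.log (B / (K * a)) / η)
      rw [← hτ₂] at this
      linarith
    have := (Real.log_le_iff_le_exp hKA).1 h8
    rw [div_le_iff₀ hA0] at this
    linarith
end Construction

section Exponents

variable {n : ℕ} {p q : ℝ}

theorem exists_bernsteinProfile_of_one_le (hn : 3 ≤ n) (hq1 : 1 ≤ q) (hq2 : q ≤ 2)
    (hκ : 0 < p + q - 1) : ∃ K ε G, 0 < ε ∧ BernsteinProfile n p q K ε G := by
  have hn' : (3 : ℝ) ≤ n := by exact_mod_cast hn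
  have hc : Continuous fun δ : ℝ => ((n : ℝ) - 2) * (1 + δ) := by fun_prop
  have hV : Continuous fun δ : ℝ => p + 1 - (2 - q) * (1 + δ) := by fun_prop
  have hB : Continuous fun δ : ℝ => (1 - (1 - δ)) * ((1 + δ) * ((n : ℝ) - ((n : ℝ) - 1) * q + 1) -
      ((n : ℝ) - 1) * p) + ((n : ℝ) - 1) * (1 - δ) * (1 + δ) := by fun_prop
  have e1 : ∀ᶠ δ in 𝓝[>] (0 : ℝ), ((n : ℝ) - 2) * (1 + δ) < (n : ℝ) - 1 :=
    ((hc.tendsto 0).eventually (gt_mem_nhds (by simp))).filter_mono nhdsWithin_le_nhds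
  have e2 : ∀ᶠ δ in 𝓝[>] (0 : ℝ), 0 < p + 1 - (2 - q) * (1 + δ) :=
    ((hV.tendsto 0).eventually (lt_mem_nhds (by simp; linarith))).filter_mono nhdsWithin_le_nhds
  have e3 := ((hB.tendsto 0).eventually (lt_mem_nhds (a := 0)
    (by simp; linarith))).filter_mono (nhdsWithin_le_nhds (s := Ioi 0))
  have e4 : ∀ᶠ δ in 𝓝[>] (0 : ℝ), δ < 1 := nhdsWithin_le_nhds (gt_mem_nhds one_pos)
  obtain ⟨δ, ⟨⟨⟨h1, h2⟩, h3⟩, h4⟩, h0 : 0 < δ⟩ :=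
    ((((e1.and e2).and e3).and e4).and self_mem_nhdsWithin).exists
  refine exists_bernsteinProfile_of_params hn hq2 hκ (c := 1 + δ) (a := 1 - δ) (by linarith) h1 h2
    (by linarith) (by linarith) ?_ h3
  have : (n : ℝ) - ((n : ℝ) - 1) * q ≤ 1 := by nlinarith
  nlinarith

theorem three_mul_sqrt_add_six_lt (hn : 3 ≤ n) :
    3 * √((n : ℝ) + 6) < 4 + 4 * √((n : ℝ) - 1) := by
  have hn' : (3 : ℝ) ≤ n := by exact_mod_cast hn
  set r := √((n : ℝ) - 1) with hr
  have hr2 : r ^ 2 = (n : ℝ) - 1 := Real.sq_sqrt (by linarith)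
  have hr0 : 0 ≤ r := Real.sqrt_nonneg _
  have hr1 : 1.4 < r := Real.lt_sqrt_of_sq_lt (by norm_num; linarith)
  have : √((n : ℝ) + 6) < (4 + 4 * r) / 3 := by
    rw [Real.sqrt_lt' (by positivity)]
    nlinarith
  linarith

theorem exists_bernsteinProfile_of_lt_one (hn : 3 ≤ n) (hq0 : 0 ≤ q) (hq1 : q < 1)
    (hκ : 4 ≤ ((n : ℝ) - 1) * (p + q - 1))
    (hp : p ≤ 3 * Real.sqrt ((n : ℝ) + 6) / (2 * ((n : ℝ) - 2))) :
    ∃ K ε G, 0 < ε ∧ BernsteinProfile n p q K ε G := by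
  have hn' : (3 : ℝ) ≤ n := by exact_mod_cast hn
  have hm : 0 < (n : ℝ) - 1 := by linarith
  have hn2 : 0 < (n : ℝ) - 2 := by linarith
  have hκ0 : 0 < p + q - 1 := by
    by_contra! h
    nlinarith
  set ω := (n : ℝ) - ((n : ℝ) - 1) * q with hω
  set c := ((n : ℝ) - 1) / ((n : ℝ) - 2) with hc
  have hω1 : 1 < ω := by nlinarith
  have hω0 : 0 < ω := by linarith
  have hc1 : 1 < c := by rw [hc, one_lt_div hn2]; linarith
  have hcn : ((n : ℝ) - 2) * c = (n : ℝ) - 1 := by rw [hc]; field_simp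
  have hV0 : 0 ≤ p + 1 - (2 - q) * c := by
    have h1 : 0 ≤ ((n : ℝ) - 1) * (((n : ℝ) - 2) * (p + 1 - (2 - q) * c)) := by
      have h2 : ((n : ℝ) - 2) * (p + 1 - (2 - q) * c) =
          ((n : ℝ) - 2) * (p + q - 1) - (2 - q) := by linear_combination (-(2 - q)) * hcn
      rw [h2]
      nlinarith [mul_le_mul_of_nonneg_left hκ hn2.le]
    exact nonneg_of_mul_nonneg_right (nonneg_of_mul_nonneg_right h1 hm) hn2
  have hB0 : 0 < (1 - 1 / ω) * (c * (ω + 1) - ((n : ℝ) - 1) * p) +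
      ((n : ℝ) - 1) * (1 / ω) * c := by
    have hpn : p * ((n : ℝ) - 2) < 2 + 2 * √((n : ℝ) - 1) := by
      rw [le_div_iff₀ (by positivity)] at hp
      linarith [three_mul_sqrt_add_six_lt hn]
    have hr2 : √((n : ℝ) - 1) ^ 2 = (n : ℝ) - 1 := Real.sq_sqrt hm.le
    have hξ : 0 < 1 - q := by linarith
    have h1 : 0 < (1 - q) * (2 + ((n : ℝ) - 1) * (1 - q) - p * ((n : ℝ) - 2)) + 1 := by
      have h2 : 0 ≤ ((n : ℝ) - 1) * (1 - q) ^ 2 - 2 * √((n : ℝ) - 1) * (1 - q) + 1 := by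
        exact (sq_nonneg (√((n : ℝ) - 1) * (1 - q) - 1)).trans_eq
          (by linear_combination (1 - q) ^ 2 * hr2)
      nlinarith [mul_pos hξ (sub_pos.2 hpn)]
    have h2 : (1 - 1 / ω) * (c * (ω + 1) - ((n : ℝ) - 1) * p) + ((n : ℝ) - 1) * (1 / ω) * c =
        c * ((1 - q) * (2 + ((n : ℝ) - 1) * (1 - q) - p * ((n : ℝ) - 2)) + 1) *
          (((n : ℝ) - 1) / ω) := by
      have h3 : ω = 1 + ((n : ℝ) - 1) * (1 - q) := by rw [hω]; ring
      have h4 : (n : ℝ) - 1 = ((n : ℝ) - 2) * c := hcn.symm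
      rw [h3] at hω0 ⊢
      rw [hc]
      field_simp
      ring
    rw [h2]
    have : 0 < c := by linarith
    positivity
  have hcc : Continuous fun δ : ℝ => c - δ := by fun_prop
  have hac : Continuous fun δ : ℝ => 1 / ω - δ := by fun_prop
  have hBc : Continuous fun δ : ℝ => (1 - (1 / ω - δ)) * ((c - δ) * (ω + 1) - ((n : ℝ) - 1) * p) +
      ((n : ℝ) - 1) * (1 / ω - δ) * (c - δ) := by fun_prop
  have e1 := ((hcc.tendsto 0).eventually (lt_mem_nhds (a := 1) (by simpa using hc1))).filter_mono
    (nhdsWithin_le_nhds (s := Ioi 0))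
  have e2 := ((hac.tendsto 0).eventually (lt_mem_nhds (a := 0) (by simpa using hω0))).filter_mono
    (nhdsWithin_le_nhds (s := Ioi 0))
  have e3 := ((hBc.tendsto 0).eventually (lt_mem_nhds (a := 0)
    (by simpa only [sub_zero] using hB0))).filter_mono (nhdsWithin_le_nhds (s := Ioi 0))
  obtain ⟨δ, ⟨⟨h1, h2⟩, h3⟩, h0 : 0 < δ⟩ := (((e1.and e2).and e3).and self_mem_nhdsWithin).exists
  refine exists_bernsteinProfile_of_params hn (by linarith) hκ0 h1 ?_ ?_ h2 ?_ ?_ h3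
  · nlinarith
  · nlinarith
  · have : 1 / ω < 1 := by rw [div_lt_one hω0]; exact hω1
    linarith
  · rw [← hω, mul_sub, mul_one_div_cancel hω0.ne']
    nlinarith

theorem exists_bernsteinProfile_of_plateau {v : ℝ} (hn : 3 ≤ n) (hq : 2 < q) (hκ : 0 < p + q - 1)
    (hv : v < 1) (hV : 0 < p + 1 + (q - 2) * v) (hQ : ∀ t ≥ 1 - v, 0 < slopeForm n p q t v 0) :
    ∃ K ε G, 0 < ε ∧ BernsteinProfile n p q K ε G := by
  have hn' : (3 : ℝ) ≤ n := by exact_mod_cast hn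
  have hm : 0 < (n : ℝ) - 1 := by linarith
  have hn2 : 0 < (n : ℝ) - 2 := by linarith
  have hq2 : 0 < q - 2 := by linarith
  obtain ⟨a, ha⟩ := exists_reachesValue_one (n := n) hκ
  obtain ⟨b, hb⟩ := exists_bernsteinProfile_of_reachesValue_one (n := n) (by lia) hκ
  set s := min (Real.exp a) (1 / (2 * ((n : ℝ) - 1))) with hs
  have hs0 : 0 < s := lt_min (Real.exp_pos a) (by positivity)
  have hs1 : ((n : ℝ) - 1) * s ≤ 1 / 2 := by
    calc ((n : ℝ) - 1) * s ≤ ((n : ℝ) - 1) * (1 / (2 * ((n : ℝ) - 1))) := by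
          gcongr
          exact min_le_right _ _
      _ = 1 / 2 := by field_simp
  set c := 1 + s with hc
  have hcm : ((n : ℝ) - 2) * c < (n : ℝ) - 1 := by nlinarith
  have hcv : 0 < c - v := by linarith
  have h1 : ReachesValue n p q (Real.log s) 1 :=
    ha _ ((Real.log_le_iff_le_exp hs0).2 (min_le_left _ _))
  have h2 : ReachesValue n p q (Real.log (c - v)) v := by
    have h := h1.trans (c' := Real.log (c - v)) (y := fun τ => c - Real.exp τ)
      (y' := fun τ => -Real.exp τ) (Real.log_le_log hs0 (by linarith))
      (fun τ => (Real.hasDerivAt_exp τ).const_sub c) (by fun_prop)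
      (by simp [Real.exp_log hs0, hc]) ?_ ?_
    · simpa [Real.exp_log hcv] using h
    · intro τ hτ
      have : Real.exp τ ≤ c - v := (Real.le_log_iff_exp_le hcv).1 hτ.2
      nlinarith
    · intro τ hτ
      have h := slopeForm_curve (n := n) (p := p) (q := q) (c := c) (Real.exp τ) 1 0 0
      simp only [sub_zero, mul_one, one_mul, zero_mul, mul_zero, sub_self, add_zero, zero_add] at h
      rw [h]
      have ht := Real.exp_pos τ
      have h3 : 0 < c * (((n : ℝ) - 1) - ((n : ℝ) - 2) * c) :=
        mul_pos (by linarith) (by linarith)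
      have h4 : 0 < c := by linarith
      positivity
  set Y := max 1 |v| with hY
  set M := |(n : ℝ) - ((n : ℝ) - 1) * q + 1| * Y + |((n : ℝ) - 1) * p| with hM
  set N := Y * (((n : ℝ) - 1) + ((n : ℝ) - 2) * Y) + ((n : ℝ) - 1) * (p + q - 1) with hN
  have hY1 : 1 ≤ Y := le_max_left _ _
  have hM0 : 0 ≤ M := by positivity
  have hN0 : 0 ≤ N := by positivity
  set τ₁ := max (max b (Real.log (c - v))) (Real.log (M + N + 1)) with hτ₁
  have hle : Real.log (c - v) ≤ τ₁ := (le_max_right _ _).trans (le_max_left _ _)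
  have hbτ : b ≤ τ₁ := (le_max_left _ _).trans (le_max_left _ _)
  have h3 : ReachesValue n p q τ₁ v := by
    have h := h2.affine hle 0 (fun τ _ => by simpa using hV) (fun τ hτ => ?_)
    · simpa using h
    · rw [zero_mul, add_zero]
      refine hQ _ ?_
      have := (Real.log_le_iff_le_exp hcv).1 hτ.1
      linarith
  have h4 := h3.affine (c' := τ₁ + (1 - v)) (by linarith) 1 ?_ ?_
  · exact hb (τ₁ + (1 - v)) (by linarith) (by simpa using h4)
  · intro τ hτ
    nlinarith [hτ.1]
  · intro τ hτ
    have hyv : v ≤ v + 1 * (τ - τ₁) := by linarith [hτ.1]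
    have hy1 : v + 1 * (τ - τ₁) ≤ 1 := by linarith [hτ.2]
    set y := v + 1 * (τ - τ₁)
    have hyY : |y| ≤ Y := abs_le.2
      ⟨by linarith [neg_abs_le v, le_max_right 1 |v|], hy1.trans hY1⟩
    refine lt_of_lt_of_le ?_ (le_slopeForm hyY (Real.exp_pos τ).le 1)
    rw [← hM, one_mul]
    have ht : M + N + 1 ≤ Real.exp τ := (Real.log_le_iff_le_exp (by positivity)).1
      ((le_max_right _ _).trans hτ.1)
    have h5 : -(Y * (((n : ℝ) - 1) + ((n : ℝ) - 2) * Y)) ≤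
        y * (((n : ℝ) - 1) - ((n : ℝ) - 2) * y) := by
      have h6 : y ^ 2 ≤ Y ^ 2 := sq_le_sq' (abs_le.1 hyY).1 (abs_le.1 hyY).2
      nlinarith [(abs_le.1 hyY).1]
    have h7 : ((n : ℝ) - 1) * (p + 1 + (q - 2) * y) ≤ ((n : ℝ) - 1) * (p + q - 1) := by
      gcongr
      nlinarith
    nlinarith

theorem exists_bernsteinProfile_of_two_lt (hn : 3 ≤ n) (hq : 2 < q) (hκ : 0 < p + q - 1) :
    ∃ K ε G, 0 < ε ∧ BernsteinProfile n p q K ε G := by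
  have hn' : (3 : ℝ) ≤ n := by exact_mod_cast hn
  have hq2 : 0 < q - 2 := by linarith
  have hq1 : 0 < q - 1 := by linarith
  rcases le_or_gt 0 p with hp | hp
  · set Y := p / (q - 2) with hY
    have hY0 : 0 ≤ Y := by positivity
    have hp' : p = (q - 2) * Y := by rw [hY]; field_simp
    refine exists_bernsteinProfile_of_plateau hn hq hκ (v := -Y) (by linarith) (by linarith)
      fun t ht => ?_
    have : slopeForm n p q t (-Y) 0 =
        t ^ 2 + ((n : ℝ) - 3) * Y * t - Y * (((n : ℝ) - 1) + ((n : ℝ) - 2) * Y) := by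
      rw [hp']
      unfold slopeForm bernsteinForm
      ring
    rw [this]
    nlinarith [mul_nonneg (mul_nonneg (sub_nonneg.2 hn') hY0) (by linarith : 0 ≤ t - (1 + Y))]
  · set y := -p / (q - 1) with hy
    have hp' : p = -((q - 1) * y) := by rw [hy]; field_simp
    have hy0 : 0 < y := div_pos (by linarith) hq1
    have hy1 : y < 1 := by rw [hy, div_lt_one hq1]; linarith
    refine exists_bernsteinProfile_of_plateau hn hq hκ hy1 (by rw [hp']; linarith)
      fun t ht => ?_
    have : slopeForm n p q t y 0 =
        y * (((n : ℝ) - 1) - ((n : ℝ) - 2) * y) + 2 * y * t + t ^ 2 := by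
      rw [hp']
      unfold slopeForm bernsteinForm
      ring
    rw [this]
    have h1 : 0 < t := by linarith
    have h2 : 0 < ((n : ℝ) - 1) - ((n : ℝ) - 2) * y := by nlinarith
    positivity

theorem exists_bernsteinProfile (hn : 3 ≤ n) (hq : 0 ≤ q)
    (hp : p ≤ 3 * Real.sqrt ((n : ℝ) + 6) / (2 * ((n : ℝ) - 2))) :
    ∃ K ε G, 0 < ε ∧ BernsteinProfile n p q K ε G := by
  rcases lt_or_ge (((n : ℝ) - 1) * (p + q - 1)) 4 with hκ | hκ
  · exact exists_bernsteinProfile_of_lt hκ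
  have hκ0 : 0 < p + q - 1 := by
    have hn' : (3 : ℝ) ≤ n := by exact_mod_cast hn
    by_contra! h
    nlinarith
  rcases lt_or_ge q 1 with hq1 | hq1
  · exact exists_bernsteinProfile_of_lt_one hn hq hq1 hκ hp
  rcases le_or_gt q 2 with hq2 | hq2
  · exact exists_bernsteinProfile_of_one_le hn hq1 hq2 hκ0
  · exact exists_bernsteinProfile_of_two_lt hn hq2 hκ0

end Exponents

theorem norm_gradient_sq {n : ℕ} (u : EuclideanSpace ℝ (Fin n) → ℝ)
    (x : EuclideanSpace ℝ (Fin n)) : ‖gradient u x‖ ^ 2 = gradSq u x := by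
  rw [EuclideanSpace.norm_sq_eq, gradSq]
  refine Finset.sum_congr rfl fun i _ => ?_
  have : gradient u x i = pd i u x := by
    rw [pd, ← InnerProductSpace.toDual_symm_apply, EuclideanSpace.inner_single_right]
    simp [gradient]
  rw [Real.norm_eq_abs, sq_abs, this]

section Logarithm

variable {n : ℕ} {p q : ℝ} {u : EuclideanSpace ℝ (Fin n) → ℝ}

theorem pd_log (hu : ContDiff ℝ 2 u) (hpos : ∀ x, 0 < u x) (i : Fin n)
    (x : EuclideanSpace ℝ (Fin n)) : pd i (fun y => Real.log (u y)) x = pd i u x / u x := by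
  rw [pd_comp (Real.differentiableAt_log (hpos x).ne')
    (hu.differentiable (by norm_num)).differentiableAt, Real.deriv_log]
  ring

theorem gradSq_log (hu : ContDiff ℝ 2 u) (hpos : ∀ x, 0 < u x) (x : EuclideanSpace ℝ (Fin n)) :
    gradSq (fun y => Real.log (u y)) x = gradSq u x / u x ^ 2 := by
  simp only [gradSq, pd_log hu hpos, div_pow, Finset.sum_div]

theorem elaplacian_log (hu : ContDiff ℝ 2 u) (hpos : ∀ x, 0 < u x)
    (x : EuclideanSpace ℝ (Fin n)) :
    elaplacian (fun y => Real.log (u y)) x =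
      elaplacian u x / u x - gradSq (fun y => Real.log (u y)) x := by
  have hd : deriv Real.log = fun t => t⁻¹ := Real.deriv_log'
  rw [elaplacian_comp (Real.contDiffAt_log.2 (hpos x).ne') hu.contDiffAt, gradSq_log hu hpos, hd,
    deriv_inv, gradSq]
  ring

theorem log_solution (hu : ContDiff ℝ 2 u) (hpos : ∀ x, 0 < u x)
    (heq : ∀ x, elaplacian u x + ‖gradient u x‖ ^ q * u x ^ p = 0)
    (x : EuclideanSpace ℝ (Fin n)) :
    elaplacian (fun y => Real.log (u y)) x = -gradSq (fun y => Real.log (u y)) x -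
      gradSq (fun y => Real.log (u y)) x ^ (q / 2) * Real.exp ((p + q - 1) * Real.log (u x)) := by
  have hux := hpos x
  have h1 : ‖gradient u x‖ ^ q = gradSq u x ^ (q / 2) := by
    rw [← norm_gradient_sq, ← Real.rpow_natCast, ← Real.rpow_mul (norm_nonneg _)]
    congr 1
    push_cast
    ring
  have h2 : gradSq u x ^ (q / 2) =
      gradSq (fun y => Real.log (u y)) x ^ (q / 2) * u x ^ q := by
    have : gradSq u x = gradSq (fun y => Real.log (u y)) x * u x ^ 2 := by
      rw [gradSq_log hu hpos]
      field_simp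
    rw [this, Real.mul_rpow (gradSq_nonneg _) (by positivity), ← Real.rpow_natCast (u x),
      ← Real.rpow_mul hux.le]
    congr 2
    push_cast
    ring
  have h3 : Real.exp ((p + q - 1) * Real.log (u x)) = u x ^ q * u x ^ p / u x := by
    rw [mul_comm, ← Real.rpow_def_of_pos hux, Real.rpow_sub_one hux.ne', add_comm,
      Real.rpow_add hux]
  have h4 : elaplacian u x = -(gradSq u x ^ (q / 2) * u x ^ p) := by
    rw [← h1]
    linarith [heq x]
  rw [elaplacian_log hu hpos, h4, h2, h3]
  ring

theorem eq_of_gradSq_eq_zero (hu : Differentiable ℝ u) (h : ∀ x, gradSq u x = 0) (x y) :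
    u x = u y := by
  refine is_const_of_fderiv_eq_zero (𝕜 := ℝ) hu (fun z => ?_) x y
  have hz : ∀ i, pd i u z = 0 := fun i => by
    have := (Finset.sum_eq_zero_iff_of_nonneg fun i _ => sq_nonneg _).1 (h z) i (Finset.mem_univ i)
    exact pow_eq_zero_iff two_ne_zero |>.1 this
  refine ContinuousLinearMap.coe_injective
    ((EuclideanSpace.basisFun (Fin n) ℝ).toBasis.ext fun i => ?_)
  simpa [pd] using hz i

end Logarithm

/-- **Theorem 1.1, case (5).** For `n ≥ 3`, `q ≥ 0` and `p ≤ 3√(n+6)/(2(n−2))`, every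
positive classical solution of `Δu + |∇u|^q u^p = 0` on all of `ℝⁿ` is constant. -/
theorem liouville_small_p (n : ℕ) (hn : 3 ≤ n) (p q : ℝ)
    (hq : 0 ≤ q) (hp : p ≤ 3 * Real.sqrt ((n : ℝ) + 6) / (2 * ((n : ℝ) - 2)))
    (u : EuclideanSpace ℝ (Fin n) → ℝ)
    (hu : ContDiff ℝ 2 u)
    (hpos : ∀ x, 0 < u x)
    (heq : ∀ x, elaplacian u x + ‖gradient u x‖ ^ q * u x ^ p = 0) :
    ∀ x y, u x = u y := by
  obtain ⟨K, ε, G, hε, hG⟩ := exists_bernsteinProfile hn hq hp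
  refine eq_of_gradSq_eq_zero (hu.differentiable (by norm_num)) fun x => ?_
  have h := hG.gradSq_eq_zero (by lia) hq hε (hu.log fun x => (hpos x).ne')
    (log_solution hu hpos heq) x
  rw [gradSq_log hu hpos, div_eq_zero_iff] at h
  exact h.resolve_right (pow_ne_zero 2 (hpos x).ne')
end

section
/- Let n ≥ 2, let q ≥ 3/2 and let p ∈ ℝ. Every positive bounded classical solution u of Δu + |∇u|^q u^p = 0 on all of ℝ^n is constant. -/
open scoped BigOperators

open Set Filter Topology Metric

/-- First and second order necessary conditions at a global maximum on the line. -/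
theorem deriv_eq_zero_and_second_deriv_nonpos_of_max {f f' : ℝ → ℝ} {c : ℝ}
    (hf : ∀ t, HasDerivAt f (f' t) t) (hf' : HasDerivAt f' c 0) (hmax : ∀ t, f t ≤ f 0) :
    f' 0 = 0 ∧ c ≤ 0 := by
  have hloc : IsLocalMax f 0 := Eventually.of_forall hmax
  have h0 : f' 0 = 0 := hloc.hasDerivAt_eq_zero (hf 0)
  refine ⟨h0, ?_⟩
  by_contra! hc
  have hd : deriv f = f' := funext fun t => (hf t).deriv
  have hmin : IsLocalMin f 0 :=
    isLocalMin_of_deriv_deriv_pos (by rw [hd, hf'.deriv]; exact hc) (by rw [hd, h0])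
      (hf 0).continuousAt
  have hconst : f =ᶠ[𝓝 0] fun _ => f 0 := by
    filter_upwards [hmin] with t ht using le_antisymm (hmax t) ht
  have h1 : f' =ᶠ[𝓝 0] fun _ => 0 := by
    have := hconst.deriv
    rw [hd] at this
    simpa using this
  have h2 : c = 0 := by
    rw [← hf'.deriv, h1.deriv_eq]
    simp
  exact hc.ne' h2

/-- A bounded continuous function admits a maximizing pair for the penalized two-point functional
`z y - z x - ‖y - x‖ - δ ‖x‖²`. -/
theorem exists_max_two_point_penalized {n : ℕ} {z : EuclideanSpace ℝ (Fin n) → ℝ} {Z δ : ℝ}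
    (hz : Continuous z) (hz0 : ∀ x, 0 ≤ z x) (hzZ : ∀ x, z x ≤ Z) (hδ : 0 < δ) :
    ∃ a b, ∀ x y, z y - z x - ‖y - x‖ - δ * ‖x‖ ^ 2 ≤ z b - z a - ‖b - a‖ - δ * ‖a‖ ^ 2 := by
  let F : EuclideanSpace ℝ (Fin n) × EuclideanSpace ℝ (Fin n) → ℝ :=
    fun P => z P.2 - z P.1 - ‖P.2 - P.1‖ - δ * ‖P.1‖ ^ 2
  have hF : Continuous F := by fun_prop
  have hev : ∀ᶠ P in cocompact _, F P ≤ F 0 := by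
    rw [← Metric.cobounded_eq_cocompact]
    have hb : Bornology.IsBounded {P | ¬ F P ≤ F 0} := by
      refine (Metric.isBounded_closedBall
        (x := (0 : EuclideanSpace ℝ (Fin n) × EuclideanSpace ℝ (Fin n)))
        (r := Z + (Z / δ + 1))).subset ?_
      rintro ⟨x, y⟩ hP
      have hP' : 0 < z y - z x - ‖y - x‖ - δ * ‖x‖ ^ 2 := by
        have : F 0 < F (x, y) := not_le.1 hP
        simpa [F] using this
      have hx0 := norm_nonneg x
      have hyx := norm_nonneg (y - x)
      have h1 := hz0 x
      have h2 := hzZ y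
      have h3 : ‖x‖ ^ 2 ≤ Z / δ := by
        rw [le_div_iff₀ hδ]
        linarith
      have h4 : ‖x‖ ≤ Z / δ + 1 := by nlinarith
      have h5 : ‖y - x‖ ≤ Z := by nlinarith [mul_nonneg hδ.le (sq_nonneg ‖x‖)]
      have h6 : ‖y‖ ≤ ‖y - x‖ + ‖x‖ := by simpa using norm_add_le (y - x) x
      rw [mem_closedBall_zero_iff, Prod.norm_def]
      exact max_le (by simp only; linarith) (by simp only; linarith)
    have := Bornology.isBounded_def.1 hb
    filter_upwards [this] with P hP
    simpa using hP
  obtain ⟨P, hP⟩ := hF.exists_forall_ge' 0 hev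
  exact ⟨P.1, P.2, fun x y => hP (x, y)⟩

theorem norm_fderiv_eq_one_of_max_sub_dist {n : ℕ} {z : EuclideanSpace ℝ (Fin n) → ℝ}
    {a b : EuclideanSpace ℝ (Fin n)} {z' : EuclideanSpace ℝ (Fin n) →L[ℝ] ℝ}
    (hz : HasFDerivAt z z' b) (hab : a ≠ b)
    (hmax : ∀ y, z y - ‖y - a‖ ≤ z b - ‖b - a‖) : ‖z'‖ = 1 := by
  have hne : b - a ≠ 0 := sub_ne_zero.2 hab.symm
  have : Nontrivial (EuclideanSpace ℝ (Fin n)) := ⟨a, b, hab⟩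
  have hd : DifferentiableAt ℝ (fun x : EuclideanSpace ℝ (Fin n) => ‖x‖) (b - a) :=
    (contDiffAt_norm ℝ hne (n := 1)).differentiableAt (by norm_num)
  have hN : HasFDerivAt (fun y => ‖y - a‖) (fderiv ℝ (‖·‖) (b - a)) b := by
    have := hd.hasFDerivAt.comp b ((hasFDerivAt_id b).sub_const a)
    simpa [Function.comp_def] using this
  have hloc : IsLocalMax (fun y => z y - ‖y - a‖) b := Eventually.of_forall hmax
  have h0 := hloc.hasFDerivAt_eq_zero (hz.sub hN)
  rw [sub_eq_zero.1 h0]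
  exact norm_fderiv_norm hd

section Line

variable {n : ℕ} {u : EuclideanSpace ℝ (Fin n) → ℝ}

theorem hasDerivAt_comp_line (hu : Differentiable ℝ u) (x v : EuclideanSpace ℝ (Fin n)) (t : ℝ) :
    HasDerivAt (fun s : ℝ => u (x + s • v)) (fderiv ℝ u (x + t • v) v) t := by
  have hl : HasDerivAt (fun s : ℝ => x + s • v) v t := by
    simpa using ((hasDerivAt_id t).smul_const v).const_add x
  exact (hu _).hasFDerivAt.comp_hasDerivAt t hl

theorem hasDerivAt_comp_line_transform (hu : Differentiable ℝ u) {ψ S : ℝ → ℝ}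
    (hψ : ∀ s, HasDerivAt ψ (S s)⁻¹ s) (x v : EuclideanSpace ℝ (Fin n)) (t : ℝ) :
    HasDerivAt (fun s : ℝ => ψ (u (x + s • v)))
      ((S (u (x + t • v)))⁻¹ * fderiv ℝ u (x + t • v) v) t :=
  (hψ _).comp t (hasDerivAt_comp_line hu x v t)

theorem hasDerivAt_deriv_comp_line_transform (hu : ContDiff ℝ 2 u) {S : ℝ → ℝ} {S' : ℝ}
    (x v : EuclideanSpace ℝ (Fin n)) (hS : HasDerivAt S S' (u x)) (hpos : S (u x) ≠ 0) :
    HasDerivAt (fun s : ℝ => (S (u (x + s • v)))⁻¹ * fderiv ℝ u (x + s • v) v)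
      ((S (u x))⁻¹ * fderiv ℝ (fun y => fderiv ℝ u y v) x v
        - S' * (fderiv ℝ u x v) ^ 2 / S (u x) ^ 2) 0 := by
  have hd : Differentiable ℝ u := hu.differentiable (by norm_num)
  have hd' : Differentiable ℝ (fun y => fderiv ℝ u y v) := by
    have : ContDiff ℝ 1 (fderiv ℝ u) := hu.fderiv_right (by norm_num)
    exact (this.differentiable (by norm_num)).clm_apply (differentiable_const v)
  have h1 := hasDerivAt_comp_line hd x v 0
  have h2 := hasDerivAt_comp_line hd' x v 0
  simp only [zero_smul, add_zero] at h1 h2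
  have hS0 : HasDerivAt S S' (u (x + (0 : ℝ) • v)) := by simpa using hS
  have h3 := (hS0.comp (0 : ℝ) h1).inv (by simpa using hpos)
  have h4 := h3.mul h2
  refine h4.congr_deriv ?_
  simp
  ring

end Line

theorem fderiv_apply_single_eq_gradient {n : ℕ} (u : EuclideanSpace ℝ (Fin n) → ℝ)
    (x : EuclideanSpace ℝ (Fin n)) (i : Fin n) :
    fderiv ℝ u x (EuclideanSpace.single i 1) = gradient u x i := by
  rw [← toDual_gradient, InnerProductSpace.toDual_apply_apply]
  exact (EuclideanSpace.inner_single_right i (1 : ℝ) _).trans (by simp)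

theorem norm_gradient {n : ℕ} (u : EuclideanSpace ℝ (Fin n) → ℝ)
    (x : EuclideanSpace ℝ (Fin n)) : ‖gradient u x‖ = ‖fderiv ℝ u x‖ := by
  simp [gradient]

/-- Optimality conditions at a maximizing pair of the penalized two-point functional associated
with `z = ψ ∘ u`, where `ψ' = 1 / S`. -/
theorem two_point_max_conditions {n : ℕ} {u : EuclideanSpace ℝ (Fin n) → ℝ}
    (hu : ContDiff ℝ 2 u) {ψ S S' : ℝ → ℝ} (hψ : ∀ s, HasDerivAt ψ (S s)⁻¹ s)
    (hS : ∀ s, 0 < S s) {δ : ℝ} {a b : EuclideanSpace ℝ (Fin n)} (hab : a ≠ b)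
    (hSa : HasDerivAt S (S' (u a)) (u a)) (hSb : HasDerivAt S (S' (u b)) (u b))
    (hmax : ∀ x y, ψ (u y) - ψ (u x) - ‖y - x‖ - δ * ‖x‖ ^ 2
      ≤ ψ (u b) - ψ (u a) - ‖b - a‖ - δ * ‖a‖ ^ 2) :
    ‖gradient u b‖ = S (u b) ∧
    (S (u b))⁻¹ • gradient u b - (S (u a))⁻¹ • gradient u a = (2 * δ) • a ∧
    ((S (u b))⁻¹ * elaplacian u b - S' (u b) * ‖gradient u b‖ ^ 2 / S (u b) ^ 2)
      - ((S (u a))⁻¹ * elaplacian u a - S' (u a) * ‖gradient u a‖ ^ 2 / S (u a) ^ 2)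
      ≤ 2 * n * δ := by
  have hd : Differentiable ℝ u := hu.differentiable (by norm_num)
  have hline : ∀ i : Fin n,
      ((S (u b))⁻¹ * gradient u b i - (S (u a))⁻¹ * gradient u a i - 2 * δ * a i = 0) ∧
      (((S (u b))⁻¹ * fderiv ℝ (fun y => fderiv ℝ u y (EuclideanSpace.single i 1)) b
          (EuclideanSpace.single i 1) - S' (u b) * (gradient u b i) ^ 2 / S (u b) ^ 2)
        - ((S (u a))⁻¹ * fderiv ℝ (fun y => fderiv ℝ u y (EuclideanSpace.single i 1)) a
          (EuclideanSpace.single i 1) - S' (u a) * (gradient u a i) ^ 2 / S (u a) ^ 2)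
        - 2 * δ ≤ 0) := by
    intro i
    set v : EuclideanSpace ℝ (Fin n) := EuclideanSpace.single i 1 with hv
    have hpen : ∀ t : ℝ, ‖a + t • v‖ ^ 2 = ‖a‖ ^ 2 + 2 * t * a i + t ^ 2 := by
      intro t
      rw [norm_add_sq_real, real_inner_smul_right, norm_smul]
      simp [hv, EuclideanSpace.inner_single_right]
      ring
    have hp1 : ∀ t : ℝ, HasDerivAt (fun s : ℝ => δ * ‖a + s • v‖ ^ 2)
        (δ * (2 * a i + 2 * t)) t := by
      intro t
      simp only [hpen]
      have h1 : HasDerivAt (fun s : ℝ => 2 * s * a i) (2 * a i) t := by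
        simpa using ((hasDerivAt_id t).const_mul 2).mul_const (a i)
      have h2 : HasDerivAt (fun s : ℝ => s ^ 2) (2 * t) t := by
        simpa using hasDerivAt_pow 2 t
      exact ((h1.const_add _).add h2).const_mul δ
    have hp2 : HasDerivAt (fun t : ℝ => δ * (2 * a i + 2 * t)) (2 * δ) 0 := by
      have := (((hasDerivAt_id (0 : ℝ)).const_mul 2).const_add (2 * a i)).const_mul δ
      simpa [mul_comm] using this
    have hfirst := fun t : ℝ => ((hasDerivAt_comp_line_transform hd hψ b v t).sub
      (hasDerivAt_comp_line_transform hd hψ a v t)).sub (hp1 t)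
    have hsecond := ((hasDerivAt_deriv_comp_line_transform hu b v hSb (hS _).ne').sub
      (hasDerivAt_deriv_comp_line_transform hu a v hSa (hS _).ne')).sub hp2
    have key := deriv_eq_zero_and_second_deriv_nonpos_of_max hfirst hsecond (by
      intro t
      have := hmax (a + t • v) (b + t • v)
      simp only [add_sub_add_right_eq_sub] at this
      simp only [Pi.sub_apply, zero_smul, add_zero]
      linarith)
    simp only [zero_smul, add_zero, mul_zero, hv, fderiv_apply_single_eq_gradient] at key
    refine ⟨by linarith [key.1], ?_⟩
    simp only [← fderiv_apply_single_eq_gradient] at key ⊢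
    exact key.2
  refine ⟨?_, ?_, ?_⟩
  · have h1 : HasFDerivAt (fun y => ψ (u y)) ((S (u b))⁻¹ • fderiv ℝ u b) b :=
      (hψ (u b)).comp_hasFDerivAt b (hd b).hasFDerivAt
    have h2 := norm_fderiv_eq_one_of_max_sub_dist h1 hab (fun y => by
      have := hmax a y
      linarith)
    rw [norm_smul, norm_inv, Real.norm_of_nonneg (hS _).le, ← norm_gradient] at h2
    have := (hS (u b)).ne'
    field_simp at h2
    exact h2
  · ext i
    have := (hline i).1
    simp only [PiLp.sub_apply, PiLp.smul_apply, smul_eq_mul]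
    linarith
  · have hsum := Finset.sum_nonpos fun i (_ : i ∈ Finset.univ) => (hline i).2
    have hg : ∀ x, ‖gradient u x‖ ^ 2 = ∑ i, (gradient u x i) ^ 2 := fun x =>
      EuclideanSpace.real_norm_sq_eq _
    rw [hg, hg]
    simp only [elaplacian, Finset.mul_sum, Finset.sum_div]
    simp only [Finset.sum_sub_distrib, Finset.sum_const, Finset.card_univ, Fintype.card_fin,
      nsmul_eq_mul] at hsum
    linarith

set_option maxHeartbeats 800000 in
/-- Two-point comparison: if `ψ' = 1 / S` and the profile quantity `S ^ (q - 1) * s ^ p + S'` is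
strictly decreasing, then `ψ ∘ u` is `1`-Lipschitz. -/
theorem transform_sub_le_norm_sub {n : ℕ} {u : EuclideanSpace ℝ (Fin n) → ℝ} {p q : ℝ}
    (hu : ContDiff ℝ 2 u) (hpos : ∀ x, 0 < u x)
    (heq : ∀ x, elaplacian u x + ‖gradient u x‖ ^ q * u x ^ p = 0)
    {V Z L κ s₁ s₂ : ℝ} (hq : 1 ≤ q) (hV : ∀ x, u x < V) {ψ S S' : ℝ → ℝ}
    (hψ : ∀ s, HasDerivAt ψ (S s)⁻¹ s) (hs₁ : 0 < s₁) (hS₁ : ∀ s, s₁ ≤ S s)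
    (hS₂ : ∀ s, S s ≤ s₂) (hSd : ∀ s ∈ Ioo 0 V, HasDerivAt S (S' s) s)
    (hL : ∀ s ∈ Ioo 0 V, |S' s| ≤ L) (hκ : 0 < κ)
    (hH : ∀ v w, 0 < v → v < w → w < V →
      S w ^ (q - 1) * w ^ p + S' w + κ * (w - v) ≤ S v ^ (q - 1) * v ^ p + S' v)
    (hψ0 : ∀ x, 0 ≤ ψ (u x)) (hψZ : ∀ x, ψ (u x) ≤ Z) (x y : EuclideanSpace ℝ (Fin n)) :
    ψ (u y) - ψ (u x) ≤ ‖y - x‖ := by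
  by_contra! hcon
  have hSpos : ∀ s, 0 < S s := fun s => hs₁.trans_le (hS₁ s)
  have hmono : Monotone ψ := monotone_of_deriv_nonneg (fun s => (hψ s).differentiableAt)
    fun s => by rw [(hψ s).deriv]; exact (inv_pos.2 (hSpos s)).le
  have hlip : ∀ v w, ψ w - ψ v ≤ s₁⁻¹ * |w - v| := fun v w =>
    (le_abs_self _).trans <| convex_univ.norm_image_sub_le_of_norm_hasDerivWithin_le
      (f := ψ) (fun s _ => (hψ s).hasDerivWithinAt)
      (fun s _ => by
        rw [Real.norm_of_nonneg (inv_pos.2 (hSpos s)).le]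
        exact inv_anti₀ hs₁ (hS₁ s)) (mem_univ v) (mem_univ w)
  have hcont : Continuous fun x => ψ (u x) :=
    (continuous_iff_continuousAt.2 fun s => (hψ s).continuousAt).comp hu.continuous
  set σ := ψ (u y) - ψ (u x) - ‖y - x‖ with hσ
  have hσ0 : 0 < σ := by linarith
  set c := s₁ * (σ / 2) with hc
  have hc0 : 0 < c := by positivity
  have hV0 : 0 < V := (hpos x).trans (hV x)
  have hL0 : 0 ≤ L := (abs_nonneg _).trans (hL _ ⟨hpos x, hV x⟩)
  have hZ0 : 0 ≤ Z := (hψ0 x).trans (hψZ x)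
  set B := s₂ ^ (q - 1) * max (c ^ p) (V ^ p) + L with hB
  have hHB : ∀ w, c ≤ w → w < V → |S w ^ (q - 1) * w ^ p + S' w| ≤ B := by
    intro w hcw hwV
    have hw0 := hc0.trans_le hcw
    have h1 : w ^ p ≤ max (c ^ p) (V ^ p) := by
      rcases le_total 0 p with h | h
      · exact (Real.rpow_le_rpow hw0.le hwV.le h).trans (le_max_right _ _)
      · exact (Real.rpow_le_rpow_of_nonpos hc0 hcw h).trans (le_max_left _ _)
    have h2 : S w ^ (q - 1) ≤ s₂ ^ (q - 1) :=
      Real.rpow_le_rpow (hSpos w).le (hS₂ w) (by linarith)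
    have h3 : 0 ≤ S w ^ (q - 1) := Real.rpow_nonneg (hSpos w).le _
    have h4 : 0 ≤ w ^ p := Real.rpow_nonneg hw0.le _
    have h5 : S w ^ (q - 1) * w ^ p ≤ s₂ ^ (q - 1) * max (c ^ p) (V ^ p) :=
      mul_le_mul h2 h1 h4 (h3.trans h2)
    calc _ ≤ |S w ^ (q - 1) * w ^ p| + |S' w| := abs_add_le _ _
      _ ≤ B := by
        rw [abs_of_nonneg (mul_nonneg h3 h4)]
        exact add_le_add h5 (hL w ⟨hw0, hwV⟩)
  let F : ℝ × ℝ → ℝ := fun P =>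
    P.1 ^ q * (κ * c) - |P.1 ^ q - 1| * B - |P.1 ^ 2 - P.1 ^ q| * L - 2 * n * P.2
  have hF : ContinuousAt F (1, 0) := by
    have h1 : ContinuousAt (fun P : ℝ × ℝ => P.1 ^ q) (1, 0) :=
      continuousAt_fst.rpow_const (Or.inl (by norm_num))
    have h2 : ContinuousAt (fun P : ℝ × ℝ => P.1 ^ 2) (1, 0) := continuousAt_fst.pow 2
    exact (((h1.mul continuousAt_const).sub ((h1.sub continuousAt_const).abs.mul
      continuousAt_const)).sub ((h2.sub h1).abs.mul continuousAt_const)).sub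
      (continuousAt_const.mul continuousAt_snd)
  have hF0 : 0 < F (1, 0) := by
    have : 0 < κ * c := by positivity
    simpa [F] using this
  obtain ⟨ε, hε, hball⟩ := Metric.eventually_nhds_iff.1 (hF.eventually (lt_mem_nhds hF0))
  obtain ⟨δ, hδ, hδε, hδZ, hδx⟩ : ∃ δ > 0, δ < ε ∧ 4 * δ * Z < ε ^ 2 ∧ δ * ‖x‖ ^ 2 ≤ σ / 2 := by
    have ht1 : Tendsto (fun δ : ℝ => 4 * δ * Z) (𝓝 0) (𝓝 0) := by
      have : Continuous fun δ : ℝ => 4 * δ * Z := by fun_prop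
      simpa using this.tendsto 0
    have ht2 : Tendsto (fun δ : ℝ => δ * ‖x‖ ^ 2) (𝓝 0) (𝓝 0) := by
      have : Continuous fun δ : ℝ => δ * ‖x‖ ^ 2 := by fun_prop
      simpa using this.tendsto 0
    have hev := (((gt_mem_nhds hε).and ((ht1.eventually (gt_mem_nhds (pow_pos hε 2))).and
      (ht2.eventually (gt_mem_nhds (half_pos hσ0))))).filter_mono
      (nhdsWithin_le_nhds (s := Ioi 0))).and self_mem_nhdsWithin
    obtain ⟨δ, ⟨h1, h2, h3⟩, h4⟩ := hev.exists
    exact ⟨δ, h4, h1, h2, h3.le⟩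
  obtain ⟨a, b, hmax⟩ := exists_max_two_point_penalized hcont hψ0 hψZ hδ
  have hval := hmax x y
  have hna : 0 ≤ δ * ‖a‖ ^ 2 := by positivity
  have hnb := norm_nonneg (b - a)
  have hgap : σ / 2 ≤ ψ (u b) - ψ (u a) := by linarith
  have hab : a ≠ b := by
    rintro rfl
    linarith
  have hlt : u a < u b := by
    by_contra! h
    linarith [hmono h]
  have hcw : c ≤ u b - u a := by
    have h1 := hgap.trans (hlip (u a) (u b))
    rw [abs_of_pos (sub_pos.2 hlt), inv_mul_eq_div, le_div_iff₀ hs₁] at h1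
    linarith
  have ha := hpos a
  have hb := hpos b
  obtain ⟨hgb, hgab, hlap⟩ := two_point_max_conditions hu hψ hSpos hab
    (hSd _ ⟨ha, hV a⟩) (hSd _ ⟨hb, hV b⟩) hmax
  set r := ‖gradient u a‖ / S (u a) with hr
  have hSa := hSpos (u a)
  have hSb := hSpos (u b)
  have hr0 : 0 ≤ r := div_nonneg (norm_nonneg _) hSa.le
  have hga : ‖gradient u a‖ = r * S (u a) := by rw [hr]; field_simp
  have hr1 : |r - 1| < ε := by
    have h1 : ‖(S (u a))⁻¹ • gradient u a‖ = r := by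
      rw [norm_smul, norm_inv, Real.norm_of_nonneg hSa.le, hr, inv_mul_eq_div]
    have h2 : ‖(S (u b))⁻¹ • gradient u b‖ = 1 := by
      rw [norm_smul, norm_inv, Real.norm_of_nonneg hSb.le, hgb, inv_mul_cancel₀ hSb.ne']
    have h3 := abs_norm_sub_norm_le ((S (u b))⁻¹ • gradient u b) ((S (u a))⁻¹ • gradient u a)
    rw [h1, h2, hgab, norm_smul, Real.norm_of_nonneg (by positivity), abs_sub_comm] at h3
    refine h3.trans_lt (lt_of_pow_lt_pow_left₀ 2 hε.le ?_)
    have h4 : δ * ‖a‖ ^ 2 ≤ Z := by linarith [hψ0 a, hψZ b]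
    calc (2 * δ * ‖a‖) ^ 2 = 4 * δ * (δ * ‖a‖ ^ 2) := by ring
      _ ≤ 4 * δ * Z := by gcongr
      _ < ε ^ 2 := hδZ
  have hFpos : 0 < F (r, δ) := by
    refine hball ?_
    rw [Prod.dist_eq, max_lt_iff, Real.dist_eq, Real.dist_eq, sub_zero, abs_of_pos hδ]
    exact ⟨hr1, hδε⟩
  have hpow : ∀ s : ℝ, 0 < s → s⁻¹ * s ^ q = s ^ (q - 1) := fun s hs => by
    rw [Real.rpow_sub_one hs.ne', inv_mul_eq_div]
  have hlb : (S (u b))⁻¹ * elaplacian u b = -(S (u b) ^ (q - 1) * u b ^ p) := by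
    rw [eq_neg_of_add_eq_zero_left (heq b), hgb, ← hpow _ hSb]
    ring
  have hla : (S (u a))⁻¹ * elaplacian u a = -(r ^ q * (S (u a) ^ (q - 1) * u a ^ p)) := by
    rw [eq_neg_of_add_eq_zero_left (heq a), hga, Real.mul_rpow hr0 hSa.le, ← hpow _ hSa]
    ring
  have hqb : S' (u b) * ‖gradient u b‖ ^ 2 / S (u b) ^ 2 = S' (u b) := by
    rw [hgb]
    field_simp
  have hqa : S' (u a) * ‖gradient u a‖ ^ 2 / S (u a) ^ 2 = S' (u a) * r ^ 2 := by
    rw [hga]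
    field_simp
  rw [hlb, hla, hqb, hqa] at hlap
  have hdec := hH _ _ ha hlt (hV b)
  have hκc : κ * c ≤ κ * (u b - u a) := by gcongr
  have hrq : 0 ≤ r ^ q := Real.rpow_nonneg hr0 q
  have hbd := hHB (u b) (by linarith) (hV b)
  have hLa := hL _ ⟨ha, hV a⟩
  set Hb := S (u b) ^ (q - 1) * u b ^ p + S' (u b) with hHb
  set Aa := S (u a) ^ (q - 1) * u a ^ p with hAa
  have e1 : r ^ q * (Hb + κ * c) ≤ r ^ q * (Aa + S' (u a)) :=
    mul_le_mul_of_nonneg_left (by linarith) hrq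
  have e2 : -(|r ^ q - 1| * B) ≤ (r ^ q - 1) * Hb := by
    refine neg_le_of_neg_le ((neg_le_abs _).trans ?_)
    rw [abs_mul]
    exact mul_le_mul_of_nonneg_left hbd (abs_nonneg _)
  have e3 : -(|r ^ 2 - r ^ q| * L) ≤ (r ^ 2 - r ^ q) * S' (u a) := by
    refine neg_le_of_neg_le ((neg_le_abs _).trans ?_)
    rw [abs_mul]
    exact mul_le_mul_of_nonneg_left hLa (abs_nonneg _)
  simp only [F] at hFpos
  linarith

/-- A gradient profile `T` on `[0, V]` for which `T ^ (q - 1) * s ^ p + T'` is strictly decreasing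
bounds the Lipschitz constant of every solution with values in `(0, V)`. -/
theorem abs_sub_le_of_profile {n : ℕ} {u : EuclideanSpace ℝ (Fin n) → ℝ} {p q : ℝ}
    (hu : ContDiff ℝ 2 u) (hpos : ∀ x, 0 < u x)
    (heq : ∀ x, elaplacian u x + ‖gradient u x‖ ^ q * u x ^ p = 0)
    {V L κ s₁ s₂ : ℝ} (hq : 1 ≤ q) (hV : ∀ x, u x < V) {T T' : ℝ → ℝ}
    (hT : ContinuousOn T (Icc 0 V)) (hs₁ : 0 < s₁) (hT₁ : ∀ s ∈ Icc 0 V, s₁ ≤ T s)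
    (hT₂ : ∀ s ∈ Icc 0 V, T s ≤ s₂) (hTd : ∀ s ∈ Ioo 0 V, HasDerivAt T (T' s) s)
    (hL : ∀ s ∈ Ioo 0 V, |T' s| ≤ L) (hκ : 0 < κ)
    (hH : ∀ v w, 0 < v → v < w → w < V →
      T w ^ (q - 1) * w ^ p + T' w + κ * (w - v) ≤ T v ^ (q - 1) * v ^ p + T' v)
    (x y : EuclideanSpace ℝ (Fin n)) : |u y - u x| ≤ s₂ * ‖y - x‖ := by
  have hV0 : 0 ≤ V := ((hpos x).trans (hV x)).le
  let S : ℝ → ℝ := IccExtend hV0 ((Icc 0 V).domRestrict T)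
  have hSc : Continuous S := (continuousOn_iff_continuous_domRestrict.1 hT).Icc_extend'
  have hST : ∀ s ∈ Icc 0 V, S s = T s := fun s hs => IccExtend_of_mem hV0 _ hs
  have hS₁ : ∀ s, s₁ ≤ S s := fun s => hT₁ _ (projIcc 0 V hV0 s).2
  have hS₂ : ∀ s, S s ≤ s₂ := fun s => hT₂ _ (projIcc 0 V hV0 s).2
  have hSpos : ∀ s, 0 < S s := fun s => hs₁.trans_le (hS₁ s)
  have hSd : ∀ s ∈ Ioo 0 V, HasDerivAt S (T' s) s := fun s hs =>
    (hTd s hs).congr_of_eventuallyEq <| by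
      filter_upwards [Ioo_mem_nhds hs.1 hs.2] with t ht using hST t (Ioo_subset_Icc_self ht)
  let ψ : ℝ → ℝ := fun v => ∫ s in (0 : ℝ)..v, (S s)⁻¹
  have hψ : ∀ s, HasDerivAt ψ (S s)⁻¹ s := fun s =>
    ((hSc.inv₀ fun t => (hSpos t).ne').integral_hasStrictDerivAt 0 s).hasDerivAt
  have hmono : Monotone ψ := monotone_of_deriv_nonneg (fun s => (hψ s).differentiableAt)
    fun s => by rw [(hψ s).deriv]; exact (inv_pos.2 (hSpos s)).le
  have hψ0 : ψ 0 = 0 := intervalIntegral.integral_same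
  have hmono' : Monotone fun s => s₂ * ψ s - s := by
    have hd : ∀ s, HasDerivAt (fun s => s₂ * ψ s - s) (s₂ * (S s)⁻¹ - 1) s := fun s =>
      ((hψ s).const_mul s₂).sub (hasDerivAt_id s)
    refine monotone_of_deriv_nonneg (fun s => (hd s).differentiableAt) fun s => ?_
    rw [(hd s).deriv, sub_nonneg, ← div_eq_mul_inv, one_le_div (hSpos s)]
    exact hS₂ s
  have hs₂ : 0 ≤ s₂ := (hSpos 0).le.trans (hS₂ 0)
  have hmain : ∀ x y, u y - u x ≤ s₂ * ‖y - x‖ := by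
    intro x y
    rcases le_total (u x) (u y) with h | h
    · have h1 := transform_sub_le_norm_sub hu hpos heq hq hV hψ hs₁ hS₁ hS₂ hSd hL hκ
        (fun v w hv hvw hw => by
          rw [hST v ⟨hv.le, (hvw.trans hw).le⟩, hST w ⟨(hv.trans hvw).le, hw.le⟩]
          exact hH v w hv hvw hw)
        (fun x => hψ0 ▸ hmono (hpos x).le) (fun x => hmono (hV x).le) x y
      have h2 := hmono' h
      simp only at h2
      nlinarith [mul_le_mul_of_nonneg_left h1 hs₂]
    · exact (sub_nonpos.2 h).trans (by positivity)
  rw [abs_le]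
  refine ⟨?_, hmain x y⟩
  have := hmain y x
  rw [norm_sub_rev] at this
  linarith

/-- For a positive exponent `p` there are arbitrarily small gradient profiles, obtained by solving
`T' = h - κ s - T ^ (q - 1) * s ^ p`. -/
theorem exists_small_profile {p q V ε : ℝ} (hp : 0 < p) (hq : 1 < q) (hV : 0 < V) (hε : 0 < ε) :
    ∃ (T T' : ℝ → ℝ) (L κ s₁ : ℝ), ContinuousOn T (Icc 0 V) ∧ 0 < s₁ ∧
      (∀ s ∈ Icc 0 V, s₁ ≤ T s) ∧ (∀ s ∈ Icc 0 V, T s ≤ ε) ∧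
      (∀ s ∈ Ioo 0 V, HasDerivAt T (T' s) s) ∧ (∀ s ∈ Ioo 0 V, |T' s| ≤ L) ∧ 0 < κ ∧
      ∀ v w, 0 < v → v < w → w < V →
        T w ^ (q - 1) * w ^ p + T' w + κ * (w - v) ≤ T v ^ (q - 1) * v ^ p + T' v := by
  set h := ε / (4 * V) with hh
  have hh0 : 0 < h := by positivity
  have hhV : h * V = ε / 4 := by rw [hh]; field_simp
  set κ := h / (2 * V) with hκ
  have hκ0 : 0 < κ := by positivity
  have hκV : κ * V = h / 2 := by rw [hκ]; field_simp
  obtain ⟨s₁, hs₁, hs₁ε, hs₁h⟩ : ∃ s₁ > 0, s₁ < ε / 2 ∧ s₁ ^ (q - 1) * V ^ p < h / 2 := by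
    have ht : Tendsto (fun s : ℝ => s ^ (q - 1) * V ^ p) (𝓝 0) (𝓝 0) := by
      have : Continuous fun s : ℝ => s ^ (q - 1) * V ^ p :=
        (Real.continuous_rpow_const (by linarith)).mul continuous_const
      simpa [Real.zero_rpow (sub_pos.2 hq).ne'] using this.tendsto 0
    have hev := (((gt_mem_nhds (half_pos hε)).and
      (ht.eventually (gt_mem_nhds (half_pos hh0)))).filter_mono
      (nhdsWithin_le_nhds (s := Ioi 0))).and self_mem_nhdsWithin
    obtain ⟨s, ⟨h1, h2⟩, h3⟩ := hev.exists
    exact ⟨s, h3, h1, h2⟩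
  have hle : s₁ ≤ ε := by linarith
  let P : ℝ → ℝ := fun x => projIcc s₁ ε hle x
  have hPm : ∀ x, P x ∈ Icc s₁ ε := fun x => (projIcc s₁ ε hle x).2
  have hP0 : ∀ x, 0 ≤ P x := fun x => hs₁.le.trans (hPm x).1
  have hPε : ∀ x, P x ^ (q - 1) ≤ ε ^ (q - 1) := fun x =>
    Real.rpow_le_rpow (hP0 x) (hPm x).2 (by linarith)
  obtain ⟨K, hK⟩ : ∃ K, LipschitzWith K fun x => P x ^ (q - 1) := by
    have hc : ContDiffOn ℝ 1 (fun x : ℝ => x ^ (q - 1)) (Icc s₁ ε) := fun x hx =>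
      (Real.contDiffAt_rpow_const_of_ne (hs₁.trans_le hx.1).ne').contDiffWithinAt
    obtain ⟨K, hK⟩ := hc.exists_lipschitzOnWith one_ne_zero (convex_Icc s₁ ε) isCompact_Icc
    refine ⟨K * 1, ?_⟩
    have hP1 : LipschitzWith 1 P := by
      simpa [Function.comp_def] using
        (LipschitzWith.subtype_val (Icc s₁ ε)).comp (LipschitzWith.projIcc hle)
    exact lipschitzOnWith_univ.1 (hK.comp hP1.lipschitzOnWith fun x _ => hPm x)
  let f : ℝ → ℝ → ℝ := fun t x => h - κ * t - P x ^ (q - 1) * t ^ p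
  have htp : ∀ t ∈ Icc 0 V, 0 ≤ t ^ p ∧ t ^ p ≤ V ^ p := fun t ht =>
    ⟨Real.rpow_nonneg ht.1 p, Real.rpow_le_rpow ht.1 ht.2 hp.le⟩
  have hVp : 0 ≤ V ^ p := Real.rpow_nonneg hV.le p
  have hεq : 0 ≤ ε ^ (q - 1) := Real.rpow_nonneg hε.le _
  have hterm : ∀ t ∈ Icc 0 V, ∀ x,
      0 ≤ P x ^ (q - 1) * t ^ p ∧ P x ^ (q - 1) * t ^ p ≤ ε ^ (q - 1) * V ^ p := fun t ht x =>
    ⟨mul_nonneg (Real.rpow_nonneg (hP0 x) _) (htp t ht).1,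
      mul_le_mul (hPε x) (htp t ht).2 (htp t ht).1 hεq⟩
  set L := h + ε ^ (q - 1) * V ^ p with hLdef
  have hL0 : 0 ≤ L := by positivity
  have hfL : ∀ t ∈ Icc 0 V, ∀ x, |f t x| ≤ L := by
    intro t ht x
    have h1 := hterm t ht x
    have h2 : κ * t ≤ κ * V := mul_le_mul_of_nonneg_left ht.2 hκ0.le
    have h3 : 0 ≤ κ * t := mul_nonneg hκ0.le ht.1
    simp only [f, abs_le]
    constructor <;> linarith
  have hPL : IsPicardLindelof f (⟨0, left_mem_Icc.2 hV.le⟩ : Icc 0 V) s₁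
      (L.toNNReal * V.toNNReal) 0 L.toNNReal (K * (V ^ p).toNNReal) := by
    refine ⟨fun t ht => ?_, fun x _ => ?_, fun t ht x _ => ?_, ?_⟩
    · refine LipschitzWith.lipschitzOnWith (LipschitzWith.of_dist_le_mul fun x y => ?_)
      have h1 := hK.dist_le_mul x y
      have h2 : dist (f t x) (f t y) = dist (P x ^ (q - 1)) (P y ^ (q - 1)) * t ^ p := by
        simp only [f, Real.dist_eq, sub_sub_sub_cancel_left]
        rw [← sub_mul, abs_mul, abs_of_nonneg (htp t ht).1, abs_sub_comm]
      rw [h2, NNReal.coe_mul, Real.coe_toNNReal _ hVp, mul_right_comm]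
      exact mul_le_mul h1 (htp t ht).2 (htp t ht).1 (by positivity)
    · have : Continuous fun t : ℝ => h - κ * t - P x ^ (q - 1) * t ^ p :=
        (continuous_const.sub (continuous_const.mul continuous_id)).sub
          (continuous_const.mul (Real.continuous_rpow_const hp.le))
      exact this.continuousOn
    · rw [Real.coe_toNNReal _ hL0]
      exact hfL t ht x
    · simp [hL0, hV.le]
  obtain ⟨T, hT0, hTd⟩ := hPL.exists_eq_forall_mem_Icc_hasDerivWithinAt₀
  simp only at hT0
  have hTc : ContinuousOn T (Icc 0 V) := fun t ht => (hTd t ht).continuousWithinAt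
  have hTr : ∀ t ∈ Ico 0 V, HasDerivWithinAt T (f t (T t)) (Ici t) t := fun t ht =>
    (hTd t ⟨ht.1, ht.2.le⟩).mono_of_mem_nhdsWithin (Icc_mem_nhdsGE_of_mem ht)
  have hTlow : ∀ t ∈ Icc 0 V, s₁ ≤ T t := by
    intro t ht
    have := image_le_of_deriv_right_lt_deriv_boundary (f := fun t => -T t)
      (f' := fun t => -f t (T t)) (B := fun _ => -s₁) (B' := fun _ => 0) hTc.neg
      (fun t ht => (hTr t ht).neg) (by simp [hT0]) (fun t => hasDerivAt_const t _)
      (fun t ht hts => by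
        have hts' : T t = s₁ := neg_injective hts
        have hPs : P s₁ = s₁ := by simp [P]
        have h1 := (htp t ⟨ht.1, ht.2.le⟩).2
        have h2 : κ * t ≤ κ * V := mul_le_mul_of_nonneg_left ht.2.le hκ0.le
        have h3 : s₁ ^ (q - 1) * t ^ p ≤ s₁ ^ (q - 1) * V ^ p :=
          mul_le_mul_of_nonneg_left h1 (Real.rpow_nonneg hs₁.le _)
        simp only [f, hts', hPs]
        linarith) ht
    simpa using this
  have hTup : ∀ t ∈ Icc 0 V, T t ≤ ε := by
    intro t ht
    have hB : ∀ t : ℝ, HasDerivAt (fun t => s₁ + 2 * h * t) (2 * h) t := fun t => by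
      simpa using ((hasDerivAt_id t).const_mul (2 * h)).const_add s₁
    have h1 := image_le_of_deriv_right_lt_deriv_boundary hTc hTr (by simp [hT0]) hB
      (fun t ht _ => by
        have h1 := (hterm t ⟨ht.1, ht.2.le⟩ (T t)).1
        have h2 : 0 ≤ κ * t := mul_nonneg hκ0.le ht.1
        simp only [f]
        linarith) ht
    have h2 : h * t ≤ h * V := mul_le_mul_of_nonneg_left ht.2 hh0.le
    linarith
  have hPT : ∀ t ∈ Icc 0 V, P (T t) = T t := fun t ht => by
    simp only [P, projIcc_of_mem hle ⟨hTlow t ht, hTup t ht⟩]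
  refine ⟨T, fun t => f t (T t), L, κ, s₁, hTc, hs₁, hTlow, hTup,
    fun t ht => (hTd t (Ioo_subset_Icc_self ht)).hasDerivAt (Icc_mem_nhds ht.1 ht.2),
    fun t ht => hfL t (Ioo_subset_Icc_self ht) _, hκ0, fun v w hv hvw hw => ?_⟩
  simp only [f, hPT v ⟨hv.le, (hvw.trans hw).le⟩, hPT w ⟨(hv.trans hvw).le, hw.le⟩]
  linarith

/-- Arbitrarily small gradient profiles for a nonpositive exponent `p`. -/
theorem exists_small_profile_of_nonpos {p q V ε : ℝ} (hp : p ≤ 0) (hq : 1 ≤ q) (hV : 0 < V)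
    (hε : 0 < ε) :
    ∃ (T T' : ℝ → ℝ) (L κ s₁ : ℝ), ContinuousOn T (Icc 0 V) ∧ 0 < s₁ ∧
      (∀ s ∈ Icc 0 V, s₁ ≤ T s) ∧ (∀ s ∈ Icc 0 V, T s ≤ ε) ∧
      (∀ s ∈ Ioo 0 V, HasDerivAt T (T' s) s) ∧ (∀ s ∈ Ioo 0 V, |T' s| ≤ L) ∧ 0 < κ ∧
      ∀ v w, 0 < v → v < w → w < V →
        T w ^ (q - 1) * w ^ p + T' w + κ * (w - v) ≤ T v ^ (q - 1) * v ^ p + T' v := by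
  set k := ε / (2 * V ^ 2) with hk
  have hk0 : 0 < k := by positivity
  have hkV : k * V ^ 2 = ε / 2 := by rw [hk]; field_simp
  have hsq : ∀ s ∈ Icc 0 V, k * s ^ 2 ≤ ε / 2 := fun s hs => by
    rw [← hkV]
    exact mul_le_mul_of_nonneg_left (pow_le_pow_left₀ hs.1 hs.2 2) hk0.le
  refine ⟨fun s => ε - k * s ^ 2, fun s => -(k * (2 * s)), k * (2 * V), 2 * k, ε / 2, ?_,
    half_pos hε, fun s hs => ?_, fun s hs => ?_, fun s hs => ?_, fun s hs => ?_, by positivity,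
    fun v w hv hvw hw => ?_⟩
  · fun_prop
  · have := hsq s hs
    simp only
    linarith
  · have : 0 ≤ k * s ^ 2 := by positivity
    simp only
    linarith
  · simpa using ((hasDerivAt_pow 2 s).const_mul k).const_sub ε
  · have h1 := hs.1
    rw [abs_neg, abs_of_nonneg (by positivity)]
    have := hs.2.le
    gcongr
  · have hw0 := hv.trans hvw
    have h1 : ε - k * w ^ 2 ≤ ε - k * v ^ 2 := by gcongr
    have h2 : 0 ≤ ε - k * w ^ 2 := by linarith [hsq w ⟨hw0.le, hw.le⟩]
    have h3 : (ε - k * w ^ 2) ^ (q - 1) * w ^ p ≤ (ε - k * v ^ 2) ^ (q - 1) * v ^ p :=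
      mul_le_mul (Real.rpow_le_rpow h2 h1 (by linarith))
        (Real.rpow_le_rpow_of_nonpos hv hvw.le hp) (Real.rpow_nonneg hw0.le _)
        (Real.rpow_nonneg (h2.trans h1) _)
    simp only
    linarith

/-- **Theorem 1.2 (bounded case, `q ≥ 3/2`).** For `n ≥ 2`, `q ≥ 3/2` and `p ∈ ℝ`, every
positive bounded classical solution of `Δu + |∇u|^q u^p = 0` on all of `ℝⁿ` is constant. -/
theorem liouville_bounded_q_ge_three_halves (n : ℕ) (hn : 2 ≤ n) (p q : ℝ)
    (hq : 3 / 2 ≤ q)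
    (u : EuclideanSpace ℝ (Fin n) → ℝ)
    (hu : ContDiff ℝ 2 u)
    (hpos : ∀ x, 0 < u x)
    (hbdd : ∃ M : ℝ, ∀ x, u x ≤ M)
    (heq : ∀ x, elaplacian u x + ‖gradient u x‖ ^ q * u x ^ p = 0) :
    ∀ x y, u x = u y := by
  obtain ⟨M, hM⟩ := hbdd
  have hV : ∀ x, u x < M + 1 := fun x => (hM x).trans_lt (lt_add_one M)
  have hV0 : 0 < M + 1 := (hpos 0).trans (hV 0)
  intro x y
  have hsmall : ∀ ε > 0, |u x - u y| ≤ ε * ‖x - y‖ := by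
    intro ε hε
    obtain ⟨T, T', L, κ, s₁, hT, hs₁, hT₁, hT₂, hTd, hL, hκ, hH⟩ := (le_or_gt p 0).elim
      (fun hp => exists_small_profile_of_nonpos hp (show 1 ≤ q by linarith) hV0 hε)
      (fun hp => exists_small_profile hp (show 1 < q by linarith) hV0 hε)
    exact abs_sub_le_of_profile hu hpos heq (by linarith) hV hT hs₁ hT₁ hT₂ hTd hL hκ hH y x
  have ht : Tendsto (fun ε : ℝ => ε * ‖x - y‖) (𝓝[>] 0) (𝓝 0) := by
    have : Continuous fun ε : ℝ => ε * ‖x - y‖ := by fun_prop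
    simpa using (this.tendsto 0).mono_left nhdsWithin_le_nhds
  have h0 : |u x - u y| ≤ 0 :=
    ge_of_tendsto ht (by filter_upwards [self_mem_nhdsWithin] with ε hε using hsmall ε hε)
  exact sub_eq_zero.1 (abs_nonpos_iff.1 h0)
end
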